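/- Let n ≥ 2, T ∈ ℝ, and let g be a smooth time-dependent metric on ℝ^n over the interval (−∞, T) solving the Ricci flow, such that g(t) is complete for every t ∈ (−∞, T) (an ancient solution). Then the scalar curvature is nonnegative: R(x,t) ≥ 0 for all (x,t) ∈ ℝ^n × (−∞, T). -/

import Mathlib

open Set MeasureTheory
open scoped BigOperators Matrix

noncomputable section

variable {n : ℕ}

/-- Partial derivative of `f` at `x` in the `i`-th coordinate direction. -/
def pd (f : (Fin n → ℝ) → ℝ) (i : Fin n) (x : Fin n → ℝ) : ℝ :=
  fderiv ℝ f x (Pi.single i 1)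

/-- Christoffel symbols `Γ^k_{ij}` of a (time-independent) metric `G`. -/
def christoffel (G : (Fin n → ℝ) → Matrix (Fin n) (Fin n) ℝ)
    (x : Fin n → ℝ) (k i j : Fin n) : ℝ :=
  (1/2) * ∑ l, (G x)⁻¹ k l *
    (pd (fun y => G y j l) i x + pd (fun y => G y i l) j x - pd (fun y => G y i j) l x)

/-- Ricci tensor `R_{jk}`. -/
def ricci (G : (Fin n → ℝ) → Matrix (Fin n) (Fin n) ℝ)
    (x : Fin n → ℝ) (j k : Fin n) : ℝ :=
  ∑ i, (pd (fun y => christoffel G y i j k) i x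
      - pd (fun y => christoffel G y i i k) j x
      + ∑ p, (christoffel G x i i p * christoffel G x p j k
            - christoffel G x i j p * christoffel G x p i k))

/-- Scalar curvature. -/
def scalarCurv (G : (Fin n → ℝ) → Matrix (Fin n) (Fin n) ℝ) (x : Fin n → ℝ) : ℝ :=
  ∑ j, ∑ k, (G x)⁻¹ j k * ricci G x j k

/-- Riemann tensor `R_{ijkl}`. -/
def riemann (G : (Fin n → ℝ) → Matrix (Fin n) (Fin n) ℝ)
    (x : Fin n → ℝ) (i j k l : Fin n) : ℝ :=
  ∑ m, G x l m *
    (pd (fun y => christoffel G y m j k) i x - pd (fun y => christoffel G y m i k) j x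
      + ∑ p, (christoffel G x m i p * christoffel G x p j k
            - christoffel G x m j p * christoffel G x p i k))

/-- Norm of the Riemann tensor. -/
def riemNorm (G : (Fin n → ℝ) → Matrix (Fin n) (Fin n) ℝ) (x : Fin n → ℝ) : ℝ :=
  Real.sqrt (∑ i, ∑ j, ∑ k, ∑ l, ∑ a, ∑ b, ∑ c, ∑ d,
    (G x)⁻¹ i a * (G x)⁻¹ j b * (G x)⁻¹ k c * (G x)⁻¹ l d *
      riemann G x i j k l * riemann G x a b c d)

/-- Sectional curvature of the plane spanned by `u`, `v`. -/
def sectionalCurv (G : (Fin n → ℝ) → Matrix (Fin n) (Fin n) ℝ)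
    (x : Fin n → ℝ) (u v : Fin n → ℝ) : ℝ :=
  (∑ i, ∑ j, ∑ k, ∑ l, riemann G x i j k l * u i * v j * v k * u l) /
    ((∑ i, ∑ j, G x i j * u i * u j) * (∑ i, ∑ j, G x i j * v i * v j)
      - (∑ i, ∑ j, G x i j * u i * v j) ^ 2)

/-- Length of a path with respect to the metric `G`. -/
def pathLength (G : (Fin n → ℝ) → Matrix (Fin n) (Fin n) ℝ)
    (γ : ℝ → (Fin n → ℝ)) : ℝ :=
  ∫ s in (0:ℝ)..1, Real.sqrt (∑ i, ∑ j, G (γ s) i j * deriv γ s i * deriv γ s j)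

/-- Riemannian distance: infimum of lengths of C¹ paths. -/
def riemDist (G : (Fin n → ℝ) → Matrix (Fin n) (Fin n) ℝ)
    (x y : Fin n → ℝ) : ℝ :=
  sInf {L : ℝ | ∃ γ : ℝ → (Fin n → ℝ),
    ContDiffOn ℝ 1 γ (Icc 0 1) ∧ γ 0 = x ∧ γ 1 = y ∧ L = pathLength G γ}

/-- Metric ball. -/
def rBall (G : (Fin n → ℝ) → Matrix (Fin n) (Fin n) ℝ)
    (x₀ : Fin n → ℝ) (r : ℝ) : Set (Fin n → ℝ) :=
  {x | riemDist G x₀ x < r}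

/-- Completeness of `(ℝⁿ, riemDist G)`. -/
def riemComplete (G : (Fin n → ℝ) → Matrix (Fin n) (Fin n) ℝ) : Prop :=
  ∀ u : ℕ → (Fin n → ℝ),
    (∀ ε > (0:ℝ), ∃ N, ∀ p ≥ N, ∀ q ≥ N, riemDist G (u p) (u q) < ε) →
    ∃ x, ∀ ε > (0:ℝ), ∃ N, ∀ p ≥ N, riemDist G (u p) x < ε

/-- Riemannian volume of a set. -/
def riemVol (G : (Fin n → ℝ) → Matrix (Fin n) (Fin n) ℝ)
    (S : Set (Fin n → ℝ)) : ℝ :=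
  ∫ x in S, Real.sqrt ((G x).det)

/-- A smooth (time-independent) Riemannian metric. -/
def SmoothMetric (G : (Fin n → ℝ) → Matrix (Fin n) (Fin n) ℝ) : Prop :=
  (∀ i j, ContDiff ℝ (⊤ : ℕ∞) (fun x => G x i j)) ∧ ∀ x, (G x).IsSymm ∧ (G x).PosDef

/-- A smooth time-dependent metric over the time interval `I`. -/
def SmoothMetricFamily (g : (Fin n → ℝ) → ℝ → Matrix (Fin n) (Fin n) ℝ)
    (I : Set ℝ) : Prop :=
  (∀ i j, ContDiffOn ℝ (⊤ : ℕ∞) (fun p : (Fin n → ℝ) × ℝ => g p.1 p.2 i j) (univ ×ˢ I)) ∧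
  ∀ x : Fin n → ℝ, ∀ t ∈ I, (g x t).IsSymm ∧ (g x t).PosDef

/-- The Ricci flow equation `∂ₜ g = -2 Ric` over the time interval `I`. -/
def IsRicciFlow (g : (Fin n → ℝ) → ℝ → Matrix (Fin n) (Fin n) ℝ)
    (I : Set ℝ) : Prop :=
  ∀ x : Fin n → ℝ, ∀ t ∈ I, ∀ j k,
    derivWithin (fun s => g x s j k) I t = -2 * ricci (fun y => g y t) x j k

/-- `lam ≥ mu ≥ nu` are the eigenvalues of the 3×3 matrix `M`
(characterized via the characteristic polynomial). -/
def IsEigTriple (M : Matrix (Fin 3) (Fin 3) ℝ) (lam mu nu : ℝ) : Prop :=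
  nu ≤ mu ∧ mu ≤ lam ∧
  ∀ z : ℝ, (z • (1 : Matrix (Fin 3) (Fin 3) ℝ) - M).det = (z - lam) * (z - mu) * (z - nu)

/-- Hamilton's curvature operator `g^{il}(R g_{lj} - 2 R_{lj})` in dimension 3. -/
def curvOp (G : (Fin 3 → ℝ) → Matrix (Fin 3) (Fin 3) ℝ) (x : Fin 3 → ℝ) :
    Matrix (Fin 3) (Fin 3) ℝ :=
  Matrix.of fun i j => ∑ l, (G x)⁻¹ i l * (scalarCurv G x * G x l j - 2 * ricci G x l j)


open scoped ContDiff Topology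

/-- The space-time domain `ℝⁿ × (-∞, T)`. -/
def dom (n : ℕ) (T : ℝ) : Set ((Fin n → ℝ) × ℝ) := univ ×ˢ Iio T

lemma isOpen_dom (n : ℕ) (T : ℝ) : IsOpen (dom n T) := isOpen_univ.prod isOpen_Iio

lemma mem_dom {T : ℝ} {p : (Fin n → ℝ) × ℝ} : p ∈ dom n T ↔ p.2 < T := by
  simp [dom]

/-- Smooth functions on the space-time domain. -/
def SmoothOn (T : ℝ) (F : (Fin n → ℝ) × ℝ → ℝ) : Prop := ContDiffOn ℝ ∞ F (dom n T)

/-- Directional derivative of a space-time function. -/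
def dd (w : (Fin n → ℝ) × ℝ) (F : (Fin n → ℝ) × ℝ → ℝ) (p : (Fin n → ℝ) × ℝ) : ℝ :=
  fderiv ℝ F p w

/-- The `i`-th spatial direction in space-time. -/
def ex (i : Fin n) : (Fin n → ℝ) × ℝ := (Pi.single i 1, 0)

/-- The time direction in space-time. -/
def et : (Fin n → ℝ) × ℝ := (0, 1)

namespace SmoothOn

variable {T : ℝ} {F F' : (Fin n → ℝ) × ℝ → ℝ}

lemma contDiffAt (h : SmoothOn T F) {p : (Fin n → ℝ) × ℝ} (hp : p.2 < T) :
    ContDiffAt ℝ ∞ F p :=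
  ContDiffOn.contDiffAt h ((isOpen_dom n T).mem_nhds (mem_dom.2 hp))

lemma differentiableAt (h : SmoothOn T F) {p : (Fin n → ℝ) × ℝ} (hp : p.2 < T) :
    DifferentiableAt ℝ F p :=
  (h.contDiffAt hp).differentiableAt (by simp)

lemma continuousOn (h : SmoothOn T F) : ContinuousOn F (dom n T) := ContDiffOn.continuousOn h

lemma const (c : ℝ) : SmoothOn T (fun _ : (Fin n → ℝ) × ℝ => c) := contDiffOn_const

lemma add (h : SmoothOn T F) (h' : SmoothOn T F') : SmoothOn T (fun p => F p + F' p) :=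
  ContDiffOn.add h h'

lemma sub (h : SmoothOn T F) (h' : SmoothOn T F') : SmoothOn T (fun p => F p - F' p) :=
  ContDiffOn.sub h h'

lemma mul (h : SmoothOn T F) (h' : SmoothOn T F') : SmoothOn T (fun p => F p * F' p) :=
  ContDiffOn.mul h h'

lemma sum {ι : Type*} {s : Finset ι} {F : ι → (Fin n → ℝ) × ℝ → ℝ}
    (h : ∀ i ∈ s, SmoothOn T (F i)) : SmoothOn T (fun p => ∑ i ∈ s, F i p) :=
  ContDiffOn.sum h

lemma prod {ι : Type*} {s : Finset ι} {F : ι → (Fin n → ℝ) × ℝ → ℝ}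
    (h : ∀ i ∈ s, SmoothOn T (F i)) : SmoothOn T (fun p => ∏ i ∈ s, F i p) :=
  contDiffOn_prod h

lemma inv (h : SmoothOn T F) (h0 : ∀ p ∈ dom n T, F p ≠ 0) : SmoothOn T (fun p => (F p)⁻¹) :=
  ContDiffOn.inv h h0

lemma congr (h : SmoothOn T F) (h' : ∀ p ∈ dom n T, F' p = F p) : SmoothOn T F' :=
  ContDiffOn.congr h h'

lemma dd (h : SmoothOn T F) (w : (Fin n → ℝ) × ℝ) : SmoothOn T (dd w F) := by
  have h1 : ContDiffOn ℝ ∞ (fderiv ℝ F) (dom n T) :=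
    ContDiffOn.fderiv_of_isOpen h (isOpen_dom n T) (by simp)
  exact h1.clm_apply contDiffOn_const

end SmoothOn

section dd

variable {T : ℝ} {F F' : (Fin n → ℝ) × ℝ → ℝ} {p : (Fin n → ℝ) × ℝ} (w : (Fin n → ℝ) × ℝ)

lemma dd_congr (hp : p.2 < T) (h' : ∀ q ∈ dom n T, F' q = F q) : dd w F' p = dd w F p := by
  have : F' =ᶠ[𝓝 p] F := by
    filter_upwards [(isOpen_dom n T).mem_nhds (mem_dom.2 hp)] with q hq using h' q hq
  unfold dd
  rw [this.fderiv_eq]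

lemma dd_const (c : ℝ) : dd w (fun _ => c) p = 0 := by simp [dd]

lemma dd_add (hp : p.2 < T) (h : SmoothOn T F) (h' : SmoothOn T F') :
    dd w (fun q => F q + F' q) p = dd w F p + dd w F' p := by
  unfold dd
  rw [fderiv_fun_add (h.differentiableAt hp) (h'.differentiableAt hp)]; rfl

lemma dd_sub (hp : p.2 < T) (h : SmoothOn T F) (h' : SmoothOn T F') :
    dd w (fun q => F q - F' q) p = dd w F p - dd w F' p := by
  unfold dd
  rw [fderiv_fun_sub (h.differentiableAt hp) (h'.differentiableAt hp)]; rfl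

lemma dd_mul (hp : p.2 < T) (h : SmoothOn T F) (h' : SmoothOn T F') :
    dd w (fun q => F q * F' q) p = dd w F p * F' p + F p * dd w F' p := by
  unfold dd
  rw [fderiv_fun_mul (h.differentiableAt hp) (h'.differentiableAt hp)]
  simp; ring

lemma dd_const_mul (hp : p.2 < T) (c : ℝ) (h : SmoothOn T F) :
    dd w (fun q => c * F q) p = c * dd w F p := by
  rw [dd_mul w hp (SmoothOn.const c) h, dd_const]; ring

lemma dd_sum (hp : p.2 < T) {ι : Type*} {s : Finset ι} {F : ι → (Fin n → ℝ) × ℝ → ℝ}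
    (h : ∀ i ∈ s, SmoothOn T (F i)) :
    dd w (fun q => ∑ i ∈ s, F i q) p = ∑ i ∈ s, dd w (F i) p := by
  unfold dd
  rw [fderiv_fun_sum (fun i hi => (h i hi).differentiableAt hp)]
  simp

lemma dd_comm (hp : p.2 < T) (h : SmoothOn T F) (w' : (Fin n → ℝ) × ℝ) :
    dd w (dd w' F) p = dd w' (dd w F) p := by
  have hs : IsSymmSndFDerivAt ℝ F p := (h.contDiffAt hp).isSymmSndFDerivAt
    (by simpa using (ENat.LEInfty.out : (2 : WithTop ℕ∞) ≤ ∞))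
  have hd : DifferentiableAt ℝ (fderiv ℝ F) p :=
    ((h.contDiffAt hp).fderiv_right (m := 1)
      (ENat.LEInfty.out : (2 : WithTop ℕ∞) ≤ ∞)).differentiableAt (by simp)
  have key : ∀ v u : (Fin n → ℝ) × ℝ, dd v (dd u F) p = fderiv ℝ (fderiv ℝ F) p v u := by
    intro v u
    unfold dd
    rw [fderiv_clm_apply hd (differentiableAt_const _)]
    simp
  rw [key, key]
  exact hs w w'

lemma pd_eq_dd {f : (Fin n → ℝ) × ℝ → ℝ} (hf : DifferentiableAt ℝ f p) (i : Fin n) :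
    pd (fun y => f (y, p.2)) i p.1 = dd (ex i) f p := by
  unfold pd dd ex
  have h1 : HasFDerivAt (fun y : Fin n → ℝ => (y, p.2)) (ContinuousLinearMap.inl ℝ _ ℝ) p.1 :=
    hasFDerivAt_prodMk_left p.1 p.2
  have h2 := HasFDerivAt.comp (g := f) p.1 (hf.hasFDerivAt) h1
  have h3 : fderiv ℝ (fun y : Fin n → ℝ => f (y, p.2)) p.1 = _ := h2.fderiv
  rw [h3]; simp

lemma hasDerivAt_dd_time {f : (Fin n → ℝ) × ℝ → ℝ} (hf : DifferentiableAt ℝ f p) :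
    HasDerivAt (fun s => f (p.1, s)) (dd et f p) p.2 := by
  unfold dd et
  have h1 : HasFDerivAt (fun s : ℝ => (p.1, s)) (ContinuousLinearMap.inr ℝ (Fin n → ℝ) ℝ) p.2 :=
    hasFDerivAt_prodMk_right p.1 p.2
  have h2 := HasFDerivAt.comp (g := f) p.2 (hf.hasFDerivAt) h1
  have h3 := h2.hasDerivAt
  simp only [ContinuousLinearMap.comp_apply, ContinuousLinearMap.inr_apply] at h3
  exact h3

end dd

/-- Entrywise directional derivative of a matrix-valued function. -/
def dm (w : (Fin n → ℝ) × ℝ) (M : (Fin n → ℝ) × ℝ → Matrix (Fin n) (Fin n) ℝ)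
    (p : (Fin n → ℝ) × ℝ) : Matrix (Fin n) (Fin n) ℝ :=
  Matrix.of fun i j => dd w (fun q => M q i j) p

/-- Matrix-valued functions with smooth entries. -/
def MSmooth (T : ℝ) (M : (Fin n → ℝ) × ℝ → Matrix (Fin n) (Fin n) ℝ) : Prop :=
  ∀ i j, SmoothOn T (fun q => M q i j)

section dm

variable {T : ℝ} {M N : (Fin n → ℝ) × ℝ → Matrix (Fin n) (Fin n) ℝ} {p : (Fin n → ℝ) × ℝ}
  (w : (Fin n → ℝ) × ℝ)

lemma dm_apply (i j : Fin n) : dm w M p i j = dd w (fun q => M q i j) p := rfl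

lemma MSmooth.add (h : MSmooth T M) (h' : MSmooth T N) : MSmooth T (fun q => M q + N q) :=
  fun i j => (h i j).add (h' i j)

lemma MSmooth.sub (h : MSmooth T M) (h' : MSmooth T N) : MSmooth T (fun q => M q - N q) :=
  fun i j => (h i j).sub (h' i j)

lemma MSmooth.mul (h : MSmooth T M) (h' : MSmooth T N) : MSmooth T (fun q => M q * N q) :=
  fun i j => by
    simp only [Matrix.mul_apply]
    exact SmoothOn.sum fun k _ => (h i k).mul (h' k j)

lemma MSmooth.transpose (h : MSmooth T M) : MSmooth T (fun q => (M q)ᵀ) := fun i j => h j i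

lemma MSmooth.dm (h : MSmooth T M) : MSmooth T (dm w M) := fun i j => (h i j).dd w

lemma MSmooth.det (h : MSmooth T M) : SmoothOn T (fun q => (M q).det) := by
  simp only [Matrix.det_apply']
  exact SmoothOn.sum fun σ _ => (SmoothOn.const _).mul (SmoothOn.prod fun i _ => h _ _)

lemma MSmooth.inv (h : MSmooth T M) (h0 : ∀ q ∈ dom n T, (M q).det ≠ 0) :
    MSmooth T (fun q => (M q)⁻¹) := fun i j => by
  simp only [Matrix.inv_def, Matrix.smul_apply, Ring.inverse_eq_inv', smul_eq_mul,
    Matrix.adjugate_apply]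
  refine (h.det.inv h0).mul (MSmooth.det fun k l => ?_)
  by_cases hk : k = j
  · subst hk
    simp only [Matrix.updateRow_self]
    exact SmoothOn.const _
  · simp only [Matrix.updateRow_ne hk]
    exact h k l

lemma dm_congr (hp : p.2 < T) (h' : ∀ q ∈ dom n T, N q = M q) : dm w N p = dm w M p := by
  ext i j
  exact dd_congr w hp fun q hq => by rw [h' q hq]

lemma dm_const (C : Matrix (Fin n) (Fin n) ℝ) : dm w (fun _ => C) p = 0 := by
  ext i j
  exact dd_const w _

lemma dm_add (hp : p.2 < T) (h : MSmooth T M) (h' : MSmooth T N) :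
    dm w (fun q => M q + N q) p = dm w M p + dm w N p := by
  ext i j
  exact dd_add w hp (h i j) (h' i j)

lemma dm_sub (hp : p.2 < T) (h : MSmooth T M) (h' : MSmooth T N) :
    dm w (fun q => M q - N q) p = dm w M p - dm w N p := by
  ext i j
  exact dd_sub w hp (h i j) (h' i j)

lemma dm_mul (hp : p.2 < T) (h : MSmooth T M) (h' : MSmooth T N) :
    dm w (fun q => M q * N q) p = dm w M p * N p + M p * dm w N p := by
  ext i j
  simp only [dm_apply, Matrix.mul_apply, Matrix.add_apply]
  rw [dd_sum w hp fun k _ => (h i k).mul (h' k j), ← Finset.sum_add_distrib]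
  exact Finset.sum_congr rfl fun k _ => dd_mul w hp (h i k) (h' k j)

lemma dm_transpose : dm w (fun q => (M q)ᵀ) p = (dm w M p)ᵀ := rfl

lemma dm_comm (hp : p.2 < T) (h : MSmooth T M) (w' : (Fin n → ℝ) × ℝ) :
    dm w (dm w' M) p = dm w' (dm w M) p := by
  ext i j
  exact dd_comm w hp (h i j) w'

lemma dm_inv (hp : p.2 < T) (h : MSmooth T M) (h0 : ∀ q ∈ dom n T, (M q).det ≠ 0) :
    dm w (fun q => (M q)⁻¹) p = -((M p)⁻¹ * dm w M p * (M p)⁻¹) := by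
  have hu : ∀ q ∈ dom n T, IsUnit (M q).det := fun q hq => isUnit_iff_ne_zero.2 (h0 q hq)
  have h1 : dm w (fun q => (M q)⁻¹ * M q) p = 0 := by
    rw [← dm_const w 1]
    exact dm_congr w hp fun q hq => Matrix.nonsing_inv_mul _ (hu q hq)
  rw [dm_mul w hp (h.inv h0) h] at h1
  have h2 := congrArg (· * (M p)⁻¹) h1
  simp only [add_mul, zero_mul] at h2
  rw [Matrix.mul_assoc (dm w _ p), Matrix.mul_nonsing_inv _ (hu p (mem_dom.2 hp)),
    Matrix.mul_one] at h2
  exact eq_neg_of_add_eq_zero_left h2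

end dm

section geometry

/-- The metric as a matrix-valued function on space-time. -/
def gm (g : (Fin n → ℝ) → ℝ → Matrix (Fin n) (Fin n) ℝ) (p : (Fin n → ℝ) × ℝ) :
    Matrix (Fin n) (Fin n) ℝ := g p.1 p.2

/-- The inverse metric as a matrix-valued function on space-time. -/
def hm (g : (Fin n → ℝ) → ℝ → Matrix (Fin n) (Fin n) ℝ) (p : (Fin n → ℝ) × ℝ) :
    Matrix (Fin n) (Fin n) ℝ := (g p.1 p.2)⁻¹

/-- The connection matrix `(Γ^k_{aj})_{kj}`. -/
def conn (g : (Fin n → ℝ) → ℝ → Matrix (Fin n) (Fin n) ℝ) (a : Fin n)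
    (p : (Fin n → ℝ) × ℝ) : Matrix (Fin n) (Fin n) ℝ :=
  Matrix.of fun k j => christoffel (fun y => g y p.2) p.1 k a j

/-- The curvature matrix of the connection. -/
def curv (g : (Fin n → ℝ) → ℝ → Matrix (Fin n) (Fin n) ℝ) (a b : Fin n)
    (p : (Fin n → ℝ) × ℝ) : Matrix (Fin n) (Fin n) ℝ :=
  dm (ex a) (conn g b) p - dm (ex b) (conn g a) p + conn g a p * conn g b p
    - conn g b p * conn g a p

/-- The Ricci tensor as a matrix-valued function on space-time. -/
def ric (g : (Fin n → ℝ) → ℝ → Matrix (Fin n) (Fin n) ℝ) (p : (Fin n → ℝ) × ℝ) :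
    Matrix (Fin n) (Fin n) ℝ := Matrix.of fun j k => ricci (fun y => g y p.2) p.1 j k

/-- The scalar curvature as a function on space-time. -/
def scal (g : (Fin n → ℝ) → ℝ → Matrix (Fin n) (Fin n) ℝ) (p : (Fin n → ℝ) × ℝ) : ℝ :=
  scalarCurv (fun y => g y p.2) p.1

/-- The curvature matrix with its second index raised. -/
def curvUp (g : (Fin n → ℝ) → ℝ → Matrix (Fin n) (Fin n) ℝ) (a b : Fin n)
    (p : (Fin n → ℝ) × ℝ) : Matrix (Fin n) (Fin n) ℝ := curv g a b p * hm g p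

variable {g : (Fin n → ℝ) → ℝ → Matrix (Fin n) (Fin n) ℝ} {T : ℝ} {p : (Fin n → ℝ) × ℝ}

lemma msmooth_gm (hg : SmoothMetricFamily g (Iio T)) : MSmooth T (gm g) := hg.1

lemma gm_posDef (hg : SmoothMetricFamily g (Iio T)) (hp : p.2 < T) : (gm g p).PosDef :=
  (hg.2 p.1 p.2 hp).2

lemma gm_transpose (hg : SmoothMetricFamily g (Iio T)) (hp : p.2 < T) : (gm g p)ᵀ = gm g p :=
  (hg.2 p.1 p.2 hp).1

lemma gm_symm (hg : SmoothMetricFamily g (Iio T)) (hp : p.2 < T) (i j : Fin n) :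
    gm g p i j = gm g p j i := by
  conv_lhs => rw [← gm_transpose hg hp]
  rfl

lemma gm_det (hg : SmoothMetricFamily g (Iio T)) : ∀ q ∈ dom n T, (gm g q).det ≠ 0 :=
  fun _ hq => (gm_posDef hg (mem_dom.1 hq)).det_pos.ne'

lemma msmooth_hm (hg : SmoothMetricFamily g (Iio T)) : MSmooth T (hm g) :=
  (msmooth_gm hg).inv (gm_det hg)

lemma hm_mul_gm (hg : SmoothMetricFamily g (Iio T)) (hp : p.2 < T) : hm g p * gm g p = 1 :=
  Matrix.nonsing_inv_mul _ (isUnit_iff_ne_zero.2 (gm_det hg p (mem_dom.2 hp)))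

lemma gm_mul_hm (hg : SmoothMetricFamily g (Iio T)) (hp : p.2 < T) : gm g p * hm g p = 1 :=
  Matrix.mul_nonsing_inv _ (isUnit_iff_ne_zero.2 (gm_det hg p (mem_dom.2 hp)))

lemma hm_transpose (hg : SmoothMetricFamily g (Iio T)) (hp : p.2 < T) : (hm g p)ᵀ = hm g p := by
  have := gm_transpose hg hp
  unfold hm
  unfold gm at this
  rw [Matrix.transpose_nonsing_inv, this]

lemma hm_symm (hg : SmoothMetricFamily g (Iio T)) (hp : p.2 < T) (i j : Fin n) :
    hm g p i j = hm g p j i := by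
  conv_lhs => rw [← hm_transpose hg hp]
  rfl

lemma conn_apply (hg : SmoothMetricFamily g (Iio T)) (hp : p.2 < T) (a k j : Fin n) :
    conn g a p k j = (1 / 2) * ∑ l, hm g p k l * (dd (ex a) (fun q => gm g q j l) p
      + dd (ex j) (fun q => gm g q a l) p - dd (ex l) (fun q => gm g q a j) p) := by
  have h : ∀ i j l, pd (fun y => g y p.2 i j) l p.1 = dd (ex l) (fun q => gm g q i j) p :=
    fun i j l => pd_eq_dd (f := fun q => gm g q i j) ((msmooth_gm hg i j).differentiableAt hp) l
  simp only [conn, christoffel, Matrix.of_apply, h, hm]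

lemma msmooth_conn (hg : SmoothMetricFamily g (Iio T)) (a : Fin n) : MSmooth T (conn g a) := by
  intro k j
  refine SmoothOn.congr (F := fun p => (1 / 2) * ∑ l, hm g p k l *
    (dd (ex a) (fun q => gm g q j l) p
      + dd (ex j) (fun q => gm g q a l) p - dd (ex l) (fun q => gm g q a j) p)) ?_
    fun q hq => conn_apply hg (mem_dom.1 hq) a k j
  refine (SmoothOn.const _).mul (SmoothOn.sum fun l _ => (msmooth_hm hg k l).mul ?_)
  exact (((msmooth_gm hg _ _).dd _).add ((msmooth_gm hg _ _).dd _)).sub ((msmooth_gm hg _ _).dd _)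

lemma dd_gm_symm (hg : SmoothMetricFamily g (Iio T)) (hp : p.2 < T) (w) (i j : Fin n) :
    dd w (fun q => gm g q i j) p = dd w (fun q => gm g q j i) p :=
  dd_congr w hp fun _ hq => gm_symm hg (mem_dom.1 hq) i j

lemma conn_symm (hg : SmoothMetricFamily g (Iio T)) (hp : p.2 < T) (a k j : Fin n) :
    conn g a p k j = conn g j p k a := by
  rw [conn_apply hg hp, conn_apply hg hp]
  congr 1
  refine Finset.sum_congr rfl fun l _ => ?_
  rw [dd_gm_symm hg hp (ex l) a j]
  ring

lemma gm_mul_conn_apply (hg : SmoothMetricFamily g (Iio T)) (hp : p.2 < T) (a l j : Fin n) :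
    (gm g p * conn g a p) l j = (1 / 2) * (dd (ex a) (fun q => gm g q j l) p
      + dd (ex j) (fun q => gm g q a l) p - dd (ex l) (fun q => gm g q a j) p) := by
  set L : Matrix (Fin n) (Fin n) ℝ := Matrix.of fun l j =>
    (1 / 2) * (dd (ex a) (fun q => gm g q j l) p
      + dd (ex j) (fun q => gm g q a l) p - dd (ex l) (fun q => gm g q a j) p) with hL
  have h : conn g a p = hm g p * L := by
    ext k j
    rw [conn_apply hg hp, Matrix.mul_apply, Finset.mul_sum]
    refine Finset.sum_congr rfl fun l _ => ?_
    simp only [hL, Matrix.of_apply]; ring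
  rw [h, ← Matrix.mul_assoc, gm_mul_hm hg hp, Matrix.one_mul]; rfl

lemma dm_gm (hg : SmoothMetricFamily g (Iio T)) (hp : p.2 < T) (a : Fin n) :
    dm (ex a) (gm g) p = (conn g a p)ᵀ * gm g p + gm g p * conn g a p := by
  have h : (conn g a p)ᵀ * gm g p = (gm g p * conn g a p)ᵀ := by
    rw [Matrix.transpose_mul, gm_transpose hg hp]
  rw [h]
  ext i j
  rw [Matrix.add_apply, Matrix.transpose_apply, gm_mul_conn_apply hg hp, gm_mul_conn_apply hg hp,
    dm_apply, dd_gm_symm hg hp (ex a) j i]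
  ring

lemma dm_hm (hg : SmoothMetricFamily g (Iio T)) (hp : p.2 < T) (a : Fin n) :
    dm (ex a) (hm g) p = -(hm g p * (conn g a p)ᵀ) - conn g a p * hm g p := by
  have h := dm_inv (ex a) hp (msmooth_gm hg) (gm_det hg)
  change dm (ex a) (hm g) p = -(hm g p * _ * hm g p) at h
  rw [h, dm_gm hg hp, mul_add, add_mul, ← mul_assoc, ← mul_assoc (hm g p) (gm g p),
    hm_mul_gm hg hp, mul_assoc _ (gm g p), gm_mul_hm hg hp]
  noncomm_ring

lemma msmooth_curv (hg : SmoothMetricFamily g (Iio T)) (a b : Fin n) : MSmooth T (curv g a b) :=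
  ((((msmooth_conn hg b).dm _).sub ((msmooth_conn hg a).dm _)).add
    ((msmooth_conn hg a).mul (msmooth_conn hg b))).sub ((msmooth_conn hg b).mul (msmooth_conn hg a))

lemma msmooth_curvUp (hg : SmoothMetricFamily g (Iio T)) (a b : Fin n) :
    MSmooth T (curvUp g a b) := (msmooth_curv hg a b).mul (msmooth_hm hg)

lemma curv_antisymm (a b : Fin n) : curv g a b p = -curv g b a p := by
  unfold curv; abel

lemma curv_skew (hg : SmoothMetricFamily g (Iio T)) (hp : p.2 < T) (a b : Fin n) :
    (curv g a b p)ᵀ * gm g p + gm g p * curv g a b p = 0 := by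
  have key : ∀ a b, dm (ex a) (dm (ex b) (gm g)) p =
      (dm (ex a) (conn g b) p)ᵀ * gm g p
      + (conn g b p)ᵀ * ((conn g a p)ᵀ * gm g p + gm g p * conn g a p)
      + ((conn g a p)ᵀ * gm g p + gm g p * conn g a p) * conn g b p
      + gm g p * dm (ex a) (conn g b) p := by
    intro a b
    have hA := msmooth_conn hg b
    have hG := msmooth_gm hg
    rw [dm_congr (ex a) hp (M := fun q => (conn g b q)ᵀ * gm g q + gm g q * conn g b q)
      fun q hq => dm_gm hg (mem_dom.1 hq) b, dm_add _ hp (hA.transpose.mul hG) (hG.mul hA),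
      dm_mul _ hp hA.transpose hG, dm_mul _ hp hG hA, dm_transpose, dm_gm hg hp a]
    abel
  have h := dm_comm (ex a) hp (msmooth_gm hg) (ex b)
  rw [key, key] at h
  simp only [curv, Matrix.transpose_sub, Matrix.transpose_add, Matrix.transpose_mul]
  rw [← sub_eq_zero] at h
  rw [← h]
  noncomm_ring

lemma curvUp_skew (hg : SmoothMetricFamily g (Iio T)) (hp : p.2 < T) (a b : Fin n) :
    (curvUp g a b p)ᵀ = -curvUp g a b p := by
  have h := congrArg (fun M => hm g p * M * hm g p) (curv_skew hg hp a b)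
  simp only [mul_add, add_mul, mul_zero, zero_mul] at h
  rw [← mul_assoc, mul_assoc _ (gm g p), gm_mul_hm hg hp, ← mul_assoc (hm g p) (gm g p),
    hm_mul_gm hg hp, mul_one, one_mul] at h
  rw [curvUp, Matrix.transpose_mul, hm_transpose hg hp]
  exact eq_neg_of_add_eq_zero_left h

lemma curvUp_skew_apply (hg : SmoothMetricFamily g (Iio T)) (hp : p.2 < T) (a b i j : Fin n) :
    curvUp g a b p i j = -curvUp g a b p j i := by
  have := congrFun (congrFun (curvUp_skew hg hp a b) j) i
  simpa using this

lemma curvUp_antisymm_apply (a b i j : Fin n) : curvUp g a b p i j = -curvUp g b a p i j := by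
  rw [curvUp, curv_antisymm, neg_mul]; rfl

/-- Second Bianchi identity. -/
lemma bianchi (hg : SmoothMetricFamily g (Iio T)) (hp : p.2 < T) (a b c : Fin n) :
    (dm (ex a) (curv g b c) p + conn g a p * curv g b c p - curv g b c p * conn g a p)
    + (dm (ex b) (curv g c a) p + conn g b p * curv g c a p - curv g c a p * conn g b p)
    + (dm (ex c) (curv g a b) p + conn g c p * curv g a b p - curv g a b p * conn g c p) = 0 := by
  have key : ∀ a b c, dm (ex a) (curv g b c) p =
      dm (ex a) (dm (ex b) (conn g c)) p - dm (ex a) (dm (ex c) (conn g b)) p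
      + (dm (ex a) (conn g b) p * conn g c p + conn g b p * dm (ex a) (conn g c) p)
      - (dm (ex a) (conn g c) p * conn g b p + conn g c p * dm (ex a) (conn g b) p) := by
    intro a b c
    have hb := msmooth_conn hg b
    have hc := msmooth_conn hg c
    unfold curv
    rw [dm_sub _ hp (((hc.dm _).sub (hb.dm _)).add (hb.mul hc)) (hc.mul hb),
      dm_add _ hp ((hc.dm _).sub (hb.dm _)) (hb.mul hc), dm_sub _ hp (hc.dm _) (hb.dm _),
      dm_mul _ hp hb hc, dm_mul _ hp hc hb]
  rw [key, key, key, dm_comm (ex b) hp (msmooth_conn hg c) (ex a),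
    dm_comm (ex c) hp (msmooth_conn hg b) (ex a), dm_comm (ex c) hp (msmooth_conn hg a) (ex b)]
  unfold curv
  noncomm_ring

lemma bianchi_up (hg : SmoothMetricFamily g (Iio T)) (hp : p.2 < T) (a b c : Fin n) :
    (dm (ex a) (curvUp g b c) p + conn g a p * curvUp g b c p
        + curvUp g b c p * (conn g a p)ᵀ)
    + (dm (ex b) (curvUp g c a) p + conn g b p * curvUp g c a p
        + curvUp g c a p * (conn g b p)ᵀ)
    + (dm (ex c) (curvUp g a b) p + conn g c p * curvUp g a b p
        + curvUp g a b p * (conn g c p)ᵀ) = 0 := by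
  have key : ∀ a b c, dm (ex a) (curvUp g b c) p =
      dm (ex a) (curv g b c) p * hm g p
      + curv g b c p * (-(hm g p * (conn g a p)ᵀ) - conn g a p * hm g p) := by
    intro a b c
    unfold curvUp
    rw [dm_mul _ hp (msmooth_curv hg b c) (msmooth_hm hg), dm_hm hg hp]
  have h := congrArg (· * hm g p) (bianchi hg hp a b c)
  simp only [zero_mul] at h
  rw [key, key, key, ← h]
  unfold curvUp
  noncomm_ring

end geometry

section ricci

variable {g : (Fin n → ℝ) → ℝ → Matrix (Fin n) (Fin n) ℝ} {T : ℝ} {p : (Fin n → ℝ) × ℝ}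

lemma ric_apply (hg : SmoothMetricFamily g (Iio T)) (hp : p.2 < T) (j k : Fin n) :
    ric g p j k = ∑ i, curv g i j p i k := by
  have h : ∀ a k j l, pd (fun y => christoffel (fun y => g y p.2) y k a j) l p.1
      = dm (ex l) (conn g a) p k j := fun a k j l =>
    pd_eq_dd (f := fun q => conn g a q k j) ((msmooth_conn hg a k j).differentiableAt hp) l
  simp only [ric, ricci, Matrix.of_apply]
  refine Finset.sum_congr rfl fun i _ => ?_
  rw [h, h, Finset.sum_sub_distrib]
  simp only [curv, Matrix.sub_apply, Matrix.add_apply, Matrix.mul_apply]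
  simp only [conn, Matrix.of_apply]
  ring

lemma msmooth_ric (hg : SmoothMetricFamily g (Iio T)) : MSmooth T (ric g) := fun j k =>
  SmoothOn.congr (SmoothOn.sum fun i (_ : i ∈ Finset.univ) => msmooth_curv hg i j i k)
    fun _ hq => ric_apply hg (mem_dom.1 hq) j k

lemma ric_mul_hm_apply (hg : SmoothMetricFamily g (Iio T)) (hp : p.2 < T) (j l : Fin n) :
    (ric g p * hm g p) j l = ∑ i, curvUp g i j p i l := by
  simp only [Matrix.mul_apply, ric_apply hg hp, curvUp, Finset.sum_mul]
  exact Finset.sum_comm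

lemma ric_mul_hm_apply' (hg : SmoothMetricFamily g (Iio T)) (hp : p.2 < T) (j l : Fin n) :
    (ric g p * hm g p) j l = ∑ i, curvUp g j i p l i := by
  rw [ric_mul_hm_apply hg hp]
  refine Finset.sum_congr rfl fun i _ => ?_
  rw [curvUp_antisymm_apply, curvUp_skew_apply hg hp]; ring

lemma scal_eq_trace (hg : SmoothMetricFamily g (Iio T)) (hp : p.2 < T) :
    scal g p = (ric g p * hm g p).trace := by
  simp only [scal, scalarCurv, Matrix.trace, Matrix.diag_apply, Matrix.mul_apply]
  refine Finset.sum_congr rfl fun i _ => Finset.sum_congr rfl fun j _ => ?_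
  rw [hm_symm hg hp j i, mul_comm]; rfl

lemma smooth_scal (hg : SmoothMetricFamily g (Iio T)) : SmoothOn T (scal g) :=
  SmoothOn.congr (SmoothOn.sum fun i (_ : i ∈ Finset.univ) =>
    (msmooth_ric hg).mul (msmooth_hm hg) i i) fun _ hq => scal_eq_trace hg (mem_dom.1 hq)

lemma scal_eq_sum (hg : SmoothMetricFamily g (Iio T)) (hp : p.2 < T) :
    scal g p = ∑ b, ∑ c, curvUp g b c p b c := by
  rw [scal_eq_trace hg hp, Finset.sum_comm]
  exact Finset.sum_congr rfl fun c _ => ric_mul_hm_apply hg hp c c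

/-- Contracted second Bianchi identity, with one index raised. -/
lemma bianchi_contracted (hg : SmoothMetricFamily g (Iio T)) (hp : p.2 < T) (a : Fin n) :
    dd (ex a) (scal g) p + 2 * ∑ b, ∑ q, conn g a p b q * (ric g p * hm g p) b q
      - 2 * ((∑ b, dd (ex b) (fun z => (ric g z * hm g z) a b) p)
        + ∑ b, ∑ q, conn g b p b q * (ric g p * hm g p) a q) = 0 := by
  have hU := ric_mul_hm_apply (g := g) hg hp
  have hU' := ric_mul_hm_apply' (g := g) hg hp
  have h0 : ∑ b, ∑ c, ((dm (ex a) (curvUp g b c) p + conn g a p * curvUp g b c p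
        + curvUp g b c p * (conn g a p)ᵀ)
    + (dm (ex b) (curvUp g c a) p + conn g b p * curvUp g c a p
        + curvUp g c a p * (conn g b p)ᵀ)
    + (dm (ex c) (curvUp g a b) p + conn g c p * curvUp g a b p
        + curvUp g a b p * (conn g c p)ᵀ)) b c = 0 := by
    refine Finset.sum_eq_zero fun b _ => Finset.sum_eq_zero fun c _ => ?_
    rw [bianchi_up hg hp a b c]; rfl
  simp only [Matrix.add_apply, Finset.sum_add_distrib] at h0
  have h1 : ∑ b, ∑ c, dm (ex a) (curvUp g b c) p b c = dd (ex a) (scal g) p := by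
    rw [dd_congr (F := fun q => ∑ b, ∑ c, curvUp g b c q b c) _ hp
      fun q hq => scal_eq_sum hg (mem_dom.1 hq), dd_sum _ hp fun b _ => SmoothOn.sum fun c _ =>
      msmooth_curvUp hg b c b c]
    refine Finset.sum_congr rfl fun b _ => ?_
    rw [dd_sum _ hp fun c _ => msmooth_curvUp hg b c b c]; rfl
  have h2 : ∑ b, ∑ c, (conn g a p * curvUp g b c p) b c
      = ∑ b, ∑ q, conn g a p b q * (ric g p * hm g p) b q := by
    refine Finset.sum_congr rfl fun b _ => ?_
    simp only [Matrix.mul_apply (M := conn g a p), hU', Finset.mul_sum]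
    exact Finset.sum_comm
  have h3 : ∑ b, ∑ c, (curvUp g b c p * (conn g a p)ᵀ) b c
      = ∑ b, ∑ q, conn g a p b q * (ric g p * hm g p) b q := by
    rw [Finset.sum_comm]
    refine Finset.sum_congr rfl fun c _ => ?_
    simp only [Matrix.mul_apply (N := (conn g a p)ᵀ), hU, Finset.mul_sum, Matrix.transpose_apply]
    rw [Finset.sum_comm]
    exact Finset.sum_congr rfl fun _ _ => Finset.sum_congr rfl fun _ _ => mul_comm _ _
  have hdU : ∀ b, ∑ c, dd (ex b) (fun z => curvUp g c a z c b) p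
      = dd (ex b) (fun z => (ric g z * hm g z) a b) p := by
    intro b
    rw [dd_congr (F := fun q => ∑ c, curvUp g c a q c b) _ hp
      fun q hq => ric_mul_hm_apply hg (mem_dom.1 hq) a b, dd_sum _ hp fun c _ =>
      msmooth_curvUp hg c a c b]
  have hdneg : ∀ (w) (b c i j : Fin n), dd w (fun z => curvUp g b c z i j) p
      = - dd w (fun z => curvUp g b c z j i) p := by
    intro w b c i j
    rw [dd_congr (F := fun z => (-1) * curvUp g b c z j i) w hp fun q hq => by
      rw [curvUp_skew_apply hg (mem_dom.1 hq)]; ring,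
        dd_const_mul w hp _ (msmooth_curvUp hg _ _ _ _)]
    ring
  have hdneg' : ∀ (w) (b c i j : Fin n), dd w (fun z => curvUp g b c z i j) p
      = - dd w (fun z => curvUp g c b z i j) p := by
    intro w b c i j
    rw [dd_congr (F := fun z => (-1) * curvUp g c b z i j) w hp fun q hq => by
      rw [curvUp_antisymm_apply]; ring, dd_const_mul w hp _ (msmooth_curvUp hg _ _ _ _)]
    ring
  have h4 : ∑ b, ∑ c, dm (ex b) (curvUp g c a) p b c
      = -∑ b, dd (ex b) (fun z => (ric g z * hm g z) a b) p := by
    rw [← Finset.sum_neg_distrib]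
    refine Finset.sum_congr rfl fun b _ => ?_
    rw [← hdU, ← Finset.sum_neg_distrib]
    exact Finset.sum_congr rfl fun c _ => hdneg _ _ _ _ _
  have h5 : ∑ b, ∑ c, dm (ex c) (curvUp g a b) p b c
      = -∑ b, dd (ex b) (fun z => (ric g z * hm g z) a b) p := by
    rw [Finset.sum_comm, ← Finset.sum_neg_distrib]
    refine Finset.sum_congr rfl fun b _ => ?_
    rw [← hdU, ← Finset.sum_neg_distrib]
    exact Finset.sum_congr rfl fun c _ => hdneg' _ _ _ _ _
  have h6 : ∑ b, ∑ c, (conn g b p * curvUp g c a p) b c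
      = -∑ b, ∑ q, conn g b p b q * (ric g p * hm g p) a q := by
    rw [← Finset.sum_neg_distrib]
    refine Finset.sum_congr rfl fun b _ => ?_
    simp only [Matrix.mul_apply (M := conn g b p), hU, Finset.mul_sum]
    rw [Finset.sum_comm, ← Finset.sum_neg_distrib]
    refine Finset.sum_congr rfl fun q _ => ?_
    rw [← Finset.sum_neg_distrib]
    refine Finset.sum_congr rfl fun c _ => ?_
    rw [curvUp_skew_apply hg hp]; ring
  have h7 : ∑ b, ∑ c, (curvUp g a b p * (conn g c p)ᵀ) b c
      = -∑ b, ∑ q, conn g b p b q * (ric g p * hm g p) a q := by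
    rw [← Finset.sum_neg_distrib, Finset.sum_comm]
    refine Finset.sum_congr rfl fun c _ => ?_
    simp only [Matrix.mul_apply (N := (conn g c p)ᵀ), hU, Finset.mul_sum, Matrix.transpose_apply]
    rw [Finset.sum_comm, ← Finset.sum_neg_distrib]
    refine Finset.sum_congr rfl fun q _ => ?_
    rw [← Finset.sum_neg_distrib]
    refine Finset.sum_congr rfl fun b _ => ?_
    rw [curvUp_antisymm_apply]; ring
  have hz : ∀ S : Fin n → Fin n → ℝ, ∀ A : Fin n → Fin n → ℝ, (∀ i j, S i j = -S j i) →
      (∀ i j, A i j = A j i) → ∑ b, ∑ q, S b q * A b q = 0 := by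
    intro S A hS hA
    have : ∑ b, ∑ q, S b q * A b q = -∑ b, ∑ q, S b q * A b q := by
      conv_lhs => rw [Finset.sum_comm]
      rw [← Finset.sum_neg_distrib]
      refine Finset.sum_congr rfl fun b _ => ?_
      rw [← Finset.sum_neg_distrib]
      refine Finset.sum_congr rfl fun q _ => ?_
      rw [hS, hA]; ring
    linarith
  have h8 : ∑ b, ∑ c, (curvUp g c a p * (conn g b p)ᵀ) b c = 0 := by
    rw [Finset.sum_comm]
    refine Finset.sum_eq_zero fun c _ => ?_
    simp only [Matrix.mul_apply (N := (conn g _ p)ᵀ), Matrix.transpose_apply]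
    exact hz _ (fun b q => conn g b p c q) (fun i j => curvUp_skew_apply hg hp _ _ _ _)
      (fun i j => conn_symm hg hp _ _ _)
  have h9 : ∑ b, ∑ c, (conn g c p * curvUp g a b p) b c = 0 := by
    refine Finset.sum_eq_zero fun b _ => ?_
    simp only [Matrix.mul_apply (M := conn g _ p)]
    rw [← hz (fun c q => curvUp g a b p q c) (fun c q => conn g c p b q)
      (fun i j => curvUp_skew_apply hg hp _ _ _ _) (fun i j => conn_symm hg hp _ _ _)]
    exact Finset.sum_congr rfl fun _ _ => Finset.sum_congr rfl fun _ _ => mul_comm _ _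
  rw [h1, h2, h3, h4, h5, h6, h7, h8, h9] at h0
  linarith

end ricci

section evolution

variable {g : (Fin n → ℝ) → ℝ → Matrix (Fin n) (Fin n) ℝ} {T : ℝ} {p : (Fin n → ℝ) × ℝ}

lemma dm_time_gm (hg : SmoothMetricFamily g (Iio T)) (hflow : IsRicciFlow g (Iio T))
    (hp : p.2 < T) : dm et (gm g) p = -(2 : ℝ) • ric g p := by
  ext j k
  have h1 := hasDerivAt_dd_time ((msmooth_gm hg j k).differentiableAt hp)
  have h2 := hflow p.1 p.2 hp j k
  rw [derivWithin_of_mem_nhds (Iio_mem_nhds hp)] at h2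
  exact h1.deriv.symm.trans h2

lemma ric_symm (hg : SmoothMetricFamily g (Iio T)) (hflow : IsRicciFlow g (Iio T))
    (hp : p.2 < T) (j k : Fin n) : ric g p j k = ric g p k j := by
  have h := dm_time_gm hg hflow hp
  have h1 := congrFun (congrFun h j) k
  have h2 := congrFun (congrFun h k) j
  rw [dm_apply, dd_gm_symm hg hp, ← dm_apply, h2] at h1
  simp at h1
  exact h1.symm

lemma ric_transpose (hg : SmoothMetricFamily g (Iio T)) (hflow : IsRicciFlow g (Iio T))
    (hp : p.2 < T) : (ric g p)ᵀ = ric g p := by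
  ext i j; exact ric_symm hg hflow hp j i

lemma dm_smul (c : ℝ) {M : (Fin n → ℝ) × ℝ → Matrix (Fin n) (Fin n) ℝ} (hM : MSmooth T M)
    (hp : p.2 < T) (w) : dm w (fun q => c • M q) p = c • dm w M p := by
  ext i j
  exact dd_const_mul w hp c (hM i j)

lemma dm_time_dm_gm (hg : SmoothMetricFamily g (Iio T)) (hflow : IsRicciFlow g (Iio T))
    (hp : p.2 < T) (a : Fin n) :
    dm et (dm (ex a) (gm g)) p = -(2 : ℝ) • dm (ex a) (ric g) p := by
  rw [dm_comm et hp (msmooth_gm hg) (ex a), ← dm_smul _ (msmooth_ric hg) hp]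
  exact dm_congr _ hp fun q hq => dm_time_gm hg hflow (mem_dom.1 hq)

lemma dm_time_hm (hg : SmoothMetricFamily g (Iio T)) (hflow : IsRicciFlow g (Iio T))
    (hp : p.2 < T) : dm et (hm g) p = (2 : ℝ) • (hm g p * ric g p * hm g p) := by
  have h := dm_inv et hp (msmooth_gm hg) (gm_det hg)
  change dm et (hm g) p = -(hm g p * _ * hm g p) at h
  rw [h, dm_time_gm hg hflow hp]
  simp

lemma dd_scal (hg : SmoothMetricFamily g (Iio T)) (hp : p.2 < T) (w) :
    dd w (scal g) p = (dm w (ric g) p * hm g p).trace + (ric g p * dm w (hm g) p).trace := by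
  rw [dd_congr w hp fun q hq => scal_eq_trace hg (mem_dom.1 hq)]
  have h := dm_mul w hp (msmooth_ric hg) (msmooth_hm hg)
  rw [← Matrix.trace_add, ← h]
  simp only [Matrix.trace, Matrix.diag_apply]
  exact dd_sum w hp fun i _ => ((msmooth_ric hg).mul (msmooth_hm hg)) i i

lemma dd_space_scal (hg : SmoothMetricFamily g (Iio T)) (hflow : IsRicciFlow g (Iio T))
    (hp : p.2 < T) (a : Fin n) :
    dd (ex a) (scal g) p = (dm (ex a) (ric g) p * hm g p).trace
      - 2 * (ric g p * conn g a p * hm g p).trace := by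
  have h : (ric g p * conn g a p * hm g p).trace = (ric g p * hm g p * (conn g a p)ᵀ).trace := by
    rw [← Matrix.trace_transpose]
    simp only [Matrix.transpose_mul, hm_transpose hg hp, ric_transpose hg hflow hp]
    rw [← mul_assoc, Matrix.trace_mul_comm, ← mul_assoc]
  rw [dd_scal hg hp, dm_hm hg hp, mul_sub, Matrix.trace_sub, mul_neg, Matrix.trace_neg,
    ← mul_assoc, ← mul_assoc, ← h]
  ring

/-- The trace of the time derivative of the connection is minus the differential of the scalar
curvature. -/
lemma trace_dm_time_conn (hg : SmoothMetricFamily g (Iio T)) (hflow : IsRicciFlow g (Iio T))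
    (hp : p.2 < T) (a : Fin n) : (dm et (conn g a) p).trace = - dd (ex a) (scal g) p := by
  have hA := msmooth_conn hg a
  have hG := msmooth_gm hg
  have h := dm_time_dm_gm hg hflow hp a
  rw [dm_congr et hp (M := fun q => (conn g a q)ᵀ * gm g q + gm g q * conn g a q)
      fun q hq => dm_gm hg (mem_dom.1 hq) a, dm_add _ hp (hA.transpose.mul hG) (hG.mul hA),
      dm_mul _ hp hA.transpose hG, dm_mul _ hp hG hA, dm_transpose, dm_time_gm hg hflow hp] at h
  have h' := congrArg (fun M => (hm g p * M).trace) h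
  simp only [mul_add, Matrix.trace_add, Matrix.mul_smul, Matrix.smul_mul, Matrix.trace_smul,
    smul_eq_mul] at h'
  have e1 : (hm g p * ((dm et (conn g a) p)ᵀ * gm g p)).trace = (dm et (conn g a) p).trace := by
    rw [Matrix.trace_mul_comm, mul_assoc, gm_mul_hm hg hp, mul_one, Matrix.trace_transpose]
  have e2 : (hm g p * (gm g p * dm et (conn g a) p)).trace = (dm et (conn g a) p).trace := by
    rw [← mul_assoc, hm_mul_gm hg hp, one_mul]
  have e3 : (hm g p * (ric g p * conn g a p)).trace = (ric g p * conn g a p * hm g p).trace :=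
    Matrix.trace_mul_comm _ _
  have e4 : (hm g p * ((conn g a p)ᵀ * ric g p)).trace = (ric g p * conn g a p * hm g p).trace := by
    rw [← Matrix.trace_transpose]
    simp only [Matrix.transpose_mul, hm_transpose hg hp, ric_transpose hg hflow hp,
      Matrix.transpose_transpose]
  have e5 : (hm g p * dm (ex a) (ric g) p).trace = (dm (ex a) (ric g) p * hm g p).trace :=
    Matrix.trace_mul_comm _ _
  rw [e1, e2, e3, e4, e5] at h'
  rw [dd_space_scal hg hflow hp]
  linarith

lemma dm_conn_symm (hg : SmoothMetricFamily g (Iio T)) (hp : p.2 < T) (w) (a k j : Fin n) :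
    dm w (conn g a) p k j = dm w (conn g j) p k a :=
  dd_congr w hp fun _ hq => conn_symm hg (mem_dom.1 hq) a k j

/-- Contracted second Bianchi identity with lowered indices. -/
lemma bianchi_lowered (hg : SmoothMetricFamily g (Iio T)) (hflow : IsRicciFlow g (Iio T))
    (hp : p.2 < T) (a : Fin n) :
    ∑ j, ∑ k, hm g p j k * (dd (ex a) (fun q => ric g q j k) p
      - 2 * dd (ex j) (fun q => ric g q a k) p + 2 * (ric g p * conn g j p) a k) = 0 := by
  have h := bianchi_contracted hg hp a
  rw [dd_space_scal hg hflow hp] at h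
  have e1 : (dm (ex a) (ric g) p * hm g p).trace
      = ∑ j, ∑ k, hm g p j k * dd (ex a) (fun q => ric g q j k) p := by
    simp only [Matrix.trace, Matrix.diag_apply, Matrix.mul_apply, dm_apply]
    refine Finset.sum_congr rfl fun j _ => Finset.sum_congr rfl fun k _ => ?_
    rw [hm_symm hg hp k j]; ring
  have e2 : (ric g p * conn g a p * hm g p).trace
      = ∑ b, ∑ q, conn g a p b q * (ric g p * hm g p) b q := by
    have h : (ric g p * conn g a p * hm g p).trace
        = (ric g p * hm g p * (conn g a p)ᵀ).trace := by
      rw [← Matrix.trace_transpose]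
      simp only [Matrix.transpose_mul, hm_transpose hg hp, ric_transpose hg hflow hp]
      rw [← mul_assoc, Matrix.trace_mul_comm, ← mul_assoc]
    rw [h]
    simp only [Matrix.trace, Matrix.diag_apply]
    refine Finset.sum_congr rfl fun j _ => ?_
    rw [Matrix.mul_apply]
    exact Finset.sum_congr rfl fun k _ => by rw [mul_comm]; rfl
  have e3 : ∀ b, dd (ex b) (fun z => (ric g z * hm g z) a b) p
      = ∑ k, hm g p b k * dd (ex b) (fun q => ric g q a k) p
        - ∑ q, conn g b p b q * (ric g p * hm g p) a q
        - ∑ k, hm g p b k * (ric g p * conn g b p) a k := by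
    intro b
    have h := congrFun (congrFun (dm_mul (ex b) hp (msmooth_ric hg) (msmooth_hm hg)) a) b
    rw [dm_apply] at h
    rw [h, dm_hm hg hp, mul_sub, mul_neg, ← mul_assoc, ← mul_assoc]
    simp only [Matrix.add_apply, Matrix.sub_apply, Matrix.neg_apply]
    rw [Matrix.mul_apply, Matrix.mul_apply (M := ric g p * hm g p),
      Matrix.mul_apply (M := ric g p * conn g b p)]
    have s1 : ∑ j, dm (ex b) (ric g) p a j * hm g p j b
        = ∑ k, hm g p b k * dd (ex b) (fun q => ric g q a k) p :=
      Finset.sum_congr rfl fun k _ => by rw [hm_symm hg hp k b, mul_comm]; rfl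
    have s2 : ∑ j, (ric g p * hm g p) a j * (conn g b p)ᵀ j b
        = ∑ q, conn g b p b q * (ric g p * hm g p) a q :=
      Finset.sum_congr rfl fun k _ => by rw [mul_comm]; rfl
    have s3 : ∑ j, (ric g p * conn g b p) a j * hm g p j b
        = ∑ k, hm g p b k * (ric g p * conn g b p) a k :=
      Finset.sum_congr rfl fun k _ => by rw [hm_symm hg hp k b, mul_comm]
    rw [s1, s2, s3]; ring
  simp only [e3, Finset.sum_sub_distrib] at h
  rw [e1, e2] at h
  simp only [mul_add, mul_sub, Finset.sum_add_distrib, Finset.sum_sub_distrib]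
  have m : ∀ f : Fin n → Fin n → ℝ, ∑ j, ∑ k, hm g p j k * (2 * f j k)
      = 2 * ∑ j, ∑ k, hm g p j k * f j k := by
    intro f
    simp only [Finset.mul_sum]
    exact Finset.sum_congr rfl fun _ _ => Finset.sum_congr rfl fun _ _ => by ring
  rw [m (fun j k => dd (ex j) (fun q => ric g q a k) p),
    m (fun j k => (ric g p * conn g j p) a k)]
  linarith

/-- Under Ricci flow the metric trace of the time derivative of the connection vanishes. -/
lemma contracted_dm_time_conn (hg : SmoothMetricFamily g (Iio T)) (hflow : IsRicciFlow g (Iio T))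
    (hp : p.2 < T) (i : Fin n) :
    ∑ j, ∑ k, hm g p j k * dm et (conn g j) p i k = 0 := by
  set X : Fin n → ℝ := fun i => ∑ j, ∑ k, hm g p j k * dm et (conn g j) p i k with hX
  suffices h : gm g p *ᵥ X = 0 by
    have h' := congrArg (hm g p *ᵥ ·) h
    simp only [Matrix.mulVec_mulVec, hm_mul_gm hg hp, Matrix.one_mulVec, Matrix.mulVec_zero] at h'
    exact congrFun h' i
  ext l
  have key : ∀ j k, (gm g p * dm et (conn g j) p) l k =
      -(dd (ex j) (fun q => ric g q k l) p + dd (ex k) (fun q => ric g q j l) p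
        - dd (ex l) (fun q => ric g q j k) p) + 2 * (ric g p * conn g j p) l k := by
    intro j k
    have hL : dd et (fun q => (gm g q * conn g j q) l k) p =
        -(dd (ex j) (fun q => ric g q k l) p + dd (ex k) (fun q => ric g q j l) p
        - dd (ex l) (fun q => ric g q j k) p) := by
      rw [dd_congr et hp fun q hq => gm_mul_conn_apply hg (mem_dom.1 hq) j l k]
      have hd : ∀ i j a, SmoothOn T (fun q => dd (ex a) (fun q => gm g q i j) q) :=
        fun i j a => (msmooth_gm hg i j).dd _
      rw [dd_const_mul et hp _ (((hd _ _ _).add (hd _ _ _)).sub (hd _ _ _)),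
        dd_sub et hp ((hd _ _ _).add (hd _ _ _)) (hd _ _ _), dd_add et hp (hd _ _ _) (hd _ _ _)]
      have hh : ∀ i j a, dd et (fun q => dd (ex a) (fun q => gm g q i j) q) p
          = -2 * dd (ex a) (fun q => ric g q i j) p := fun i j a =>
        congrFun (congrFun (dm_time_dm_gm hg hflow hp a) i) j
      rw [hh, hh, hh]; ring
    have hM := congrFun (congrFun (dm_mul et hp (msmooth_gm hg) (msmooth_conn hg j)) l) k
    rw [dm_apply, hL, dm_time_gm hg hflow hp] at hM
    simp only [Matrix.smul_mul, Matrix.add_apply, Matrix.smul_apply, smul_eq_mul] at hM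
    linarith
  have hs : (gm g p *ᵥ X) l = ∑ j, ∑ k, hm g p j k * (gm g p * dm et (conn g j) p) l k := by
    simp only [Matrix.mulVec, dotProduct, hX, Matrix.mul_apply, Finset.mul_sum]
    rw [Finset.sum_comm]
    refine Finset.sum_congr rfl fun j _ => ?_
    rw [Finset.sum_comm]
    exact Finset.sum_congr rfl fun k _ => Finset.sum_congr rfl fun i _ => by ring
  have hsym : ∀ a i j, dd (ex a) (fun q => ric g q i j) p = dd (ex a) (fun q => ric g q j i) p :=
    fun a i j => dd_congr _ hp fun q hq => ric_symm hg hflow (mem_dom.1 hq) i j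
  have hb := bianchi_lowered hg hflow hp l
  rw [hs, Pi.zero_apply, ← hb]
  simp only [key, mul_add, mul_sub, mul_neg, Finset.sum_add_distrib, Finset.sum_sub_distrib,
    Finset.sum_neg_distrib]
  have e1 : ∑ j, ∑ k, hm g p j k * dd (ex k) (fun q => ric g q j l) p
      = ∑ j, ∑ k, hm g p j k * dd (ex j) (fun q => ric g q k l) p := by
    rw [Finset.sum_comm]
    exact Finset.sum_congr rfl fun j _ => Finset.sum_congr rfl fun k _ => by rw [hm_symm hg hp]
  have e2 : ∑ j, ∑ k, hm g p j k * (2 * dd (ex j) (fun q => ric g q l k) p)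
      = 2 * ∑ j, ∑ k, hm g p j k * dd (ex j) (fun q => ric g q k l) p := by
    simp only [Finset.mul_sum]
    exact Finset.sum_congr rfl fun j _ => Finset.sum_congr rfl fun k _ => by rw [hsym]; ring
  rw [e1, e2]; ring

end evolution

section laplacian

variable {g : (Fin n → ℝ) → ℝ → Matrix (Fin n) (Fin n) ℝ} {T : ℝ} {p : (Fin n → ℝ) × ℝ}

/-- The Laplacian of the scalar curvature. -/
def lapScal (g : (Fin n → ℝ) → ℝ → Matrix (Fin n) (Fin n) ℝ) (p : (Fin n → ℝ) × ℝ) : ℝ :=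
  ∑ j, ∑ k, hm g p j k * (dd (ex j) (fun q => dd (ex k) (scal g) q) p
    - ∑ q, conn g j p q k * dd (ex q) (scal g) p)

lemma dm_time_curv (hg : SmoothMetricFamily g (Iio T)) (hp : p.2 < T) (i j : Fin n) :
    dm et (curv g i j) p = dm (ex i) (dm et (conn g j)) p - dm (ex j) (dm et (conn g i)) p
      + dm et (conn g i) p * conn g j p + conn g i p * dm et (conn g j) p
      - dm et (conn g j) p * conn g i p - conn g j p * dm et (conn g i) p := by
  have hA := msmooth_conn hg
  rw [dm_congr et hp (N := curv g i j) (M := fun q => dm (ex i) (conn g j) q -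
      dm (ex j) (conn g i) q
      + conn g i q * conn g j q - conn g j q * conn g i q) fun q _ => rfl,
    dm_sub et hp ((((hA j).dm _).sub ((hA i).dm _)).add ((hA i).mul (hA j))) ((hA j).mul (hA i)),
    dm_add et hp (((hA j).dm _).sub ((hA i).dm _)) ((hA i).mul (hA j)),
    dm_sub et hp ((hA j).dm _) ((hA i).dm _), dm_mul et hp (hA i) (hA j),
    dm_mul et hp (hA j) (hA i),
    dm_comm et hp (hA j) (ex i), dm_comm et hp (hA i) (ex j)]
  abel

lemma sum_dm_time_conn (hg : SmoothMetricFamily g (Iio T)) (hflow : IsRicciFlow g (Iio T))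
    (hp : p.2 < T) (k : Fin n) :
    ∑ i, dm et (conn g i) p i k = - dd (ex k) (scal g) p := by
  rw [← trace_dm_time_conn hg hflow hp]
  exact Finset.sum_congr rfl fun i _ => dm_conn_symm hg hp et i i k

lemma contracted_dm_dm_time_conn (hg : SmoothMetricFamily g (Iio T))
    (hflow : IsRicciFlow g (Iio T)) (hp : p.2 < T) (i : Fin n) :
    ∑ j, ∑ k, hm g p j k * dm (ex i) (dm et (conn g j)) p i k
      = 2 * ∑ j, ∑ k, ∑ q, hm g p j q * conn g i p k q * dm et (conn g j) p i k := by
  have hY := fun j => (msmooth_conn hg j).dm (w := et)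
  have hH := msmooth_hm hg
  have h0 : dd (ex i) (fun q => ∑ j, ∑ k, hm g q j k * dm et (conn g j) q i k) p = 0 := by
    rw [dd_congr _ hp fun q hq => contracted_dm_time_conn hg hflow (mem_dom.1 hq) i]
    exact dd_const _ _
  rw [dd_sum _ hp fun j _ => SmoothOn.sum fun k _ => (hH j k).mul (hY j i k)] at h0
  have h1 : ∀ j, dd (ex i) (fun q => ∑ k, hm g q j k * dm et (conn g j) q i k) p
      = ∑ k, (-(∑ q, hm g p j q * conn g i p k q) - ∑ q, conn g i p j q * hm g p q k)
          * dm et (conn g j) p i k + ∑ k, hm g p j k * dm (ex i) (dm et (conn g j)) p i k := by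
    intro j
    rw [dd_sum _ hp fun k _ => (hH j k).mul (hY j i k), ← Finset.sum_add_distrib]
    refine Finset.sum_congr rfl fun k _ => ?_
    rw [dd_mul _ hp (hH j k) (hY j i k)]
    have h2 := congrFun (congrFun (dm_hm hg hp i) j) k
    rw [dm_apply] at h2
    rw [h2]
    simp only [Matrix.sub_apply, Matrix.neg_apply, Matrix.mul_apply, Matrix.transpose_apply]
    rfl
  simp only [h1, Finset.sum_add_distrib, sub_mul, neg_mul, Finset.sum_sub_distrib,
    Finset.sum_neg_distrib, Finset.sum_mul] at h0
  have h3 : ∑ j, ∑ k, ∑ q, conn g i p j q * hm g p q k * dm et (conn g j) p i k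
      = ∑ j, ∑ k, ∑ q, hm g p j q * conn g i p k q * dm et (conn g j) p i k := by
    rw [Finset.sum_comm]
    refine Finset.sum_congr rfl fun j _ => Finset.sum_congr rfl fun k _ =>
      Finset.sum_congr rfl fun q _ => ?_
    rw [dm_conn_symm hg hp et k i j, hm_symm hg hp q j]; ring
  linarith

lemma trace_dm_time_ric (hg : SmoothMetricFamily g (Iio T)) (hflow : IsRicciFlow g (Iio T))
    (hp : p.2 < T) : (dm et (ric g) p * hm g p).trace = lapScal g p := by
  have hY := fun j => (msmooth_conn hg j).dm (w := et)
  have h1 : (dm et (ric g) p * hm g p).trace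
      = ∑ j, ∑ k, hm g p j k * ∑ i, dm et (curv g i j) p i k := by
    simp only [Matrix.trace, Matrix.diag_apply, Matrix.mul_apply]
    refine Finset.sum_congr rfl fun j _ => Finset.sum_congr rfl fun k _ => ?_
    rw [hm_symm hg hp k j, mul_comm, dm_apply, dd_congr et hp fun q hq =>
      ric_apply hg (mem_dom.1 hq) j k, dd_sum et hp fun i _ => msmooth_curv hg i j i k]
    rfl
  have e1 : ∑ j, ∑ k, ∑ i, hm g p j k * dm (ex i) (dm et (conn g j)) p i k
      = 2 * ∑ i, ∑ j, ∑ k, ∑ q, hm g p j q * conn g i p k q * dm et (conn g j) p i k := by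
    rw [Finset.mul_sum, ← Finset.sum_congr rfl fun i _ =>
      contracted_dm_dm_time_conn hg hflow hp i]
    rw [Finset.sum_comm' (t' := Finset.univ) (s' := fun _ => Finset.univ) (by simp)]
    rw [Finset.sum_comm]
    conv_lhs => enter [2, j]; rw [Finset.sum_comm]
    rw [Finset.sum_comm]
  have e2 : ∀ j k, ∑ i, dm (ex j) (dm et (conn g i)) p i k
      = - dd (ex j) (fun q => dd (ex k) (scal g) q) p := by
    intro j k
    have := dd_congr (ex j) hp fun q hq => sum_dm_time_conn hg hflow (mem_dom.1 hq) k
    rw [dd_sum _ hp fun i _ => hY i i k] at this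
    rw [show ∑ i, dm (ex j) (dm et (conn g i)) p i k
      = ∑ i, dd (ex j) (fun q => dm et (conn g i) q i k) p from rfl, this]
    have h := dd_const_mul (ex j) hp (-1) ((smooth_scal hg).dd (ex k))
    simpa using h
  have e3 : ∀ j k, ∑ i, (dm et (conn g i) p * conn g j p) i k
      = - ∑ q, conn g j p q k * dd (ex q) (scal g) p := by
    intro j k
    simp only [Matrix.mul_apply]
    rw [Finset.sum_comm, ← Finset.sum_neg_distrib]
    refine Finset.sum_congr rfl fun q _ => ?_
    rw [← Finset.sum_mul, sum_dm_time_conn hg hflow hp]; ring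
  have e4 : ∑ j, ∑ k, ∑ i, hm g p j k * (conn g i p * dm et (conn g j) p) i k = 0 := by
    have : ∀ i, ∑ j, ∑ k, hm g p j k * (conn g i p * dm et (conn g j) p) i k = 0 := by
      intro i
      have : ∀ q, conn g i p i q * ∑ j, ∑ k, hm g p j k * dm et (conn g j) p q k = 0 := fun q => by
        rw [contracted_dm_time_conn hg hflow hp, mul_zero]
      rw [← Finset.sum_const_zero (s := (Finset.univ : Finset (Fin n))),
        ← Finset.sum_congr rfl fun q _ => this q]
      simp only [Matrix.mul_apply, Finset.mul_sum]
      conv_rhs => rw [Finset.sum_comm]; enter [2, j]; rw [Finset.sum_comm]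
      exact Finset.sum_congr rfl fun _ _ => Finset.sum_congr rfl fun _ _ =>
        Finset.sum_congr rfl fun _ _ => by ring
    conv_lhs => enter [2, j]; rw [Finset.sum_comm]
    rw [Finset.sum_comm]
    exact Finset.sum_eq_zero fun i _ => this i
  have e5 : ∑ j, ∑ k, ∑ i, hm g p j k * (dm et (conn g j) p * conn g i p) i k
      = ∑ i, ∑ j, ∑ k, ∑ q, hm g p j q * conn g i p k q * dm et (conn g j) p i k := by
    conv_lhs => enter [2, j]; rw [Finset.sum_comm]
    rw [Finset.sum_comm]
    refine Finset.sum_congr rfl fun i _ => Finset.sum_congr rfl fun j _ => ?_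
    simp only [Matrix.mul_apply, Finset.mul_sum]
    rw [Finset.sum_comm]
    exact Finset.sum_congr rfl fun _ _ => Finset.sum_congr rfl fun _ _ => by ring
  have e6 : ∑ j, ∑ k, ∑ i, hm g p j k * (conn g j p * dm et (conn g i) p) i k
      = ∑ i, ∑ j, ∑ k, ∑ q, hm g p j q * conn g i p k q * dm et (conn g j) p i k := by
    have r : ∑ i, ∑ j, ∑ k, ∑ q, hm g p j q * conn g i p k q * dm et (conn g j) p i k
        = ∑ q, ∑ j, ∑ k, ∑ i, hm g p j q * conn g i p k q * dm et (conn g j) p i k := by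
      conv_lhs => enter [2, i]; rw [Finset.sum_comm' (t' := Finset.univ)
        (s' := fun _ => Finset.univ) (by simp)]
      conv_lhs => enter [2, i, 2, k]; rw [Finset.sum_comm]
      conv_lhs => enter [2, i]; rw [Finset.sum_comm]
      rw [Finset.sum_comm]
      refine Finset.sum_congr rfl fun q _ => ?_
      conv_lhs => enter [2, i]; rw [Finset.sum_comm]
      rw [Finset.sum_comm]
      refine Finset.sum_congr rfl fun j _ => ?_
      rw [Finset.sum_comm]
    rw [r]
    refine Finset.sum_congr rfl fun q _ => Finset.sum_congr rfl fun j _ =>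
      Finset.sum_congr rfl fun k _ => ?_
    rw [Matrix.mul_apply, Finset.mul_sum]
    refine Finset.sum_congr rfl fun i _ => ?_
    rw [hm_symm hg hp q j, conn_symm hg hp q k i, dm_conn_symm hg hp et k i j]; ring
  rw [h1]
  generalize ∑ i, ∑ j, ∑ k, ∑ q, hm g p j q * conn g i p k q * dm et (conn g j) p i k = B
    at e1 e5 e6
  simp only [dm_time_curv hg hp, Matrix.add_apply, Matrix.sub_apply, Finset.sum_add_distrib,
    Finset.sum_sub_distrib, e2, e3, mul_add, mul_sub, Finset.mul_sum, e1, e4, e5, e6, lapScal]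
  simp only [mul_neg, Finset.sum_neg_distrib, Finset.mul_sum]
  ring

/-- The evolution equation of the scalar curvature under Ricci flow. -/
lemma dd_time_scal (hg : SmoothMetricFamily g (Iio T)) (hflow : IsRicciFlow g (Iio T))
    (hp : p.2 < T) : dd et (scal g) p = lapScal g p
      + 2 * (ric g p * hm g p * ric g p * hm g p).trace := by
  rw [dd_scal hg hp, trace_dm_time_ric hg hflow hp, dm_time_hm hg hflow hp, Matrix.mul_smul,
    Matrix.trace_smul, smul_eq_mul]
  simp only [mul_assoc]

lemma trace_sq_le {M : Matrix (Fin n) (Fin n) ℝ} (hM : Mᵀ = M) :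
    M.trace ^ 2 ≤ n * (M * M).trace := by
  have h1 : M.trace ^ 2 ≤ n * ∑ i, M i i ^ 2 := by
    simpa [Matrix.trace] using sq_sum_le_card_mul_sum_sq (s := Finset.univ) (f := fun i => M i i)
  refine h1.trans (mul_le_mul_of_nonneg_left ?_ (Nat.cast_nonneg n))
  simp only [Matrix.trace, Matrix.diag_apply, Matrix.mul_apply]
  refine Finset.sum_le_sum fun i _ => ?_
  have : ∀ j, M i j * M j i = M i j ^ 2 := fun j => by
    rw [← congrFun (congrFun hM i) j, Matrix.transpose_apply, sq]
  simp only [this]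
  exact Finset.single_le_sum (f := fun j => M i j ^ 2) (fun j _ => sq_nonneg _)
    (Finset.mem_univ i)

lemma exists_frame (hg : SmoothMetricFamily g (Iio T)) (hp : p.2 < T) :
    ∃ P : Matrix (Fin n) (Fin n) ℝ, P * Pᵀ = hm g p ∧ Pᵀ * gm g p * P = 1 := by
  open scoped MatrixOrder in
  have h0 : 0 ≤ hm g p := (gm_posDef hg hp).inv.posSemidef.nonneg
  obtain ⟨B, hB⟩ := CStarAlgebra.nonneg_iff_eq_star_mul_self.1 h0
  have hP : Bᵀ * Bᵀᵀ = hm g p := by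
    rw [hB, Matrix.star_eq_conjTranspose, Matrix.conjTranspose_eq_transpose_of_trivial,
      Matrix.transpose_transpose]
  refine ⟨Bᵀ, hP, ?_⟩
  rw [mul_eq_one_comm, ← mul_assoc, hP, hm_mul_gm hg hp]

lemma scal_sq_le (hg : SmoothMetricFamily g (Iio T)) (hflow : IsRicciFlow g (Iio T))
    (hp : p.2 < T) :
    scal g p ^ 2 ≤ n * (ric g p * hm g p * ric g p * hm g p).trace := by
  obtain ⟨P, hP, -⟩ := exists_frame hg hp
  have h1 : scal g p = (Pᵀ * ric g p * P).trace := by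
    rw [scal_eq_trace hg hp, ← hP, ← mul_assoc, Matrix.trace_mul_comm, ← mul_assoc]
  have h2 : (ric g p * hm g p * ric g p * hm g p).trace
      = ((Pᵀ * ric g p * P) * (Pᵀ * ric g p * P)).trace := by
    rw [← hP, ← mul_assoc, Matrix.trace_mul_comm]
    simp only [mul_assoc]
  rw [h1, h2]
  refine trace_sq_le ?_
  simp only [Matrix.transpose_mul, ric_transpose hg hflow hp, Matrix.transpose_transpose, mul_assoc]

end laplacian

section length

variable {g : (Fin n → ℝ) → ℝ → Matrix (Fin n) (Fin n) ℝ} {T : ℝ} {p : (Fin n → ℝ) × ℝ}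

/-- The squared norm of a vector. -/
def qf (g : (Fin n → ℝ) → ℝ → Matrix (Fin n) (Fin n) ℝ) (p : (Fin n → ℝ) × ℝ)
    (v : Fin n → ℝ) : ℝ := ∑ i, ∑ j, gm g p i j * v i * v j

/-- The norm of a vector. -/
def nm (g : (Fin n → ℝ) → ℝ → Matrix (Fin n) (Fin n) ℝ) (p : (Fin n → ℝ) × ℝ)
    (v : Fin n → ℝ) : ℝ := √(qf g p v)

lemma qf_eq_dot (v : Fin n → ℝ) : qf g p v = v ⬝ᵥ (gm g p *ᵥ v) := by
  simp only [qf, dotProduct, Matrix.mulVec, Finset.mul_sum]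
  exact Finset.sum_congr rfl fun _ _ => Finset.sum_congr rfl fun _ _ => by ring

lemma exists_qf_eq_norm (hg : SmoothMetricFamily g (Iio T)) (hp : p.2 < T) :
    ∃ L : (Fin n → ℝ) →ₗ[ℝ] EuclideanSpace ℝ (Fin n), ∀ v, qf g p v = ‖L v‖ ^ 2 := by
  open scoped MatrixOrder in
  have h0 : 0 ≤ gm g p := (gm_posDef hg hp).posSemidef.nonneg
  obtain ⟨B, hB⟩ := CStarAlgebra.nonneg_iff_eq_star_mul_self.1 h0
  rw [Matrix.star_eq_conjTranspose, Matrix.conjTranspose_eq_transpose_of_trivial] at hB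
  refine ⟨(WithLp.linearEquiv 2 ℝ (Fin n → ℝ)).symm.toLinearMap ∘ₗ Matrix.toLin' B, fun v => ?_⟩
  rw [qf_eq_dot, hB, ← Matrix.mulVec_mulVec, Matrix.dotProduct_mulVec, Matrix.vecMul_transpose,
    EuclideanSpace.norm_sq_eq]
  simp [dotProduct, sq]

lemma qf_nonneg (hg : SmoothMetricFamily g (Iio T)) (hp : p.2 < T) (v : Fin n → ℝ) :
    0 ≤ qf g p v := by
  obtain ⟨L, hL⟩ := exists_qf_eq_norm hg hp
  rw [hL]; positivity

lemma nm_nonneg (v : Fin n → ℝ) : 0 ≤ nm g p v := Real.sqrt_nonneg _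

lemma nm_sq (hg : SmoothMetricFamily g (Iio T)) (hp : p.2 < T) (v : Fin n → ℝ) :
    nm g p v ^ 2 = qf g p v := Real.sq_sqrt (qf_nonneg hg hp v)

lemma nm_add_le (hg : SmoothMetricFamily g (Iio T)) (hp : p.2 < T) (v w : Fin n → ℝ) :
    nm g p (v + w) ≤ nm g p v + nm g p w := by
  obtain ⟨L, hL⟩ := exists_qf_eq_norm hg hp
  simp only [nm, hL, Real.sqrt_sq (norm_nonneg _), map_add]
  exact norm_add_le _ _

lemma qf_smul (c : ℝ) (v : Fin n → ℝ) : qf g p (c • v) = c ^ 2 * qf g p v := by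
  simp only [qf, Finset.mul_sum, Pi.smul_apply, smul_eq_mul]
  exact Finset.sum_congr rfl fun _ _ => Finset.sum_congr rfl fun _ _ => by ring

lemma nm_smul (c : ℝ) (v : Fin n → ℝ) : nm g p (c • v) = |c| * nm g p v := by
  rw [nm, qf_smul, Real.sqrt_mul (sq_nonneg c), Real.sqrt_sq_eq_abs, nm]

lemma nm_neg (v : Fin n → ℝ) : nm g p (-v) = nm g p v := by
  simpa using nm_smul (g := g) (p := p) (-1) v

lemma continuousOn_qf (hg : SmoothMetricFamily g (Iio T)) :
    ContinuousOn (fun z : ((Fin n → ℝ) × ℝ) × (Fin n → ℝ) => qf g z.1 z.2) (dom n T ×ˢ univ) := by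
  refine continuousOn_finsetSum _ fun i _ => continuousOn_finsetSum _ fun j _ => ?_
  have h1 : ContinuousOn (fun z : ((Fin n → ℝ) × ℝ) × (Fin n → ℝ) => gm g z.1 i j)
      (dom n T ×ˢ univ) :=
    (msmooth_gm hg i j).continuousOn.comp continuousOn_fst fun z hz => hz.1
  have h2 : ∀ i, Continuous (fun z : ((Fin n → ℝ) × ℝ) × (Fin n → ℝ) => z.2 i) := fun i => by
    fun_prop
  exact (h1.mul (h2 i).continuousOn).mul (h2 j).continuousOn

lemma abs_sum_le_norm_sq {c : ℝ} {M : Matrix (Fin n) (Fin n) ℝ} (hM : ∀ i j, |M i j| ≤ c)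
    (v : Fin n → ℝ) : |∑ i, ∑ j, M i j * v i * v j| ≤ n ^ 2 * c * ‖v‖ ^ 2 := by
  have h : ∀ i j, |M i j * v i * v j| ≤ c * ‖v‖ ^ 2 := fun i j => by
    rw [abs_mul, abs_mul, mul_assoc, sq]
    have h1 := norm_le_pi_norm v i
    have h2 := norm_le_pi_norm v j
    rw [Real.norm_eq_abs] at h1 h2
    have := (abs_nonneg (M i j)).trans (hM i j)
    gcongr
    exact hM i j
  calc |∑ i, ∑ j, M i j * v i * v j| ≤ ∑ i, |∑ j, M i j * v i * v j| :=
        Finset.abs_sum_le_sum_abs _ _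
    _ ≤ ∑ i : Fin n, ∑ j : Fin n, c * ‖v‖ ^ 2 := Finset.sum_le_sum fun i _ =>
        (Finset.abs_sum_le_sum_abs _ _).trans (Finset.sum_le_sum fun j _ => h i j)
    _ = n ^ 2 * c * ‖v‖ ^ 2 := by simp; ring

/-- A smooth function is bounded on compact sets. -/
lemma SmoothOn.exists_bound {F : (Fin n → ℝ) × ℝ → ℝ} (hF : SmoothOn T F)
    {K : Set ((Fin n → ℝ) × ℝ)} (hK : IsCompact K) (hKT : K ⊆ dom n T) :
    ∃ C, 0 ≤ C ∧ ∀ p ∈ K, |F p| ≤ C := by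
  obtain ⟨C, hC⟩ := hK.exists_bound_of_continuousOn (hF.continuousOn.mono hKT)
  exact ⟨max C 0, le_max_right _ _, fun p hp => (hC p hp).trans (le_max_left _ _)⟩

lemma MSmooth.exists_bound {M : (Fin n → ℝ) × ℝ → Matrix (Fin n) (Fin n) ℝ} (hM : MSmooth T M)
    {K : Set ((Fin n → ℝ) × ℝ)} (hK : IsCompact K) (hKT : K ⊆ dom n T) :
    ∃ C, 0 ≤ C ∧ ∀ p ∈ K, ∀ i j, |M p i j| ≤ C := by
  choose C hC0 hC using fun i j => (hM i j).exists_bound hK hKT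
  refine ⟨∑ i, ∑ j, C i j, Finset.sum_nonneg fun i _ => Finset.sum_nonneg fun j _ => hC0 i j,
    fun p hp i j => (hC i j p hp).trans ?_⟩
  exact (Finset.single_le_sum (f := fun j => C i j) (fun j _ => hC0 i j) (Finset.mem_univ j)).trans
    (Finset.single_le_sum (f := fun i => ∑ j, C i j)
      (fun i _ => Finset.sum_nonneg fun j _ => hC0 i j) (Finset.mem_univ i))

lemma exists_qf_le (hg : SmoothMetricFamily g (Iio T))
    {K : Set ((Fin n → ℝ) × ℝ)} (hK : IsCompact K) (hKT : K ⊆ dom n T) :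
    ∃ M, 0 < M ∧ ∀ p ∈ K, ∀ v, qf g p v ≤ M * ‖v‖ ^ 2 := by
  obtain ⟨C, hC0, hC⟩ := (msmooth_gm hg).exists_bound hK hKT
  refine ⟨n ^ 2 * C + 1, by positivity, fun p hp v => ?_⟩
  have := (le_abs_self _).trans (abs_sum_le_norm_sq (hC p hp) v)
  have h2 := sq_nonneg ‖v‖
  unfold qf
  linarith

lemma exists_le_qf (hg : SmoothMetricFamily g (Iio T))
    {K : Set ((Fin n → ℝ) × ℝ)} (hK : IsCompact K) (hKT : K ⊆ dom n T) :
    ∃ m, 0 < m ∧ ∀ p ∈ K, ∀ v, m * ‖v‖ ^ 2 ≤ qf g p v := by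
  have hS : IsCompact (Metric.sphere (0 : Fin n → ℝ) 1) := isCompact_sphere _ _
  obtain ⟨m, hm0, hm⟩ : ∃ m, 0 < m ∧ ∀ z ∈ K ×ˢ Metric.sphere (0 : Fin n → ℝ) 1,
      m ≤ qf g z.1 z.2 := by
    refine (hK.prod hS).exists_forall_le' (a := 0)
      ((continuousOn_qf hg).mono fun z hz => ⟨hKT hz.1, trivial⟩) fun z hz => ?_
    have hz0 : z.2 ≠ 0 := by
      rintro h
      have := hz.2
      simp [h] at this
    have := (gm_posDef hg (mem_dom.1 (hKT hz.1))).dotProduct_mulVec_pos hz0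
    rw [qf_eq_dot]
    simpa using this
  refine ⟨m, hm0, fun p hp v => ?_⟩
  rcases eq_or_ne v 0 with rfl | hv
  · simp [qf]
  have hv' : ‖v‖ ≠ 0 := norm_ne_zero_iff.2 hv
  have h := hm (p, ‖v‖⁻¹ • v) ⟨hp, by simp [norm_smul, hv']⟩
  simp only [qf_smul] at h
  have h2 : (‖v‖⁻¹) ^ 2 * ‖v‖ ^ 2 = 1 := by field_simp
  calc m * ‖v‖ ^ 2 ≤ (‖v‖⁻¹ ^ 2 * qf g p v) * ‖v‖ ^ 2 := by gcongr
    _ = (‖v‖⁻¹ ^ 2 * ‖v‖ ^ 2) * qf g p v := by ring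
    _ = qf g p v := by rw [h2, one_mul]

/-- Nearby metrics are comparable, uniformly on compact sets. -/
lemma exists_qf_comparison (hg : SmoothMetricFamily g (Iio T))
    {K : Set ((Fin n → ℝ) × ℝ)} (hK : IsCompact K) (hKT : K ⊆ dom n T) {ε : ℝ} (hε : 0 < ε) :
    ∃ η > 0, ∀ p ∈ K, ∀ q ∈ K, dist p q < η → ∀ v, qf g q v ≤ (1 + ε) * qf g p v := by
  obtain ⟨m, hm0, hm⟩ := exists_le_qf hg hK hKT
  set δ := ε * m / (n ^ 2 + 1) with hδ
  have hδ0 : 0 < δ := by positivity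
  have h : ∀ i j, ∃ η > 0, ∀ p ∈ K, ∀ q ∈ K, dist p q < η → |gm g q i j - gm g p i j| ≤ δ := by
    intro i j
    have huc := hK.uniformContinuousOn_of_continuous ((msmooth_gm hg i j).continuousOn.mono hKT)
    obtain ⟨η, hη, h⟩ := Metric.uniformContinuousOn_iff.1 huc δ hδ0
    exact ⟨η, hη, fun p hp q hq hpq => by
      have := h p hp q hq hpq
      rw [dist_comm, Real.dist_eq] at this
      exact this.le⟩
  choose η hη0 hη using h
  obtain ⟨η₀, hη₀, hle⟩ : ∃ η₀ > 0, ∀ i j, η₀ ≤ η i j := by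
    have h1 : ∀ᶠ e in 𝓝[>] (0 : ℝ), ∀ i j, e ≤ η i j := by
      refine Filter.eventually_all.2 fun i => Filter.eventually_all.2 fun j => ?_
      exact nhdsWithin_le_nhds (eventually_le_nhds (hη0 i j))
    obtain ⟨e, he, he'⟩ := (h1.and self_mem_nhdsWithin).exists
    exact ⟨e, he', he⟩
  refine ⟨η₀, hη₀, fun p hp q hq hpq v => ?_⟩
  have h1 := abs_sum_le_norm_sq (M := gm g q - gm g p) (c := δ)
    (fun i j => hη i j p hp q hq (hpq.trans_le (hle i j))) v
  have h2 : ∑ i, ∑ j, (gm g q - gm g p) i j * v i * v j = qf g q v - qf g p v := by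
    simp only [qf, Matrix.sub_apply, sub_mul, Finset.sum_sub_distrib]
  rw [h2] at h1
  have h3 := hm p hp v
  have h4 : n ^ 2 * δ ≤ ε * m := by
    rw [hδ, mul_div_assoc', div_le_iff₀ (by positivity)]
    nlinarith [mul_pos hε hm0]
  nlinarith [le_abs_self (qf g q v - qf g p v), sq_nonneg ‖v‖,
    mul_le_mul_of_nonneg_right h4 (sq_nonneg ‖v‖)]

end length

section paths

variable {g : (Fin n → ℝ) → ℝ → Matrix (Fin n) (Fin n) ℝ} {T t : ℝ} {x y z : Fin n → ℝ}
  {u : ℝ → Fin n → ℝ}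

/-- The path starting at `x` with velocity `u`. -/
def pth (x : Fin n → ℝ) (u : ℝ → Fin n → ℝ) (s : ℝ) : Fin n → ℝ := x + ∫ r in (0 : ℝ)..s, u r

@[simp] lemma pth_zero : pth x u 0 = x := by simp [pth]

lemma continuous_pth (hu : Integrable u) : Continuous (pth x u) :=
  continuous_const.add (intervalIntegral.continuous_primitive
    (fun _ _ => hu.intervalIntegrable) 0)

lemma pth_sub (hu : Integrable u) (r s : ℝ) : pth x u s - pth x u r = ∫ q in r..s, u q := by
  rw [pth, pth, add_sub_add_left_eq_sub,
    intervalIntegral.integral_interval_sub_left hu.intervalIntegrable hu.intervalIntegrable]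

lemma norm_pth_sub_le (hu : Integrable u) {r s : ℝ} (hrs : r ≤ s) :
    ‖pth x u s - pth x u r‖ ≤ ∫ q in r..s, ‖u q‖ := by
  rw [pth_sub hu]
  exact intervalIntegral.norm_integral_le_integral_norm hrs

/-- Length of the path starting at `x` with velocity `u`. -/
def len (g : (Fin n → ℝ) → ℝ → Matrix (Fin n) (Fin n) ℝ) (t : ℝ) (x : Fin n → ℝ)
    (u : ℝ → Fin n → ℝ) (a b : ℝ) : ℝ := ∫ s in a..b, nm g (pth x u s, t) (u s)

lemma continuous_nm (hg : SmoothMetricFamily g (Iio T)) (ht : t < T) :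
    Continuous (fun z : (Fin n → ℝ) × (Fin n → ℝ) => nm g (z.1, t) z.2) := by
  refine Continuous.sqrt ?_
  exact (continuousOn_qf hg).comp_continuous (f := fun z : (Fin n → ℝ) × (Fin n → ℝ) =>
    ((z.1, t), z.2)) (by fun_prop) fun z => ⟨mem_dom.2 ht, trivial⟩

lemma intervalIntegrable_nm (hg : SmoothMetricFamily g (Iio T)) (ht : t < T)
    {γ : ℝ → Fin n → ℝ} (hγ : Continuous γ) (hu : Integrable u) (a b : ℝ) :
    IntervalIntegrable (fun s => nm g (γ s, t) (u s)) volume a b := by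
  have hK : IsCompact ((fun s => (γ s, t)) '' uIcc a b) :=
    isCompact_uIcc.image (by fun_prop)
  obtain ⟨M, hM0, hM⟩ := exists_qf_le hg hK (by rintro _ ⟨s, -, rfl⟩; exact mem_dom.2 ht)
  refine IntervalIntegrable.mono_fun (f := fun s => √M * ‖u s‖)
    ((hu.norm.const_mul _).intervalIntegrable) ?_ ?_
  · exact (((continuous_nm hg ht).comp_aestronglyMeasurable
      (hγ.aestronglyMeasurable.prodMk hu.aestronglyMeasurable))).restrict
  · refine (ae_restrict_mem measurableSet_uIoc).mono fun s hs => ?_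
    have hs' := uIoc_subset_uIcc hs
    beta_reduce
    rw [Real.norm_of_nonneg (nm_nonneg _), Real.norm_of_nonneg (by positivity), nm,
      ← Real.sqrt_sq (norm_nonneg (u s)), ← Real.sqrt_mul hM0.le]
    exact Real.sqrt_le_sqrt (hM _ ⟨s, hs', rfl⟩ _)

lemma len_add (hg : SmoothMetricFamily g (Iio T)) (ht : t < T) (hu : Integrable u) (a b c : ℝ) :
    len g t x u a b + len g t x u b c = len g t x u a c :=
  intervalIntegral.integral_add_adjacent_intervals
    (intervalIntegrable_nm hg ht (continuous_pth hu) hu _ _)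
    (intervalIntegrable_nm hg ht (continuous_pth hu) hu _ _)

lemma len_nonneg {a b : ℝ} (hab : a ≤ b) : 0 ≤ len g t x u a b :=
  intervalIntegral.integral_nonneg hab fun _ _ => nm_nonneg _

lemma len_le (hg : SmoothMetricFamily g (Iio T)) (ht : t < T) (hu : Integrable u) {s : ℝ}
    (hs : s ∈ Icc (0 : ℝ) 1) : len g t x u 0 s ≤ len g t x u 0 1 := by
  rw [← len_add hg ht hu 0 s 1]
  linarith [len_nonneg (g := g) (t := t) (x := x) (u := u) hs.2]

/-- A path leaving a ball around its starting point has a first exit time. -/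
lemma exists_exit_time (hu : Integrable u) {ρ s₁ : ℝ} (hρ : 0 < ρ)
    (hs : 0 ≤ s₁) (h : ρ ≤ ‖pth x u s₁ - x‖) :
    ∃ τ ∈ Icc 0 s₁, ‖pth x u τ - x‖ = ρ ∧ ∀ s ∈ Icc 0 τ, ‖pth x u s - x‖ ≤ ρ := by
  have hc : Continuous fun s => ‖pth x u s - x‖ := ((continuous_pth hu).sub continuous_const).norm
  have hK : IsCompact (Icc 0 s₁ ∩ {s | ρ ≤ ‖pth x u s - x‖}) :=
    isCompact_Icc.inter_right (isClosed_le continuous_const hc)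
  obtain ⟨τ, ⟨hτ, hτ'⟩, hmin⟩ := hK.exists_isLeast ⟨s₁, ⟨hs, le_rfl⟩, h⟩
  obtain ⟨s, hs', hsρ⟩ : ρ ∈ (fun s => ‖pth x u s - x‖) '' Icc 0 τ :=
    intermediate_value_Icc hτ.1 hc.continuousOn ⟨by simpa using hρ.le, hτ'⟩
  have hsτ : τ ≤ s := hmin ⟨⟨hs'.1, hs'.2.trans hτ.2⟩, hsρ.ge⟩
  obtain rfl : s = τ := le_antisymm hs'.2 hsτ
  refine ⟨s, hτ, hsρ, fun q hq => ?_⟩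
  rcases hq.2.eq_or_lt with rfl | hlt
  · exact hsρ.le
  · by_contra! hcon
    exact absurd (hmin ⟨⟨hq.1, hq.2.trans hτ.2⟩, hcon.le⟩) (not_le.2 hlt)

lemma len_ge_of_exit (hg : SmoothMetricFamily g (Iio T)) (ht : t < T) (hu : Integrable u)
    {ρ τ m : ℝ} (hm : 0 ≤ m) (hτ : 0 ≤ τ)
    (hle : ∀ y, ‖y - x‖ ≤ ρ → ∀ v, m * ‖v‖ ^ 2 ≤ qf g (y, t) v)
    (hin : ∀ s ∈ Icc 0 τ, ‖pth x u s - x‖ ≤ ρ) :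
    √m * ‖pth x u τ - x‖ ≤ len g t x u 0 τ := by
  have h1 := norm_pth_sub_le (x := x) hu hτ
  rw [pth_zero] at h1
  calc √m * ‖pth x u τ - x‖ ≤ √m * ∫ q in (0 : ℝ)..τ, ‖u q‖ := by gcongr
    _ = ∫ q in (0 : ℝ)..τ, √m * ‖u q‖ := by rw [intervalIntegral.integral_const_mul]
    _ ≤ len g t x u 0 τ := by
      refine intervalIntegral.integral_mono_on hτ (hu.norm.const_mul _).intervalIntegrable
        (intervalIntegrable_nm hg ht (continuous_pth hu) hu _ _) fun s hs => ?_
      rw [nm, ← Real.sqrt_sq (norm_nonneg (u s)), ← Real.sqrt_mul hm]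
      exact Real.sqrt_le_sqrt (hle _ (hin s hs) _)

/-- Short paths stay in a ball around their starting point, uniformly in time. -/
lemma exists_short_paths_stay (hg : SmoothMetricFamily g (Iio T)) {a b : ℝ} (hb : b < T)
    (x : Fin n → ℝ) {ρ : ℝ} (hρ : 0 < ρ) :
    ∃ r > 0, ∀ t ∈ Icc a b, ∀ u : ℝ → Fin n → ℝ, Integrable u → ∀ s, 0 ≤ s →
      len g t x u 0 s < r → ‖pth x u s - x‖ < ρ := by
  have hK : IsCompact (Metric.closedBall x ρ ×ˢ Icc a b) :=
    (isCompact_closedBall _ _).prod isCompact_Icc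
  obtain ⟨m, hm0, hm⟩ := exists_le_qf hg hK fun p hp => mem_dom.2 (hp.2.2.trans_lt hb)
  refine ⟨√m * ρ, by positivity, fun t ht u hu s hs hlen => ?_⟩
  by_contra! hcon
  obtain ⟨τ, hτ, hτρ, hin⟩ := exists_exit_time hu hρ hs hcon
  have htT := ht.2.trans_lt hb
  have h := len_ge_of_exit hg htT hu hm0.le hτ.1
    (fun y hy v => hm (y, t) ⟨by simpa [dist_eq_norm] using hy, ht⟩ v) hin
  rw [hτρ] at h
  have h2 := len_add (x := x) hg htT hu 0 τ s
  linarith [len_nonneg (g := g) (t := t) (x := x) (u := u) hτ.2]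

end paths

section reach

variable {g : (Fin n → ℝ) → ℝ → Matrix (Fin n) (Fin n) ℝ} {T t : ℝ} {x y z : Fin n → ℝ}
  {u : ℝ → Fin n → ℝ} {r r' : ℝ}

/-- `y` can be joined to `x` by a path with integrable velocity of length less than `r`. -/
def Rch (g : (Fin n → ℝ) → ℝ → Matrix (Fin n) (Fin n) ℝ) (t r : ℝ) (x y : Fin n → ℝ) : Prop :=
  ∃ u : ℝ → Fin n → ℝ, Integrable u ∧ pth x u 1 = y ∧ len g t x u 0 1 < r

lemma Rch.of_window (hu : Integrable u) {a b : ℝ} (hab : a ≤ b)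
    (h : len g t x u a b < r) : Rch g t r (pth x u a) (pth x u b) := by
  set c := b - a with hc
  have hc0 : 0 ≤ c := sub_nonneg.2 hab
  have hp : ∀ s, pth (pth x u a) (fun s => c • u (c * s + a)) s = pth x u (c * s + a) := by
    intro s
    rw [sub_eq_iff_eq_add'.1 (pth_sub (x := x) hu a (c * s + a)), pth,
      intervalIntegral.integral_smul, intervalIntegral.smul_integral_comp_mul_add, mul_zero,
      zero_add]
  refine ⟨fun s => c • u (c * s + a), ?_, ?_, ?_⟩
  · rcases eq_or_ne c 0 with h0 | h0
    · simp [h0]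
    · exact (Integrable.comp_mul_left' (hu.comp_add_right a) h0).smul c
  · rw [hp, hc]; congr 1; ring
  · simp only [len, hp, nm_smul, abs_of_nonneg hc0]
    rw [intervalIntegral.integral_const_mul, intervalIntegral.mul_integral_comp_mul_add
      (f := fun s => nm g (pth x u s, t) (u s))]
    convert h using 1
    simp [len, hc]

lemma Rch.symm (h : Rch g t r x y) : Rch g t r y x := by
  obtain ⟨u, hu, rfl, hl⟩ := h
  have hp : ∀ s, pth (pth x u 1) (fun s => -u (1 - s)) s = pth x u (1 - s) := by
    intro s
    rw [sub_eq_iff_eq_add'.1 (pth_sub (x := x) hu 1 (1 - s)), pth, intervalIntegral.integral_neg,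
      intervalIntegral.integral_comp_sub_left (fun s => u s), intervalIntegral.integral_symm]
    simp
  refine ⟨fun s => -u (1 - s), (hu.comp_sub_left 1).neg, by simp [hp], ?_⟩
  simp only [len, hp, nm_neg]
  rw [intervalIntegral.integral_comp_sub_left (fun s => nm g (pth x u s, t) (u s))]
  simpa [len] using hl

lemma Rch.trans (hg : SmoothMetricFamily g (Iio T)) (ht : t < T) (h : Rch g t r x y)
    (h' : Rch g t r' y z) : Rch g t (r + r') x z := by
  obtain ⟨u, hu, rfl, hl⟩ := h
  obtain ⟨v, hv, rfl, hl'⟩ := h'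
  set w : ℝ → Fin n → ℝ := (Iic 1).piecewise u fun s => v (s - 1) with hw
  have hwi : Integrable w :=
    Integrable.piecewise measurableSet_Iic hu.integrableOn (hv.comp_sub_right 1).integrableOn
  have w1 : ∀ s ≤ 1, w s = u s := fun s hs => piecewise_eq_of_mem _ _ _ hs
  have w2 : ∀ s, 1 < s → w s = v (s - 1) := fun s hs => piecewise_eq_of_notMem _ _ _ (not_le.2 hs)
  have p1 : ∀ s ∈ Icc (0 : ℝ) 1, pth x w s = pth x u s := by
    intro s hs
    rw [pth, pth, intervalIntegral.integral_congr fun q hq => w1 q ?_]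
    rw [uIcc_of_le hs.1] at hq
    exact hq.2.trans hs.2
  have p2 : ∀ s, 1 ≤ s → pth x w s = pth (pth x u 1) v (s - 1) := by
    intro s hs
    rw [sub_eq_iff_eq_add'.1 (pth_sub (x := x) hwi 1 s), p1 1 ⟨zero_le_one, le_rfl⟩]
    conv_rhs => rw [pth]
    congr 1
    rw [intervalIntegral.integral_of_le hs, setIntegral_congr_fun measurableSet_Ioc
      fun q hq => w2 q hq.1, ← intervalIntegral.integral_of_le hs,
      intervalIntegral.integral_comp_sub_right (fun q => v q)]
    simp
  have l1 : len g t x w 0 1 = len g t x u 0 1 := by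
    refine intervalIntegral.integral_congr fun q hq => ?_
    rw [uIcc_of_le zero_le_one] at hq
    rw [p1 q hq, w1 q hq.2]
  have l2 : len g t x w 1 2 = len g t (pth x u 1) v 0 1 := by
    rw [len, intervalIntegral.integral_of_le one_le_two]
    rw [setIntegral_congr_fun (g := fun q => nm g (pth (pth x u 1) v (q - 1), t) (v (q - 1)))
      measurableSet_Ioc fun q hq => by beta_reduce; rw [p2 q hq.1.le, w2 q hq.1],
      ← intervalIntegral.integral_of_le one_le_two, intervalIntegral.integral_comp_sub_right
      (fun q => nm g (pth (pth x u 1) v q, t) (v q))]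
    norm_num [len]
  have h3 := Rch.of_window (g := g) (t := t) (x := x) hwi (zero_le_two (α := ℝ)) (r := r + r')
    (by rw [← len_add hg ht hwi 0 1 2, l1, l2]; linarith)
  rw [p2 2 one_le_two, pth_zero] at h3
  convert h3 using 2; norm_num

lemma Rch.mono (h : Rch g t r x y) (hr : r ≤ r') : Rch g t r' x y := by
  obtain ⟨u, hu, h1, h2⟩ := h
  exact ⟨u, hu, h1, h2.trans_le hr⟩

lemma Rch.split (hg : SmoothMetricFamily g (Iio T)) (ht : t < T) (h : Rch g t r x z) :
    ∃ y, Rch g t (r / 2) x y ∧ Rch g t (r / 2) y z := by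
  obtain ⟨u, hu, rfl, hl⟩ := h
  have hc : Continuous (len g t x u 0) := intervalIntegral.continuous_primitive
    (fun a b => intervalIntegrable_nm hg ht (continuous_pth hu) hu a b) 0
  have h0 : len g t x u 0 0 = 0 := by simp [len]
  have h1 := len_nonneg (g := g) (t := t) (x := x) (u := u) zero_le_one
  obtain ⟨s, hs, hs'⟩ := intermediate_value_Icc zero_le_one hc.continuousOn
    (show len g t x u 0 1 / 2 ∈ Icc (len g t x u 0 0) (len g t x u 0 1) from
      ⟨by rw [h0]; linarith, by linarith⟩)
  refine ⟨pth x u s, ?_, Rch.of_window hu hs.2 ?_⟩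
  · have := Rch.of_window (g := g) (t := t) (x := x) hu hs.1 (r := r / 2) (by linarith)
    rwa [pth_zero] at this
  · linarith [len_add (x := x) hg ht hu 0 s 1]

lemma pth_segment {s : ℝ} (hs : s ∈ Icc (0 : ℝ) 1) :
    pth x ((Icc (0 : ℝ) 1).indicator fun _ => y - x) s = x + s • (y - x) := by
  rw [pth, intervalIntegral.integral_congr (g := fun _ => y - x) fun q hq => ?_]
  · simp [smul_sub]
  · rw [uIcc_of_le hs.1] at hq
    exact indicator_of_mem (s := Icc (0 : ℝ) 1) ⟨hq.1, hq.2.trans hs.2⟩ _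

lemma exists_segment_bound (hg : SmoothMetricFamily g (Iio T)) (ht : t < T) (z : Fin n → ℝ)
    (ρ : ℝ) : ∃ M > 0, ∀ x ∈ Metric.closedBall z ρ, ∀ y ∈ Metric.closedBall z ρ, ∀ r,
      M * ‖y - x‖ < r → Rch g t r x y := by
  have hK : IsCompact (Metric.closedBall z ρ ×ˢ ({t} : Set ℝ)) :=
    (isCompact_closedBall _ _).prod isCompact_singleton
  obtain ⟨M, hM0, hM⟩ := exists_qf_le hg hK fun p hp => mem_dom.2 (by rw [hp.2]; exact ht)
  refine ⟨√M, by positivity, fun x hx y hy r hr => ?_⟩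
  have hu : Integrable ((Icc (0 : ℝ) 1).indicator fun _ => y - x) := by
    rw [integrable_indicator_iff measurableSet_Icc]
    exact continuousOn_const.integrableOn_Icc
  refine ⟨_, hu, ?_, lt_of_le_of_lt ?_ hr⟩
  · rw [pth_segment ⟨zero_le_one, le_rfl⟩]; simp
  · calc len g t x _ 0 1 ≤ ∫ _ in (0 : ℝ)..1, √M * ‖y - x‖ := by
          refine intervalIntegral.integral_mono_on zero_le_one
            (intervalIntegrable_nm hg ht (continuous_pth hu) hu _ _) (by simp) fun s hs => ?_
          rw [pth_segment hs, indicator_of_mem hs, nm, ← Real.sqrt_sq (norm_nonneg (y - x)),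
            ← Real.sqrt_mul hM0.le]
          refine Real.sqrt_le_sqrt (hM (_, t) ⟨?_, mem_singleton _⟩ _)
          exact (convex_closedBall z ρ).add_smul_sub_mem hx hy hs
      _ = √M * ‖y - x‖ := by simp

end reach

section dist

variable {g : (Fin n → ℝ) → ℝ → Matrix (Fin n) (Fin n) ℝ} {T t : ℝ} {x y z : Fin n → ℝ}
  {u : ℝ → Fin n → ℝ} {r r' : ℝ}

lemma pathLength_eq (γ : ℝ → Fin n → ℝ) :
    pathLength (fun x => g x t) γ = ∫ s in (0 : ℝ)..1, nm g (γ s, t) (deriv γ s) := rfl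

lemma Rch.of_riemDist (h : riemDist (fun x => g x t) x y < r) : Rch g t r x y := by
  obtain ⟨L, ⟨γ, hγ, rfl, rfl, rfl⟩, hL⟩ := exists_lt_of_csInf_lt (by
    refine ⟨_, fun s => x + s • (y - x), ?_, ?_, ?_, rfl⟩
    · exact ContDiff.contDiffOn (by fun_prop)
    · simp
    · simp) h
  set u : ℝ → Fin n → ℝ := (Ioo (0 : ℝ) 1).indicator (derivWithin γ (Icc 0 1)) with hu
  have hc : ContinuousOn (derivWithin γ (Icc (0 : ℝ) 1)) (Icc 0 1) :=
    hγ.continuousOn_derivWithin (uniqueDiffOn_Icc zero_lt_one) le_rfl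
  have hui : Integrable u := by
    rw [hu, integrable_indicator_iff measurableSet_Ioo]
    exact (hc.integrableOn_Icc).mono_set Ioo_subset_Icc_self
  have hd : ∀ s ∈ Ioo (0 : ℝ) 1, HasDerivAt γ (u s) s := by
    intro s hs
    have h1 := ((hγ.differentiableOn (by simp)) s
      (Ioo_subset_Icc_self hs)).hasDerivWithinAt.hasDerivAt (Icc_mem_nhds hs.1 hs.2)
    rwa [hu, indicator_of_mem hs]
  have hp : ∀ s ∈ Icc (0 : ℝ) 1, pth (γ 0) u s = γ s := by
    intro s hs
    rw [pth, intervalIntegral.integral_eq_sub_of_hasDerivAt_of_le hs.1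
      (hγ.continuousOn.mono (Icc_subset_Icc_right hs.2))
      (fun q hq => hd q ⟨hq.1, hq.2.trans_le hs.2⟩) hui.intervalIntegrable]
    abel
  refine ⟨u, hui, hp 1 ⟨zero_le_one, le_rfl⟩, lt_of_eq_of_lt ?_ hL⟩
  rw [pathLength_eq, len, intervalIntegral.integral_of_le zero_le_one,
    intervalIntegral.integral_of_le zero_le_one, integral_Ioc_eq_integral_Ioo,
    integral_Ioc_eq_integral_Ioo]
  refine setIntegral_congr_fun measurableSet_Ioo fun s hs => ?_
  rw [hp s (Ioo_subset_Icc_self hs), (hd s hs).deriv]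

lemma Rch.riemDist_lt (hg : SmoothMetricFamily g (Iio T)) (ht : t < T) (h : Rch g t r x y) :
    riemDist (fun x => g x t) x y < r := by
  obtain ⟨u, hu, rfl, hl⟩ := h
  set L := len g t x u 0 1 with hLdef
  have hL0 : 0 ≤ L := len_nonneg zero_le_one
  obtain ⟨ε, hε, hεL⟩ : ∃ ε > 0, (1 + ε) * L < r := by
    refine ⟨(r - L) / (2 * (L + 1)), by have := sub_pos.2 hl; positivity, ?_⟩
    have h1 : (r - L) / (2 * (L + 1)) * L ≤ (r - L) / 2 := by
      rw [div_mul_eq_mul_div, div_le_div_iff₀ (by positivity) two_pos]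
      nlinarith
    nlinarith
  set R := ∫ q, ‖u q‖ with hR
  have hle : ∀ s ∈ Icc (0 : ℝ) 1, ‖pth x u s - x‖ ≤ R := by
    intro s hs
    have h1 := norm_pth_sub_le (x := x) hu hs.1
    rw [pth_zero, intervalIntegral.integral_of_le hs.1] at h1
    exact h1.trans (setIntegral_le_integral hu.norm (ae_of_all _ fun _ => norm_nonneg _))
  have hK : IsCompact (Metric.closedBall x (R + 1) ×ˢ ({t} : Set ℝ)) :=
    (isCompact_closedBall _ _).prod isCompact_singleton
  have hKT : ∀ p ∈ Metric.closedBall x (R + 1) ×ˢ ({t} : Set ℝ), p ∈ dom n T :=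
    fun p hp => mem_dom.2 (by rw [hp.2]; exact ht)
  obtain ⟨M, hM0, hM⟩ := exists_qf_le hg hK hKT
  obtain ⟨η, hη0, hη⟩ := exists_qf_comparison hg hK hKT hε
  have hgap := sub_pos.2 hεL
  obtain ⟨δ, hδ0, hδη, hδ1, hδM⟩ : ∃ δ > 0, 2 * δ < η ∧ 2 * δ ≤ 1 ∧
      √M * (2 * δ) < r - (1 + ε) * L := by
    have hsM : 0 < √M := Real.sqrt_pos.2 hM0
    refine ⟨min (η / 4) (min (1 / 2) ((r - (1 + ε) * L) / (4 * √M))), by positivity, ?_, ?_, ?_⟩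
    · linarith [min_le_left (η / 4) (min (1 / 2) ((r - (1 + ε) * L) / (4 * √M)))]
    · linarith [(min_le_right (η / 4) (min (1 / 2) ((r - (1 + ε) * L) / (4 * √M)))).trans
        (min_le_left _ _)]
    · have h1 := (min_le_right (η / 4) (min (1 / 2) ((r - (1 + ε) * L) / (4 * √M)))).trans
        (min_le_right _ _)
      have h2 := mul_le_mul_of_nonneg_left h1 (show 0 ≤ 2 * √M by positivity)
      have h3 : 2 * √M * ((r - (1 + ε) * L) / (4 * √M)) = (r - (1 + ε) * L) / 2 := by
        field_simp; norm_num
      nlinarith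
  obtain ⟨v, -, hv, hvc, hvi⟩ := hu.exists_hasCompactSupport_integral_sub_le hδ0
  have huv : Integrable fun s => u s - v s := hu.sub hvi
  set c := ∫ s in (0 : ℝ)..1, (u s - v s) with hc
  have hcδ : ‖c‖ ≤ δ := by
    refine (intervalIntegral.norm_integral_le_integral_norm zero_le_one).trans ?_
    rw [intervalIntegral.integral_of_le zero_le_one]
    exact (setIntegral_le_integral huv.norm (ae_of_all _ fun _ => norm_nonneg _)).trans hv
  set w : ℝ → Fin n → ℝ := fun s => v s + c with hw
  have hwc : Continuous w := by fun_prop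
  have hwu : ∫ s in (0 : ℝ)..1, ‖w s - u s‖ ≤ 2 * δ := by
    have h1 : ∫ s in (0 : ℝ)..1, ‖w s - u s‖ ≤ ∫ s in (0 : ℝ)..1, (‖u s - v s‖ + ‖c‖) := by
      refine intervalIntegral.integral_mono_on zero_le_one ?_ ?_ fun s _ => ?_
      · exact ((hwc.intervalIntegrable _ _).sub hu.intervalIntegrable).norm
      · exact huv.norm.intervalIntegrable.add (by simp)
      · rw [hw, add_sub_right_comm, ← norm_neg (u s - v s), neg_sub]
        exact norm_add_le _ _
    rw [intervalIntegral.integral_add huv.norm.intervalIntegrable (by simp),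
      intervalIntegral.integral_of_le (f := fun s => ‖u s - v s‖) zero_le_one] at h1
    have h2 := (setIntegral_le_integral (s := Ioc (0 : ℝ) 1) huv.norm
      (ae_of_all _ fun _ => norm_nonneg _)).trans hv
    simp only [intervalIntegral.integral_const, sub_zero, one_smul] at h1
    linarith
  have hintg : ∀ a b, IntervalIntegrable (fun s => w s - u s) volume a b := fun a b =>
    (hwc.intervalIntegrable _ _).sub hu.intervalIntegrable
  have hpd : ∀ s, pth x w s - pth x u s = ∫ q in (0 : ℝ)..s, (w q - u q) := by
    intro s
    rw [intervalIntegral.integral_sub (hwc.intervalIntegrable _ _) hu.intervalIntegrable, pth, pth]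
    abel
  have hpw : ∀ s ∈ Icc (0 : ℝ) 1, ‖pth x w s - pth x u s‖ ≤ 2 * δ := by
    intro s hs
    rw [hpd]
    refine (intervalIntegral.norm_integral_le_integral_norm hs.1).trans (le_trans ?_ hwu)
    exact intervalIntegral.integral_mono_interval le_rfl hs.1 hs.2
      (ae_of_all _ fun _ => norm_nonneg _) (hintg 0 1).norm
  have hp1 : pth x w 1 = pth x u 1 := by
    rw [← sub_eq_zero, hpd]
    have h1 : ∀ q, w q - u q = c - (u q - v q) := fun q => by simp only [hw]; abel
    simp only [h1]
    rw [intervalIntegral.integral_sub (by simp) huv.intervalIntegrable, ← hc]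
    simp
  have hder : ∀ s, HasDerivAt (pth x w) (w s) s := fun s =>
    (intervalIntegral.integral_hasDerivAt_right (hwc.intervalIntegrable _ _)
      (hwc.stronglyMeasurableAtFilter _ _) hwc.continuousAt).const_add x
  have hdw : deriv (pth x w) = w := funext fun s => (hder s).deriv
  have hC1 : ContDiff ℝ 1 (pth x w) := by
    rw [contDiff_one_iff_deriv, hdw]
    exact ⟨fun s => (hder s).differentiableAt, hwc⟩
  have hpc := hC1.continuous
  have hfin : pathLength (fun x => g x t) (pth x w) < r := by
    rw [pathLength_eq, hdw]
    have h1 : ∫ s in (0 : ℝ)..1, nm g (pth x w s, t) (w s) ≤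
        ∫ s in (0 : ℝ)..1, (√M * ‖w s - u s‖ + (1 + ε) * nm g (pth x u s, t) (u s)) := by
      refine intervalIntegral.integral_mono_on zero_le_one
        (((continuous_nm hg ht).comp (hpc.prodMk hwc)).intervalIntegrable _ _)
        (((hintg 0 1).norm.const_mul _).add
          ((intervalIntegrable_nm hg ht (continuous_pth hu) hu _ _).const_mul _)) fun s hs => ?_
      have e1 := hpw s hs
      have e2 := hle s hs
      have m1 : (pth x w s, t) ∈ Metric.closedBall x (R + 1) ×ˢ ({t} : Set ℝ) := by
        refine ⟨?_, mem_singleton _⟩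
        rw [mem_closedBall_iff_norm]
        have := norm_add_le (pth x w s - pth x u s) (pth x u s - x)
        rw [sub_add_sub_cancel] at this
        linarith
      have m2 : (pth x u s, t) ∈ Metric.closedBall x (R + 1) ×ˢ ({t} : Set ℝ) := by
        refine ⟨?_, mem_singleton _⟩
        rw [mem_closedBall_iff_norm]
        linarith
      have hdist : dist (pth x u s, t) (pth x w s, t) < η := by
        rw [dist_comm, Prod.dist_eq, dist_self, max_eq_left dist_nonneg, dist_eq_norm]
        linarith
      have e3 : nm g (pth x w s, t) (w s - u s) ≤ √M * ‖w s - u s‖ := by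
        rw [nm, ← Real.sqrt_sq (norm_nonneg (w s - u s)), ← Real.sqrt_mul hM0.le]
        exact Real.sqrt_le_sqrt (hM _ m1 _)
      have e4 : nm g (pth x w s, t) (u s) ≤ (1 + ε) * nm g (pth x u s, t) (u s) := by
        refine Real.sqrt_le_iff.2 ⟨mul_nonneg (by positivity) (nm_nonneg _), ?_⟩
        rw [mul_pow, nm_sq hg (by exact ht)]
        refine (hη _ m2 _ m1 hdist (u s)).trans ?_
        have := qf_nonneg hg (p := (pth x u s, t)) ht (u s)
        nlinarith [mul_nonneg hε.le this, mul_nonneg (mul_nonneg hε.le hε.le) this]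
      have e5 := nm_add_le hg (p := (pth x w s, t)) ht (w s - u s) (u s)
      rw [sub_add_cancel] at e5
      linarith
    rw [intervalIntegral.integral_add ((hintg 0 1).norm.const_mul _)
      ((intervalIntegrable_nm hg ht (continuous_pth hu) hu _ _).const_mul _),
      intervalIntegral.integral_const_mul, intervalIntegral.integral_const_mul] at h1
    have h2 := mul_le_mul_of_nonneg_left hwu (Real.sqrt_nonneg M)
    change _ ≤ _ + (1 + ε) * L at h1
    linarith
  refine lt_of_le_of_lt (csInf_le ⟨0, ?_⟩ ?_) hfin
  · rintro _ ⟨γ, -, -, -, rfl⟩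
    rw [pathLength_eq]
    exact intervalIntegral.integral_nonneg zero_le_one fun _ _ => nm_nonneg _
  · exact ⟨pth x w, hC1.contDiffOn, pth_zero, hp1, rfl⟩

end dist

section hopfRinow

variable {g : (Fin n → ℝ) → ℝ → Matrix (Fin n) (Fin n) ℝ} {T t : ℝ} {x y z : Fin n → ℝ}
  {u : ℝ → Fin n → ℝ} {r r' : ℝ}

lemma Rch.pos (h : Rch g t r x y) : 0 < r := by
  obtain ⟨u, -, -, h⟩ := h
  exact (len_nonneg zero_le_one).trans_lt h

lemma Rch.refl (hg : SmoothMetricFamily g (Iio T)) (ht : t < T) (hr : 0 < r) : Rch g t r x x := by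
  obtain ⟨M, -, hM⟩ := exists_segment_bound hg ht x 1
  exact hM x (by simp) x (by simp) r (by simpa using hr)

/-- If a ball is unbounded, so is a smaller ball around some nearby point. -/
lemma exists_unbounded_ball (hg : SmoothMetricFamily g (Iio T)) (ht : t < T)
    (h : ∀ R, ∃ y, Rch g t r x y ∧ R < ‖y‖) :
    ∃ y, Rch g t (3 / 4 * r) x y ∧ ∀ R, ∃ z, Rch g t (3 / 4 * r) y z ∧ R < ‖z‖ := by
  have hr : 0 < r := (h 0).choose_spec.1.pos
  by_cases hu : ∀ R, ∃ y, Rch g t (r / 2) x y ∧ R < ‖y‖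
  · refine ⟨x, Rch.refl hg ht (by positivity), fun R => ?_⟩
    obtain ⟨y, hy, hR⟩ := hu R
    exact ⟨y, hy.mono (by linarith), hR⟩
  · push Not at hu
    obtain ⟨R₀, hR₀⟩ := hu
    choose z hz hzn using fun k : ℕ => h k
    choose y hy hy' using fun k => (hz k).split hg ht
    have hyb : ∀ k, y k ∈ Metric.closedBall (0 : Fin n → ℝ) R₀ := fun k => by
      simpa using hR₀ _ (hy k)
    obtain ⟨a, ha, φ, hφ, hlim⟩ := (isCompact_closedBall (0 : Fin n → ℝ) R₀).tendsto_subseq hyb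
    obtain ⟨M, hM0, hM⟩ := exists_segment_bound hg ht (0 : Fin n → ℝ) R₀
    have hsmall : ∀ᶠ k in Filter.atTop, M * ‖a - y (φ k)‖ < r / 4 := by
      have h1 : Filter.Tendsto (fun k => M * ‖a - y (φ k)‖) Filter.atTop (𝓝 (M * ‖a - a‖)) :=
        ((tendsto_const_nhds.sub hlim).norm).const_mul M
      refine h1.eventually_lt_const ?_
      simp; positivity
    have hnear : ∀ᶠ k in Filter.atTop, Rch g t (r / 4) (y (φ k)) a :=
      hsmall.mono fun k hk => hM _ (hyb _) _ ha _ hk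
    refine ⟨a, ?_, fun R => ?_⟩
    · obtain ⟨k, hk⟩ := hnear.exists
      exact ((hy (φ k)).trans hg ht hk).mono (by linarith)
    · obtain ⟨k, hk, hkR⟩ := (hnear.and (hφ.tendsto_atTop.eventually
        (Filter.tendsto_atTop.1 tendsto_natCast_atTop_atTop R))).exists
      exact ⟨z (φ k), (hk.symm.trans hg ht (hy' (φ k))).mono (by linarith), hkR.trans_lt (hzn _)⟩

/-- Balls of a complete metric are bounded. -/
lemma Rch.bounded (hg : SmoothMetricFamily g (Iio T)) (ht : t < T)
    (hc : riemComplete (fun x => g x t)) (r : ℝ) (x : Fin n → ℝ) :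
    ∃ R, ∀ y, Rch g t r x y → ‖y‖ ≤ R := by
  by_contra! hcon
  have hr : 0 < r := (hcon 0).choose_spec.1.pos
  let A := {p : (Fin n → ℝ) × ℝ // ∀ R, ∃ y, Rch g t p.2 p.1 y ∧ R < ‖y‖}
  have hstep : ∀ p : A, ∃ q : A, q.1.2 = 3 / 4 * p.1.2 ∧ Rch g t p.1.2 p.1.1 q.1.1 := by
    rintro ⟨⟨x, r⟩, h⟩
    have hr : 0 < r := (h 0).choose_spec.1.pos
    obtain ⟨y, hy, hy'⟩ := exists_unbounded_ball hg ht h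
    exact ⟨⟨(y, 3 / 4 * r), hy'⟩, rfl, hy.mono (by linarith)⟩
  choose F hF1 hF2 using hstep
  let s : ℕ → A := fun k => F^[k] ⟨(x, r), hcon⟩
  have hs : ∀ k, s (k + 1) = F (s k) := fun k => Function.iterate_succ_apply' _ _ _
  have hsr : ∀ k, (s k).1.2 = (3 / 4) ^ k * r := by
    intro k
    induction k with
    | zero => simp [s]
    | succ k ih => rw [hs, hF1, ih]; ring
  have hchain : ∀ k p, Rch g t (4 * ((3 / 4) ^ p * r)) (s p).1.1 (s (p + k)).1.1 := by
    intro k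
    induction k with
    | zero => exact fun p => Rch.refl hg ht (by positivity)
    | succ k ih =>
      intro p
      have h1 := hF2 (s p)
      rw [← hs, hsr] at h1
      have h2 := h1.trans hg ht (ih (p + 1))
      rw [show p + 1 + k = p + (k + 1) by ring] at h2
      exact h2.mono (le_of_eq (by ring))
  have hto : Filter.Tendsto (fun k : ℕ => 4 * ((3 / 4 : ℝ) ^ k * r)) Filter.atTop (𝓝 0) := by
    simpa using ((tendsto_pow_atTop_nhds_zero_of_lt_one (by norm_num : (0 : ℝ) ≤ 3 / 4)
      (by norm_num)).mul_const r).const_mul 4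
  have hmono : ∀ N p, N ≤ p → 4 * ((3 / 4 : ℝ) ^ p * r) ≤ 4 * ((3 / 4 : ℝ) ^ N * r) := by
    intro N p hp
    have := pow_le_pow_of_le_one (by norm_num : (0 : ℝ) ≤ 3 / 4) (by norm_num) hp
    gcongr
  obtain ⟨z, hz⟩ := hc (fun k => (s k).1.1) (by
    intro ε hε
    obtain ⟨N, hN⟩ := (hto.eventually_lt_const hε).exists
    refine ⟨N, fun p hp q hq => Rch.riemDist_lt hg ht ?_⟩
    rcases le_total p q with h | h
    · obtain ⟨k, rfl⟩ := Nat.exists_eq_add_of_le h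
      exact (hchain k p).mono ((hmono N p hp).trans hN.le)
    · obtain ⟨k, rfl⟩ := Nat.exists_eq_add_of_le h
      exact (hchain k q).symm.mono ((hmono N q hq).trans hN.le))
  obtain ⟨r₀, hr₀, hstay⟩ := exists_short_paths_stay (a := t) (b := t) hg ht z one_pos
  obtain ⟨N, hN⟩ := hz (r₀ / 2) (by positivity)
  obtain ⟨p, hpN, hp⟩ := ((Filter.eventually_ge_atTop N).and
    (hto.eventually_lt_const (show (0 : ℝ) < r₀ / 2 by positivity))).exists
  have h1 := Rch.of_riemDist (hN p hpN)
  obtain ⟨y, hy, hyn⟩ := (s p).2 (‖z‖ + 1)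
  rw [hsr] at hy
  obtain ⟨u, hu, rfl, hl⟩ := h1.symm.trans hg ht hy
  have hpos : 0 < (3 / 4 : ℝ) ^ p * r := by positivity
  have h2 := hstay t ⟨le_rfl, le_rfl⟩ u hu 1 zero_le_one (by linarith)
  have h3 := norm_le_norm_sub_add (pth z u 1) z
  linarith

/-- Paths of bounded length stay in a compact set, uniformly in time. -/
lemma exists_paths_bounded (hg : SmoothMetricFamily g (Iio T))
    (hc : ∀ t ∈ Iio T, riemComplete (fun x => g x t)) {a b : ℝ} (hb : b < T)
    (x : Fin n → ℝ) (r : ℝ) :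
    ∃ R > 0, ∀ t ∈ Icc a b, ∀ u : ℝ → Fin n → ℝ, Integrable u → len g t x u 0 1 < r →
      ∀ s ∈ Icc (0 : ℝ) 1, ‖pth x u s - x‖ ≤ R := by
  suffices H : ∃ R, ∀ t ∈ Icc a b, ∀ u : ℝ → Fin n → ℝ, Integrable u → len g t x u 0 1 < r →
      ∀ s ∈ Icc (0 : ℝ) 1, ‖pth x u s - x‖ ≤ R by
    obtain ⟨R, hR⟩ := H
    exact ⟨max R 1, by positivity, fun t ht u hu hl s hs =>
      (hR t ht u hu hl s hs).trans (le_max_left _ _)⟩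
  refine isCompact_Icc.induction_on (p := fun S => ∃ R, ∀ t ∈ S, ∀ u : ℝ → Fin n → ℝ,
    Integrable u → len g t x u 0 1 < r → ∀ s ∈ Icc (0 : ℝ) 1, ‖pth x u s - x‖ ≤ R) ?_ ?_ ?_ ?_
  · exact ⟨0, by simp⟩
  · rintro S S' hS ⟨R, hR⟩
    exact ⟨R, fun t ht => hR t (hS ht)⟩
  · rintro S S' ⟨R, hR⟩ ⟨R', hR'⟩
    refine ⟨max R R', ?_⟩
    rintro t (ht | ht) u hu hl s hs
    · exact (hR t ht u hu hl s hs).trans (le_max_left _ _)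
    · exact (hR' t ht u hu hl s hs).trans (le_max_right _ _)
  · intro t₁ ht₁
    have ht₁T : t₁ < T := ht₁.2.trans_lt hb
    obtain ⟨R, hR⟩ := Rch.bounded hg ht₁T (hc t₁ ht₁T) (2 * r) x
    have hR0 : 0 ≤ max R 0 := le_max_right _ _
    set ρ := max R 0 + ‖x‖ + 1 with hρ
    have hK : IsCompact (Metric.closedBall x ρ ×ˢ Icc a b) :=
      (isCompact_closedBall _ _).prod isCompact_Icc
    have hKT : ∀ p ∈ Metric.closedBall x ρ ×ˢ Icc a b, p ∈ dom n T :=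
      fun p hp => mem_dom.2 (hp.2.2.trans_lt hb)
    obtain ⟨η, hη0, hη⟩ := exists_qf_comparison hg hK hKT (show (0 : ℝ) < 3 by norm_num)
    refine ⟨Icc a b ∩ Metric.ball t₁ η,
      inter_mem_nhdsWithin _ (Metric.ball_mem_nhds _ hη0), ρ, ?_⟩
    rintro t ⟨ht, htη⟩ u hu hl s hs
    have htT : t < T := ht.2.trans_lt hb
    by_contra! hcon
    obtain ⟨τ, hτ, hτρ, hin⟩ := exists_exit_time hu (by positivity) hs.1 hcon.le
    have hτ1 : τ ∈ Icc (0 : ℝ) 1 := ⟨hτ.1, hτ.2.trans hs.2⟩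
    have h1 : len g t₁ x u 0 τ ≤ 2 * len g t x u 0 τ := by
      rw [len, len, ← intervalIntegral.integral_const_mul]
      refine intervalIntegral.integral_mono_on hτ.1
        (intervalIntegrable_nm hg ht₁T (continuous_pth hu) hu _ _)
        ((intervalIntegrable_nm hg htT (continuous_pth hu) hu _ _).const_mul _) fun q hq => ?_
      refine Real.sqrt_le_iff.2 ⟨mul_nonneg two_pos.le (nm_nonneg _), ?_⟩
      rw [mul_pow, nm_sq hg (by exact htT)]
      have hq' : pth x u q ∈ Metric.closedBall x ρ := mem_closedBall_iff_norm.2 (hin q hq)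
      refine (hη (_, t) ⟨hq', ht⟩ (_, t₁) ⟨hq', ht₁⟩ ?_ _).trans (le_of_eq (by norm_num [pth]))
      rw [Prod.dist_eq, dist_self, max_eq_right dist_nonneg]
      exact htη
    have h2 := len_le (x := x) hg htT hu hτ1
    have h3 := Rch.of_window (g := g) (t := t₁) (x := x) hu hτ.1 (r := 2 * r) (by linarith)
    rw [pth_zero] at h3
    have h4 := hR _ h3
    have h5 := norm_sub_le (pth x u τ) x
    linarith [le_max_left R 0]

end hopfRinow

section weak

/-- Bounded sequences in a separable Hilbert space have weakly convergent subsequences. -/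
lemma exists_weak_subseq {H : Type*} [NormedAddCommGroup H] [InnerProductSpace ℝ H]
    [CompleteSpace H] [TopologicalSpace.SeparableSpace H] (x : ℕ → H) {C : ℝ}
    (hx : ∀ k, ‖x k‖ ≤ C) : ∃ φ : ℕ → ℕ, StrictMono φ ∧ ∃ a : H, ∀ h : H,
      Filter.Tendsto (fun k => inner ℝ (x (φ k)) h) Filter.atTop (𝓝 (inner ℝ a h)) := by
  obtain ⟨f, -, φ, hφ, hf⟩ := WeakDual.isSeqCompact_closedBall ℝ H 0 C
    (x := fun k => WeakDual.toStrongDual.symm (InnerProductSpace.toDual ℝ H (x k)))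
    (fun k => by simpa using hx k)
  refine ⟨φ, hφ, (InnerProductSpace.toDual ℝ H).symm (WeakDual.toStrongDual f), fun h => ?_⟩
  rw [InnerProductSpace.toDual_symm_apply]
  exact ((WeakDual.eval_continuous h).tendsto f).comp hf

lemma exists_weak_subseq_memLp {μ : Measure ℝ} [IsFiniteMeasure μ] (u : ℕ → ℝ → Fin n → ℝ)
    (hu : ∀ k, MemLp (u k) 2 μ) {C : ℝ} (hC : ∀ k, ∫ s, ‖u k s‖ ^ 2 ∂μ ≤ C) :
    ∃ φ : ℕ → ℕ, StrictMono φ ∧ ∃ v : ℝ → Fin n → ℝ, MemLp v 2 μ ∧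
      ∀ h : ℝ → Fin n → ℝ, MemLp h 2 μ →
        Filter.Tendsto (fun k => ∫ s, u (φ k) s ⬝ᵥ h s ∂μ) Filter.atTop
          (𝓝 (∫ s, v s ⬝ᵥ h s ∂μ)) := by
  have : Fact ((2 : ENNReal) ≠ ⊤) := ⟨by simp⟩
  have hlp : ∀ {f : ℝ → Fin n → ℝ}, MemLp f 2 μ →
      MemLp (fun s => (WithLp.toLp 2 (f s) : EuclideanSpace ℝ (Fin n))) 2 μ := fun hf =>
    memLp_piLp_iff.2 fun i => hf.eval i
  have hinner : ∀ (f h : ℝ → Fin n → ℝ) (hf : MemLp f 2 μ) (hh : MemLp h 2 μ),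
      inner ℝ ((hlp hf).toLp _) ((hlp hh).toLp _) = ∫ s, f s ⬝ᵥ h s ∂μ := by
    intro f h hf hh
    rw [L2.inner_def]
    refine integral_congr_ae ?_
    filter_upwards [(hlp hf).coeFn_toLp, (hlp hh).coeFn_toLp] with s h1 h2
    rw [h1, h2, EuclideanSpace.inner_toLp_toLp, dotProduct_comm]
    simp
  have hbound : ∀ k, ‖(hlp (hu k)).toLp _‖ ≤ √(n * C) := by
    intro k
    refine Real.le_sqrt_of_sq_le ?_
    rw [← real_inner_self_eq_norm_sq, hinner _ _ (hu k) (hu k)]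
    calc ∫ s, u k s ⬝ᵥ u k s ∂μ ≤ ∫ s, n * ‖u k s‖ ^ 2 ∂μ := by
          refine integral_mono_of_nonneg (ae_of_all _ fun s => ?_)
            (((memLp_two_iff_integrable_sq_norm (hu k).1).1 (hu k)).const_mul _)
            (ae_of_all _ fun s => ?_)
          · exact Finset.sum_nonneg fun i _ => mul_self_nonneg _
          · refine (Finset.sum_le_card_nsmul _ _ (‖u k s‖ ^ 2) fun i _ => ?_).trans (by simp)
            have := norm_le_pi_norm (u k s) i
            rw [← sq, ← sq_abs]
            exact pow_le_pow_left₀ (abs_nonneg _) this 2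
      _ ≤ n * C := by
          rw [integral_const_mul]
          exact mul_le_mul_of_nonneg_left (hC k) (Nat.cast_nonneg n)
  obtain ⟨φ, hφ, a, ha⟩ := exists_weak_subseq _ hbound
  have hav : MemLp (fun s => (a s).ofLp) 2 μ := memLp_pi_iff.2 fun i => (Lp.memLp a).eval_piLp i
  refine ⟨φ, hφ, fun s => (a s).ofLp, hav, fun h hh => ?_⟩
  have e : a = (hlp hav).toLp _ := by
    refine Lp.ext ?_
    filter_upwards [(hlp hav).coeFn_toLp] with s h1
    rw [h1]
  have := ha ((hlp hh).toLp _)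
  rw [e, hinner _ _ hav hh] at this
  exact this.congr fun k => hinner _ _ (hu _) hh

end weak

section energy

variable {g : (Fin n → ℝ) → ℝ → Matrix (Fin n) (Fin n) ℝ} {T t : ℝ} {x y z : Fin n → ℝ}
  {u : ℝ → Fin n → ℝ} {r r' : ℝ}

/-- Admissible velocities. -/
def Adm (u : ℝ → Fin n → ℝ) : Prop := Integrable u ∧ MemLp u 2 volume

/-- The energy of the path starting at `x` with velocity `u`. -/
def erg (g : (Fin n → ℝ) → ℝ → Matrix (Fin n) (Fin n) ℝ) (t : ℝ) (x : Fin n → ℝ)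
    (u : ℝ → Fin n → ℝ) : ℝ := 1 / 2 * ∫ s in (0 : ℝ)..1, qf g (pth x u s, t) (u s)

lemma Adm.sq_integrable (hu : Adm u) : Integrable fun s => ‖u s‖ ^ 2 :=
  (memLp_two_iff_integrable_sq_norm hu.2.1).1 hu.2

lemma adm_zero : Adm (fun _ => 0 : ℝ → Fin n → ℝ) := ⟨by simp, by simp⟩

lemma continuous_qf (hg : SmoothMetricFamily g (Iio T)) (ht : t < T) :
    Continuous (fun z : (Fin n → ℝ) × (Fin n → ℝ) => qf g (z.1, t) z.2) :=
  (continuousOn_qf hg).comp_continuous (f := fun z : (Fin n → ℝ) × (Fin n → ℝ) =>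
    ((z.1, t), z.2)) (by fun_prop) fun z => ⟨mem_dom.2 ht, trivial⟩

lemma intervalIntegrable_qf (hg : SmoothMetricFamily g (Iio T)) (ht : t < T)
    {γ : ℝ → Fin n → ℝ} (hγ : Continuous γ) (hu : Adm u) (a b : ℝ) :
    IntervalIntegrable (fun s => qf g (γ s, t) (u s)) volume a b := by
  have hK : IsCompact ((fun s => (γ s, t)) '' uIcc a b) :=
    isCompact_uIcc.image (by fun_prop)
  obtain ⟨M, hM0, hM⟩ := exists_qf_le hg hK (by rintro _ ⟨s, -, rfl⟩; exact mem_dom.2 ht)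
  refine IntervalIntegrable.mono_fun (f := fun s => M * ‖u s‖ ^ 2)
    ((hu.sq_integrable.const_mul _).intervalIntegrable) ?_ ?_
  · exact (((continuous_qf hg ht).comp_aestronglyMeasurable
      (hγ.aestronglyMeasurable.prodMk hu.1.aestronglyMeasurable))).restrict
  · refine (ae_restrict_mem measurableSet_uIoc).mono fun s hs => ?_
    beta_reduce
    rw [Real.norm_of_nonneg (qf_nonneg hg (by exact ht) _), Real.norm_of_nonneg (by positivity)]
    exact hM _ ⟨s, uIoc_subset_uIcc hs, rfl⟩ _

lemma erg_nonneg (hg : SmoothMetricFamily g (Iio T)) (ht : t < T) : 0 ≤ erg g t x u :=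
  mul_nonneg (by norm_num) (intervalIntegral.integral_nonneg zero_le_one fun _ _ =>
    qf_nonneg hg (by exact ht) _)

lemma erg_zero : erg g t x (fun _ => 0) = 0 := by simp [erg, qf]

lemma len_lt_of_erg (hg : SmoothMetricFamily g (Iio T)) (ht : t < T) (hu : Adm u) :
    len g t x u 0 1 < erg g t x u + 1 := by
  have h : len g t x u 0 1 ≤ ∫ s in (0 : ℝ)..1, (1 / 2 + 1 / 2 * qf g (pth x u s, t) (u s)) := by
    refine intervalIntegral.integral_mono_on zero_le_one
      (intervalIntegrable_nm hg ht (continuous_pth hu.1) hu.1 _ _)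
      ((intervalIntegrable_const).add
        ((intervalIntegrable_qf hg ht (continuous_pth hu.1) hu _ _).const_mul _)) fun s _ => ?_
    rw [← nm_sq hg (by exact ht)]
    nlinarith [sq_nonneg (nm g (pth x u s, t) (u s) - 1)]
  rw [intervalIntegral.integral_add intervalIntegrable_const
    ((intervalIntegrable_qf hg ht (continuous_pth hu.1) hu _ _).const_mul _),
    intervalIntegral.integral_const_mul] at h
  simp only [intervalIntegral.integral_const, sub_zero, one_smul] at h
  rw [erg]
  linarith

lemma qf_add_dual_nonneg (hg : SmoothMetricFamily g (Iio T)) {p : (Fin n → ℝ) × ℝ} (hp : p.2 < T)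
    (v q : Fin n → ℝ) : 2 * (v ⬝ᵥ q) - q ⬝ᵥ (hm g p *ᵥ q) ≤ qf g p v := by
  have h := qf_nonneg hg hp (v - hm g p *ᵥ q)
  rw [qf_eq_dot, Matrix.mulVec_sub, Matrix.mulVec_mulVec, gm_mul_hm hg hp, Matrix.one_mulVec,
    sub_dotProduct, dotProduct_sub, dotProduct_sub, ← qf_eq_dot] at h
  have h1 : (hm g p *ᵥ q) ⬝ᵥ (gm g p *ᵥ v) = v ⬝ᵥ q := by
    rw [Matrix.dotProduct_mulVec, ← Matrix.mulVec_transpose, gm_transpose hg hp,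
      Matrix.mulVec_mulVec, gm_mul_hm hg hp, Matrix.one_mulVec, dotProduct_comm]
  rw [h1, dotProduct_comm (hm g p *ᵥ q) q] at h
  linarith

lemma tendsto_pth {uk : ℕ → ℝ → Fin n → ℝ} (huk : ∀ k, Integrable (uk k)) (hu : Integrable u)
    (hw : ∀ h : ℝ → Fin n → ℝ, MemLp h 2 (volume.restrict (Ioc (0 : ℝ) 1)) →
      Filter.Tendsto (fun k => ∫ s in Ioc (0 : ℝ) 1, uk k s ⬝ᵥ h s) Filter.atTop
        (𝓝 (∫ s in Ioc (0 : ℝ) 1, u s ⬝ᵥ h s))) {s : ℝ} (hs : s ∈ Icc (0 : ℝ) 1) :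
    Filter.Tendsto (fun k => pth x (uk k) s) Filter.atTop (𝓝 (pth x u s)) := by
  refine Filter.Tendsto.const_add _ (tendsto_pi_nhds.2 fun i => ?_)
  have hkey : ∀ v : ℝ → Fin n → ℝ, Integrable v → (∫ q in (0 : ℝ)..s, v q) i =
      ∫ q in Ioc (0 : ℝ) 1, v q ⬝ᵥ (Ioc 0 s).indicator (fun _ => Pi.single i 1) q := by
    intro v hv
    have e : ∀ q, v q ⬝ᵥ (Ioc 0 s).indicator (fun _ => (Pi.single i 1 : Fin n → ℝ)) q =
        (Ioc 0 s).indicator (fun q => v q i) q := by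
      intro q
      by_cases hq : q ∈ Ioc 0 s
      · simp [indicator_of_mem hq]
      · simp [indicator_of_notMem hq]
    simp only [e]
    rw [setIntegral_indicator measurableSet_Ioc,
      inter_eq_self_of_subset_right (Ioc_subset_Ioc_right hs.2),
      intervalIntegral.integral_of_le hs.1, eval_integral fun j => (hv.eval j).integrableOn]
  rw [hkey u hu]
  simp only [hkey _ (huk _)]
  refine hw _ (MemLp.indicator measurableSet_Ioc (memLp_const _))

lemma erg_le_of_tendsto (hg : SmoothMetricFamily g (Iio T)) {K : Set ((Fin n → ℝ) × ℝ)}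
    (hK : IsCompact K) (hKT : ∀ p ∈ K, p ∈ dom n T) {uk : ℕ → ℝ → Fin n → ℝ} {tk : ℕ → ℝ}
    (huk : ∀ k, Adm (uk k)) (hu : Adm u) (htk : Filter.Tendsto tk Filter.atTop (𝓝 t))
    (hin : ∀ k, ∀ s ∈ Icc (0 : ℝ) 1, (pth x (uk k) s, tk k) ∈ K)
    (hw : ∀ h : ℝ → Fin n → ℝ, MemLp h 2 (volume.restrict (Ioc (0 : ℝ) 1)) →
      Filter.Tendsto (fun k => ∫ s in Ioc (0 : ℝ) 1, uk k s ⬝ᵥ h s) Filter.atTop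
        (𝓝 (∫ s in Ioc (0 : ℝ) 1, u s ⬝ᵥ h s))) {e : ℝ}
    (he : Filter.Tendsto (fun k => erg g (tk k) x (uk k)) Filter.atTop (𝓝 e)) :
    erg g t x u ≤ e := by
  have hp : ∀ s ∈ Icc (0 : ℝ) 1, Filter.Tendsto (fun k => (pth x (uk k) s, tk k)) Filter.atTop
      (𝓝 (pth x u s, t)) := fun s hs =>
    (tendsto_pth (fun k => (huk k).1) hu.1 hw hs).prodMk_nhds htk
  have hinl : ∀ s ∈ Icc (0 : ℝ) 1, (pth x u s, t) ∈ K := fun s hs =>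
    hK.isClosed.mem_of_tendsto (hp s hs) (Filter.Eventually.of_forall fun k => hin k s hs)
  have ht : t < T := mem_dom.1 (hKT _ (hinl 0 ⟨le_rfl, zero_le_one⟩))
  have htkT : ∀ k, tk k < T := fun k => mem_dom.1 (hKT _ (hin k 0 ⟨le_rfl, zero_le_one⟩))
  have hpc := continuous_pth (x := x) hu.1
  set q : ℝ → Fin n → ℝ := fun s => gm g (pth x u s, t) *ᵥ u s with hq
  obtain ⟨C, hC0, hC⟩ := (msmooth_gm hg).exists_bound hK hKT
  obtain ⟨D, hD0, hD⟩ := (msmooth_hm hg).exists_bound hK hKT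
  have hgc : ∀ i j, Continuous fun s => gm g (pth x u s, t) i j := fun i j =>
    (msmooth_gm hg i j).continuousOn.comp_continuous (by fun_prop) fun s => mem_dom.2 ht
  have hqm : AEStronglyMeasurable q (volume.restrict (Ioc (0 : ℝ) 1)) := by
    refine (aemeasurable_pi_iff.2 fun i => ?_).aestronglyMeasurable.restrict
    simp only [hq, Matrix.mulVec, dotProduct]
    refine Finset.aemeasurable_fun_sum _ fun j _ => ?_
    exact (hgc i j).aemeasurable.mul (hu.1.eval j).aestronglyMeasurable.aemeasurable
  have hqL : MemLp q 2 (volume.restrict (Ioc (0 : ℝ) 1)) := by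
    refine MemLp.of_le_mul (c := n * C) (hu.2.restrict _) hqm ?_
    refine (ae_restrict_mem measurableSet_Ioc).mono fun s hs => ?_
    refine (pi_norm_le_iff_of_nonneg (by positivity)).2 fun i => ?_
    simp only [hq, Matrix.mulVec, dotProduct]
    refine (norm_sum_le _ _).trans ?_
    refine (Finset.sum_le_card_nsmul _ _ (C * ‖u s‖) fun j _ => ?_).trans (by simp [mul_assoc])
    rw [norm_mul]
    exact mul_le_mul (hC _ (hinl s (Ioc_subset_Icc_self hs)) i j) (norm_le_pi_norm _ _)
      (norm_nonneg _) hC0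
  have hquad : ∀ p ∈ K, ∀ s, ‖q s ⬝ᵥ (hm g p *ᵥ q s)‖ ≤ n ^ 2 * D * ‖q s‖ ^ 2 := by
    intro p hpK s
    have := abs_sum_le_norm_sq (hD p hpK) (q s)
    rw [Real.norm_eq_abs]
    convert this using 2
    simp only [dotProduct, Matrix.mulVec, Finset.mul_sum]
    exact Finset.sum_congr rfl fun _ _ => Finset.sum_congr rfl fun _ _ => by ring
  have hqsq : Integrable (fun s => (n : ℝ) ^ 2 * D * ‖q s‖ ^ 2)
      (volume.restrict (Ioc (0 : ℝ) 1)) :=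
    ((memLp_two_iff_integrable_sq_norm hqm).1 hqL).const_mul _
  have hhmeas : ∀ {v : ℝ → Fin n → ℝ} {τ : ℝ}, Continuous v → τ < T →
      AEStronglyMeasurable (fun s => q s ⬝ᵥ (hm g (v s, τ) *ᵥ q s))
      (volume.restrict (Ioc (0 : ℝ) 1)) := by
    intro v τ hv hτ
    have hqi : ∀ i, AEStronglyMeasurable (fun s => q s i) (volume.restrict (Ioc (0 : ℝ) 1)) :=
      fun i => (continuous_apply i).comp_aestronglyMeasurable hqm
    simp only [Matrix.mulVec, dotProduct]
    refine Finset.aestronglyMeasurable_fun_sum _ fun i _ => (hqi i).mul ?_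
    refine Finset.aestronglyMeasurable_fun_sum _ fun j _ => AEStronglyMeasurable.mul ?_ (hqi j)
    exact (Continuous.aestronglyMeasurable ((msmooth_hm hg i j).continuousOn.comp_continuous
      (f := fun s => (v s, τ)) (by fun_prop) fun s => mem_dom.2 hτ))
  have hlim2 : Filter.Tendsto (fun k => ∫ s in Ioc (0 : ℝ) 1,
      q s ⬝ᵥ (hm g (pth x (uk k) s, tk k) *ᵥ q s)) Filter.atTop
      (𝓝 (∫ s in Ioc (0 : ℝ) 1, q s ⬝ᵥ (hm g (pth x u s, t) *ᵥ q s))) := by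
    refine tendsto_integral_of_dominated_convergence _
      (fun k => hhmeas (continuous_pth (huk k).1) (htkT k)) hqsq
      (fun k => (ae_restrict_mem measurableSet_Ioc).mono fun s hs =>
        hquad _ (hin k s (Ioc_subset_Icc_self hs)) s)
      ((ae_restrict_mem measurableSet_Ioc).mono fun s hs => ?_)
    simp only [Matrix.mulVec, dotProduct]
    refine tendsto_finsetSum _ fun i _ => Filter.Tendsto.const_mul _ ?_
    refine tendsto_finsetSum _ fun j _ => Filter.Tendsto.mul_const _ ?_
    exact ((msmooth_hm hg i j).contDiffAt (by exact ht)).continuousAt.tendsto.comp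
      (hp s (Ioc_subset_Icc_self hs))
  have hval1 : ∫ s in Ioc (0 : ℝ) 1, u s ⬝ᵥ q s = 2 * erg g t x u := by
    rw [erg, intervalIntegral.integral_of_le zero_le_one]
    simp only [hq, ← qf_eq_dot]
    ring
  have hval2 : ∫ s in Ioc (0 : ℝ) 1, q s ⬝ᵥ (hm g (pth x u s, t) *ᵥ q s) = 2 * erg g t x u := by
    rw [← hval1]
    refine integral_congr_ae (ae_of_all _ fun s => ?_)
    have htp : ((pth x u s, t) : (Fin n → ℝ) × ℝ).2 < T := ht
    simp only [hq]
    rw [Matrix.mulVec_mulVec, hm_mul_gm hg htp, Matrix.one_mulVec, dotProduct_comm]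
  have hdot : ∀ k, Integrable (fun s => uk k s ⬝ᵥ q s) (volume.restrict (Ioc (0 : ℝ) 1)) :=
    fun k => integrable_finsetSum _ fun i _ =>
      (((huk k).2.restrict _).eval i).integrable_mul (hqL.eval i)
  have hle : ∀ k, 2 * (∫ s in Ioc (0 : ℝ) 1, uk k s ⬝ᵥ q s) -
      (∫ s in Ioc (0 : ℝ) 1, q s ⬝ᵥ (hm g (pth x (uk k) s, tk k) *ᵥ q s)) ≤
      2 * erg g (tk k) x (uk k) := by
    intro k
    have hI2 : Integrable (fun s => q s ⬝ᵥ (hm g (pth x (uk k) s, tk k) *ᵥ q s))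
        (volume.restrict (Ioc (0 : ℝ) 1)) :=
      hqsq.mono' (hhmeas (continuous_pth (huk k).1) (htkT k))
        ((ae_restrict_mem measurableSet_Ioc).mono fun s hs =>
          hquad _ (hin k s (Ioc_subset_Icc_self hs)) s)
    rw [← integral_const_mul, ← integral_sub ((hdot k).const_mul 2) hI2, erg,
      intervalIntegral.integral_of_le zero_le_one, ← mul_assoc, mul_one_div_cancel two_ne_zero,
      one_mul]
    refine integral_mono (((hdot k).const_mul 2).sub hI2) ?_ fun s =>
      qf_add_dual_nonneg hg (by exact htkT k) _ _
    have := intervalIntegrable_qf hg (htkT k) (continuous_pth (x := x) (huk k).1) (huk k) 0 1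
    rwa [intervalIntegrable_iff_integrableOn_Ioc_of_le zero_le_one] at this
  have hL := le_of_tendsto_of_tendsto' (((hw q hqL).const_mul 2).sub hlim2) (he.const_mul 2) hle
  rw [hval1, hval2] at hL
  linarith

end energy

section minimum

variable {g : (Fin n → ℝ) → ℝ → Matrix (Fin n) (Fin n) ℝ} {T t : ℝ} {x y z : Fin n → ℝ}
  {u : ℝ → Fin n → ℝ} {r r' : ℝ}

/-- The functional to be minimised over times and paths. -/
def Fn (g : (Fin n → ℝ) → ℝ → Matrix (Fin n) (Fin n) ℝ) (a β B : ℝ) (x : Fin n → ℝ) (t : ℝ)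
    (u : ℝ → Fin n → ℝ) : ℝ :=
  scal g (pth x u 1, t) + n / (t - a) + β / (B - erg g t x u) ^ 2

lemma exists_min (hg : SmoothMetricFamily g (Iio T))
    (hc : ∀ t ∈ Iio T, riemComplete (fun x => g x t)) (hn : 0 < n) {a t₀ β B : ℝ} (ha : a < t₀)
    (ht₀ : t₀ < T) (hβ : 0 < β) (hB : 0 < B) (x : Fin n → ℝ) :
    ∃ t₁ ∈ Ioc a t₀, ∃ u, Adm u ∧ erg g t₁ x u < B ∧
      ∀ t ∈ Ioc a t₀, ∀ v, Adm v → erg g t x v < B → Fn g a β B x t₁ u ≤ Fn g a β B x t v := by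
  obtain ⟨R, hR0, hR⟩ := exists_paths_bounded hg hc ht₀ x (B + 1) (a := a)
  have hK : IsCompact (Metric.closedBall x R ×ˢ Icc a t₀) :=
    (isCompact_closedBall _ _).prod isCompact_Icc
  have hKT : ∀ p ∈ Metric.closedBall x R ×ˢ Icc a t₀, p ∈ dom n T :=
    fun p hp => mem_dom.2 (hp.2.2.trans_lt ht₀)
  obtain ⟨M, hM0, hM⟩ := (smooth_scal hg).exists_bound hK hKT
  obtain ⟨m, hm0, hm⟩ := exists_le_qf hg hK hKT
  have hin : ∀ t ∈ Ioc a t₀, ∀ v, Adm v → erg g t x v < B → ∀ s ∈ Icc (0 : ℝ) 1,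
      (pth x v s, t) ∈ Metric.closedBall x R ×ˢ Icc a t₀ := by
    intro t ht v hv hvB s hs
    have htT : t < T := ht.2.trans_lt ht₀
    exact ⟨mem_closedBall_iff_norm.2 (hR t (Ioc_subset_Icc_self ht) v hv.1
      ((len_lt_of_erg hg htT hv).trans (by linarith)) s hs), Ioc_subset_Icc_self ht⟩
  have hn' : (0 : ℝ) < n := Nat.cast_pos.2 hn
  set S : Set ℝ := {y | ∃ t ∈ Ioc a t₀, ∃ v, Adm v ∧ erg g t x v < B ∧ Fn g a β B x t v = y}
    with hS
  have hSlow : ∀ t ∈ Ioc a t₀, ∀ v, Adm v → erg g t x v < B →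
      -M + n / (t - a) + β / (B - erg g t x v) ^ 2 ≤ Fn g a β B x t v := by
    intro t ht v hv hvB
    have := neg_le_of_abs_le (hM _ (hin t ht v hv hvB 1 ⟨zero_le_one, le_rfl⟩))
    rw [Fn]; linarith
  have hSne : S.Nonempty :=
    ⟨_, t₀, ⟨ha, le_rfl⟩, _, adm_zero, by rw [erg_zero]; exact hB, rfl⟩
  have hSb : BddBelow S := by
    refine ⟨-M, ?_⟩
    rintro _ ⟨t, ht, v, hv, hvB, rfl⟩
    have h1 : 0 ≤ n / (t - a) := div_nonneg hn'.le (sub_nonneg.2 ht.1.le)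
    have h2 : 0 ≤ β / (B - erg g t x v) ^ 2 := by positivity
    linarith [hSlow t ht v hv hvB]
  obtain ⟨F, hFa, hFl, hFS⟩ := exists_seq_tendsto_sInf hSne hSb
  choose tk htk uk huk hukB hFk using hFS
  have hF0 : ∀ k, F k ≤ F 0 := fun k => hFa (Nat.zero_le k)
  set M' := F 0 + M with hM'
  have hM'0 : 0 < M' := by
    have h1 : 0 < n / (tk 0 - a) := div_pos hn' (sub_pos.2 (htk 0).1)
    have h2 : 0 ≤ β / (B - erg g (tk 0) x (uk 0)) ^ 2 := by positivity
    linarith [hSlow _ (htk 0) _ (huk 0) (hukB 0), hFk 0]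
  have htk' : ∀ k, tk k ∈ Icc (a + n / M') t₀ := by
    intro k
    refine ⟨?_, (htk k).2⟩
    have h1 : n / (tk k - a) ≤ M' := by
      have h2 : 0 ≤ β / (B - erg g (tk k) x (uk k)) ^ 2 := by positivity
      linarith [hSlow _ (htk k) _ (huk k) (hukB k), hFk k, hF0 k]
    rw [div_le_iff₀ (sub_pos.2 (htk k).1)] at h1
    have h3 : n / M' ≤ tk k - a := (div_le_iff₀' hM'0).2 h1
    linarith
  have hek : ∀ k, erg g (tk k) x (uk k) ∈ Icc 0 (B - √(β / M')) := by
    intro k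
    refine ⟨erg_nonneg hg ((htk k).2.trans_lt ht₀), ?_⟩
    have h0 : 0 < B - erg g (tk k) x (uk k) := sub_pos.2 (hukB k)
    have h1 : β / (B - erg g (tk k) x (uk k)) ^ 2 ≤ M' := by
      have h2 : 0 ≤ n / (tk k - a) := div_nonneg hn'.le (sub_nonneg.2 (htk k).1.le)
      linarith [hSlow _ (htk k) _ (huk k) (hukB k), hFk k, hF0 k]
    rw [div_le_iff₀ (by positivity)] at h1
    have h3 : β / M' ≤ (B - erg g (tk k) x (uk k)) ^ 2 := (div_le_iff₀' hM'0).2 h1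
    have := (Real.sqrt_le_sqrt h3).trans (Real.sqrt_sq h0.le).le
    linarith
  have hc0 : 0 < √(β / M') := Real.sqrt_pos.2 (by positivity)
  have hL2 : ∀ k, ∫ s in Ioc (0 : ℝ) 1, ‖uk k s‖ ^ 2 ≤ 2 * B / m := by
    intro k
    have htT : tk k < T := (htk k).2.trans_lt ht₀
    have hI := intervalIntegrable_qf hg htT (continuous_pth (x := x) (huk k).1) (huk k) 0 1
    rw [intervalIntegrable_iff_integrableOn_Ioc_of_le zero_le_one] at hI
    have h1 : ∫ s in Ioc (0 : ℝ) 1, m * ‖uk k s‖ ^ 2 ≤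
        ∫ s in Ioc (0 : ℝ) 1, qf g (pth x (uk k) s, tk k) (uk k s) := by
      refine setIntegral_mono_on ((huk k).sq_integrable.const_mul m).integrableOn hI
        measurableSet_Ioc fun s hs => ?_
      exact hm _ (hin _ (htk k) _ (huk k) (hukB k) s (Ioc_subset_Icc_self hs)) _
    rw [integral_const_mul] at h1
    have h2 := hukB k
    rw [erg, intervalIntegral.integral_of_le zero_le_one] at h2
    rw [le_div_iff₀' hm0]
    linarith
  obtain ⟨φ, hφ, v, hv, hw⟩ := exists_weak_subseq_memLp uk (fun k => (huk k).2.restrict _) hL2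
  obtain ⟨⟨t₁, e⟩, ⟨ht₁, he⟩, ψ, hψ, hlim⟩ := (isCompact_Icc.prod isCompact_Icc).tendsto_subseq
    (x := fun k => (tk (φ k), erg g (tk (φ k)) x (uk (φ k)))) fun k => ⟨htk' _, hek _⟩
  have hlt : Filter.Tendsto (fun k => tk (φ (ψ k))) Filter.atTop (𝓝 t₁) :=
    (continuous_fst.tendsto _).comp hlim
  have hle : Filter.Tendsto (fun k => erg g (tk (φ (ψ k))) x (uk (φ (ψ k)))) Filter.atTop
    (𝓝 e) := (continuous_snd.tendsto _).comp hlim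
  have ht₁' : t₁ ∈ Ioc a t₀ := ⟨by have := div_pos hn' hM'0; linarith [ht₁.1], ht₁.2⟩
  have ht₁T : t₁ < T := ht₁'.2.trans_lt ht₀
  set w : ℝ → Fin n → ℝ := (Ioc (0 : ℝ) 1).indicator v with hwdef
  have hwa : Adm w := by
    constructor
    · rw [hwdef, integrable_indicator_iff measurableSet_Ioc]
      exact hv.integrable one_le_two
    · exact (memLp_indicator_iff_restrict measurableSet_Ioc).2 hv
  have hww : ∀ h : ℝ → Fin n → ℝ, MemLp h 2 (volume.restrict (Ioc (0 : ℝ) 1)) →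
      Filter.Tendsto (fun k => ∫ s in Ioc (0 : ℝ) 1, uk (φ (ψ k)) s ⬝ᵥ h s) Filter.atTop
        (𝓝 (∫ s in Ioc (0 : ℝ) 1, w s ⬝ᵥ h s)) := by
    intro h hh
    rw [setIntegral_congr_fun (g := fun s => v s ⬝ᵥ h s) measurableSet_Ioc fun s hs => by
      simp only [hwdef, indicator_of_mem hs]]
    exact (hw h hh).comp hψ.tendsto_atTop
  have herg : erg g t₁ x w ≤ e := erg_le_of_tendsto hg hK hKT (fun k => huk _) hwa hlt
    (fun k s hs => hin _ (htk _) _ (huk _) (hukB _) s hs) hww hle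
  have heB : e < B := by linarith [he.2]
  refine ⟨t₁, ht₁', w, hwa, herg.trans_lt heB, fun t ht v hv hvB => ?_⟩
  have hm_le : sInf S ≤ Fn g a β B x t v := csInf_le hSb ⟨t, ht, v, hv, hvB, rfl⟩
  refine le_trans ?_ hm_le
  have hlim1 : Filter.Tendsto (fun k => Fn g a β B x (tk (φ (ψ k))) (uk (φ (ψ k)))) Filter.atTop
      (𝓝 (scal g (pth x w 1, t₁) + n / (t₁ - a) + β / (B - e) ^ 2)) := by
    refine Filter.Tendsto.add (Filter.Tendsto.add ?_ ?_) ?_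
    · exact ((smooth_scal hg).contDiffAt (p := (pth x w 1, t₁)) ht₁T).continuousAt.tendsto.comp
        ((tendsto_pth (fun k => (huk _).1) hwa.1 hww ⟨zero_le_one, le_rfl⟩).prodMk_nhds hlt)
    · exact tendsto_const_nhds.div (hlt.sub_const a) (sub_pos.2 ht₁'.1).ne'
    · exact tendsto_const_nhds.div ((hle.const_sub B).pow 2) (pow_ne_zero 2 (sub_pos.2 heB).ne')
  have hlim2 : Filter.Tendsto (fun k => Fn g a β B x (tk (φ (ψ k))) (uk (φ (ψ k)))) Filter.atTop
      (𝓝 (sInf S)) := by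
    simp only [hFk]
    exact hFl.comp (hφ.comp hψ).tendsto_atTop
  rw [← tendsto_nhds_unique hlim1 hlim2, Fn]
  have h1 : 0 < B - e := sub_pos.2 heB
  gcongr

end minimum

section lineDerivatives

variable {g : (Fin n → ℝ) → ℝ → Matrix (Fin n) (Fin n) ℝ} {T t : ℝ}
  {F : (Fin n → ℝ) × ℝ → ℝ} {M : (Fin n → ℝ) × ℝ → Matrix (Fin n) (Fin n) ℝ}

/-- The bilinear form of a matrix. -/
def bl (M : Matrix (Fin n) (Fin n) ℝ) (v w : Fin n → ℝ) : ℝ := v ⬝ᵥ (M *ᵥ w)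

lemma bl_eq_sum (M : Matrix (Fin n) (Fin n) ℝ) (v w : Fin n → ℝ) :
    bl M v w = ∑ i, ∑ j, M i j * v i * w j := by
  simp only [bl, Matrix.mulVec, dotProduct, Finset.mul_sum]
  exact Finset.sum_congr rfl fun i _ => Finset.sum_congr rfl fun j _ => by ring

lemma qf_eq_bl (p : (Fin n → ℝ) × ℝ) (v : Fin n → ℝ) : qf g p v = bl (gm g p) v v :=
  qf_eq_dot _

lemma bl_comm {M : Matrix (Fin n) (Fin n) ℝ} (hM : Mᵀ = M) (v w : Fin n → ℝ) :
    bl M v w = bl M w v := by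
  rw [bl, Matrix.dotProduct_mulVec, ← Matrix.mulVec_transpose, hM, dotProduct_comm, bl]

lemma hasDerivAt_bl {M : ℝ → Matrix (Fin n) (Fin n) ℝ} {M' : Matrix (Fin n) (Fin n) ℝ}
    {v w : ℝ → Fin n → ℝ} {v' w' : Fin n → ℝ} {s : ℝ}
    (hM : ∀ i j, HasDerivAt (fun r => M r i j) (M' i j) s) (hv : HasDerivAt v v' s)
    (hw : HasDerivAt w w' s) :
    HasDerivAt (fun r => bl (M r) (v r) (w r))
      (bl M' (v s) (w s) + bl (M s) v' (w s) + bl (M s) (v s) w') s := by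
  rw [hasDerivAt_pi] at hv hw
  simp only [bl_eq_sum]
  refine (HasDerivAt.fun_sum fun i _ => HasDerivAt.fun_sum fun j _ =>
    ((hM i j).mul (hv i)).mul (hw j)).congr_deriv ?_
  simp only [← Finset.sum_add_distrib]
  exact Finset.sum_congr rfl fun i _ => Finset.sum_congr rfl fun j _ => by
    simp only [Pi.mul_apply]; ring

lemma bl_sum_left {ι : Type*} (s : Finset ι) (M : ι → Matrix (Fin n) (Fin n) ℝ)
    (c : ι → ℝ) (v w : Fin n → ℝ) :
    bl (∑ a ∈ s, c a • M a) v w = ∑ a ∈ s, c a * bl (M a) v w := by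
  simp only [bl, Matrix.sum_mulVec, dotProduct_sum, Matrix.smul_mulVec, dotProduct_smul,
    smul_eq_mul]

lemma continuous_bl {X : Type*} [TopologicalSpace X] {M : X → Matrix (Fin n) (Fin n) ℝ}
    {v w : X → Fin n → ℝ} (hM : ∀ i j, Continuous fun z => M z i j) (hv : Continuous v)
    (hw : Continuous w) : Continuous fun z => bl (M z) (v z) (w z) := by
  simp only [bl_eq_sum]
  exact continuous_finsetSum _ fun i _ => continuous_finsetSum _ fun j _ =>
    ((hM i j).mul ((continuous_apply i).comp hv)).mul ((continuous_apply j).comp hw)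

lemma dd_eq_sum (ξ : Fin n → ℝ) (p : (Fin n → ℝ) × ℝ) :
    dd (ξ, 0) F p = ∑ a, ξ a * dd (ex a) F p := by
  have h : ((ξ, 0) : (Fin n → ℝ) × ℝ) = ∑ a, ξ a • ex a := by
    refine Prod.ext ?_ ?_
    · simp only [ex, Prod.fst_sum, Prod.smul_mk]
      ext i
      simp [Finset.sum_apply, Pi.single_apply]
    · simp [ex, Prod.snd_sum]
  rw [dd, h, map_sum]
  simp only [map_smul, smul_eq_mul, dd]

lemma dm_eq_sum (ξ : Fin n → ℝ) (p : (Fin n → ℝ) × ℝ) :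
    dm (ξ, 0) M p = ∑ a, ξ a • dm (ex a) M p := by
  ext i j
  simp only [dm_apply, dd_eq_sum, Matrix.sum_apply, Matrix.smul_apply, smul_eq_mul]

lemma dd_dd_eq_sum (hF : SmoothOn T F) (ξ : Fin n → ℝ) {p : (Fin n → ℝ) × ℝ} (hp : p.2 < T) :
    dd (ξ, 0) (dd (ξ, 0) F) p = ∑ a, ∑ b, ξ a * ξ b * dd (ex a) (dd (ex b) F) p := by
  rw [dd_eq_sum]
  refine Finset.sum_congr rfl fun a _ => ?_
  rw [show dd (ξ, 0) F = fun q => ∑ b, ξ b * dd (ex b) F q from funext fun q => dd_eq_sum ξ q,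
    dd_sum _ hp fun b _ => (SmoothOn.const _).mul (hF.dd _), Finset.mul_sum]
  refine Finset.sum_congr rfl fun b _ => ?_
  rw [dd_const_mul _ hp _ (hF.dd _)]; ring

lemma hasDerivAt_line (hF : SmoothOn T F) (ht : t < T) (y ξ : Fin n → ℝ) (ε : ℝ) :
    HasDerivAt (fun ε : ℝ => F (y + ε • ξ, t)) (dd (ξ, 0) F (y + ε • ξ, t)) ε := by
  have h1 : HasDerivAt (fun ε : ℝ => ((y + ε • ξ, t) : (Fin n → ℝ) × ℝ)) (ξ, 0) ε := by
    refine HasDerivAt.prodMk ?_ (hasDerivAt_const _ _)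
    simpa using ((hasDerivAt_id ε).smul_const ξ).const_add y
  exact ((hF.differentiableAt (p := (y + ε • ξ, t)) ht).hasFDerivAt).comp_hasDerivAt ε h1

lemma hasDerivAt_along (hF : SmoothOn T F) (ht : t < T) {γ : ℝ → Fin n → ℝ} {v : Fin n → ℝ}
    {s : ℝ} (hγ : HasDerivAt γ v s) :
    HasDerivAt (fun s => F (γ s, t)) (dd (v, 0) F (γ s, t)) s :=
  ((hF.differentiableAt (p := (γ s, t)) ht).hasFDerivAt).comp_hasDerivAt s
    (hγ.prodMk (hasDerivAt_const _ _))

lemma continuous_slice (hF : SmoothOn T F) (ht : t < T) : Continuous fun y => F (y, t) :=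
  hF.continuousOn.comp_continuous (by fun_prop) fun y => mem_dom.2 ht

lemma continuous_dd (hF : SmoothOn T F) (ht : t < T) :
    Continuous fun z : (Fin n → ℝ) × (Fin n → ℝ) => dd (z.2, 0) F (z.1, t) := by
  simp only [dd_eq_sum]
  exact continuous_finsetSum _ fun a _ => ((continuous_apply a).comp continuous_snd).mul
    ((continuous_slice (hF.dd (ex a)) ht).comp continuous_fst)

lemma continuous_dd_dd (hF : SmoothOn T F) (ht : t < T) :
    Continuous fun z : (Fin n → ℝ) × (Fin n → ℝ) => dd (z.2, 0) (dd (z.2, 0) F) (z.1, t) := by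
  simp only [fun z : (Fin n → ℝ) × (Fin n → ℝ) => dd_dd_eq_sum hF z.2 (p := (z.1, t)) ht]
  exact continuous_finsetSum _ fun a _ => continuous_finsetSum _ fun b _ =>
    (((continuous_apply a).comp continuous_snd).mul ((continuous_apply b).comp continuous_snd)).mul
    ((continuous_slice ((hF.dd (ex b)).dd (ex a)) ht).comp continuous_fst)

/-- The first variation of the squared speed. -/
def dqf (g : (Fin n → ℝ) → ℝ → Matrix (Fin n) (Fin n) ℝ) (p : (Fin n → ℝ) × ℝ)
    (v ξ η : Fin n → ℝ) : ℝ := bl (dm (ξ, 0) (gm g) p) v v + 2 * bl (gm g p) v η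

/-- The second variation of the squared speed. -/
def ddqf (g : (Fin n → ℝ) → ℝ → Matrix (Fin n) (Fin n) ℝ) (p : (Fin n → ℝ) × ℝ)
    (v ξ η : Fin n → ℝ) : ℝ :=
  bl (dm (ξ, 0) (dm (ξ, 0) (gm g)) p) v v + 4 * bl (dm (ξ, 0) (gm g) p) v η +
    2 * bl (gm g p) η η

lemma hasDerivAt_add_smul (v η : Fin n → ℝ) (ε : ℝ) :
    HasDerivAt (fun ε : ℝ => v + ε • η) η ε := by
  simpa using ((hasDerivAt_id ε).smul_const η).const_add v

lemma hasDerivAt_qf (hg : SmoothMetricFamily g (Iio T)) (ht : t < T) (y v ξ η : Fin n → ℝ)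
    (ε : ℝ) : HasDerivAt (fun ε : ℝ => qf g (y + ε • ξ, t) (v + ε • η))
      (dqf g (y + ε • ξ, t) (v + ε • η) ξ η) ε := by
  simp only [qf_eq_bl]
  refine (hasDerivAt_bl (fun i j => hasDerivAt_line (msmooth_gm hg i j) ht y ξ ε)
    (hasDerivAt_add_smul v η ε) (hasDerivAt_add_smul v η ε)
    (M' := dm (ξ, 0) (gm g) (y + ε • ξ, t))).congr_deriv ?_
  rw [bl_comm (gm_transpose hg (by exact ht)) η, dqf]; ring

lemma dm_gm_transpose (hg : SmoothMetricFamily g (Iio T)) {p : (Fin n → ℝ) × ℝ} (hp : p.2 < T)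
    (w : (Fin n → ℝ) × ℝ) : (dm w (gm g) p)ᵀ = dm w (gm g) p := by
  ext i j
  simp only [Matrix.transpose_apply, dm_apply]
  exact dd_congr w hp fun q hq => gm_symm hg (mem_dom.1 hq) _ _

lemma hasDerivAt_dqf (hg : SmoothMetricFamily g (Iio T)) (ht : t < T) (y v ξ η : Fin n → ℝ)
    (ε : ℝ) : HasDerivAt (fun ε : ℝ => dqf g (y + ε • ξ, t) (v + ε • η) ξ η)
      (ddqf g (y + ε • ξ, t) (v + ε • η) ξ η) ε := by
  simp only [dqf]
  have h1 := hasDerivAt_bl (fun i j => hasDerivAt_line ((msmooth_gm hg).dm (ξ, 0) i j) ht y ξ ε)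
    (hasDerivAt_add_smul v η ε) (hasDerivAt_add_smul v η ε)
    (M' := dm (ξ, 0) (dm (ξ, 0) (gm g)) (y + ε • ξ, t))
  have h2 := hasDerivAt_bl (fun i j => hasDerivAt_line (msmooth_gm hg i j) ht y ξ ε)
    (hasDerivAt_add_smul v η ε) (hasDerivAt_const ε η)
    (M' := dm (ξ, 0) (gm g) (y + ε • ξ, t))
  refine (h1.add (h2.const_mul 2)).congr_deriv ?_
  rw [bl_comm (dm_gm_transpose hg (by exact ht) _) η, ddqf]
  simp only [bl, Matrix.mulVec_zero, dotProduct_zero]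
  ring

lemma continuous_dqf (hg : SmoothMetricFamily g (Iio T)) (ht : t < T)
    {X : Type*} [TopologicalSpace X] {y v ξ η : X → Fin n → ℝ} (hy : Continuous y)
    (hv : Continuous v) (hξ : Continuous ξ) (hη : Continuous η) :
    Continuous fun z => dqf g (y z, t) (v z) (ξ z) (η z) :=
  (continuous_bl (fun i j => (continuous_dd (msmooth_gm hg i j) ht).comp (hy.prodMk hξ)) hv
    hv).add (continuous_const.mul (continuous_bl
    (fun i j => (continuous_slice (msmooth_gm hg i j) ht).comp hy) hv hη))

lemma continuous_ddqf (hg : SmoothMetricFamily g (Iio T)) (ht : t < T)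
    {X : Type*} [TopologicalSpace X] {y v ξ η : X → Fin n → ℝ} (hy : Continuous y)
    (hv : Continuous v) (hξ : Continuous ξ) (hη : Continuous η) :
    Continuous fun z => ddqf g (y z, t) (v z) (ξ z) (η z) :=
  ((continuous_bl (fun i j => (continuous_dd_dd (msmooth_gm hg i j) ht).comp (hy.prodMk hξ)) hv
    hv).add (continuous_const.mul (continuous_bl
    (fun i j => (continuous_dd (msmooth_gm hg i j) ht).comp (hy.prodMk hξ)) hv hη))).add
    (continuous_const.mul (continuous_bl
    (fun i j => (continuous_slice (msmooth_gm hg i j) ht).comp hy) hη hη))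

/-- Differentiation under the integral sign for continuous data. -/
lemma hasDerivAt_integral_of_continuousOn {φ φ' : ℝ → ℝ → ℝ} {U : Set ℝ} (hU : IsOpen U) {ε : ℝ}
    (hε : ε ∈ U) (hφ : ∀ r ∈ U, Continuous (φ r))
    (hφ' : ContinuousOn (fun z : ℝ × ℝ => φ' z.1 z.2) (U ×ˢ univ))
    (hd : ∀ r ∈ U, ∀ s, HasDerivAt (fun r => φ r s) (φ' r s) r) :
    HasDerivAt (fun r => ∫ s in (0 : ℝ)..1, φ r s) (∫ s in (0 : ℝ)..1, φ' ε s) ε := by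
  obtain ⟨δ, hδ, hδU⟩ := Metric.nhds_basis_closedBall.mem_iff.1 (hU.mem_nhds hε)
  have hK : IsCompact (Metric.closedBall ε δ ×ˢ Icc (0 : ℝ) 1) :=
    (isCompact_closedBall _ _).prod isCompact_Icc
  obtain ⟨C, hC⟩ := hK.exists_bound_of_continuousOn
    (hφ'.mono (prod_mono hδU (subset_univ _)))
  have hcont : ∀ r ∈ U, Continuous (φ' r) := fun r hr =>
    hφ'.comp_continuous (f := fun s => (r, s)) (by fun_prop) fun s => ⟨hr, trivial⟩
  refine (intervalIntegral.hasDerivAt_integral_of_dominated_loc_of_deriv_le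
    (Metric.closedBall_mem_nhds ε hδ) (bound := fun _ => C) ?_ ?_ ?_ ?_ ?_ ?_).2
  · filter_upwards [hU.mem_nhds hε] with r hr using (hφ r hr).aestronglyMeasurable
  · exact (hφ ε hε).intervalIntegrable _ _
  · exact (hcont ε hε).aestronglyMeasurable
  · refine Filter.Eventually.of_forall fun s hs r hr => hC (r, s) ⟨hr, ?_⟩
    rw [uIoc_of_le zero_le_one] at hs
    exact Ioc_subset_Icc_self hs
  · exact intervalIntegrable_const
  · exact Filter.Eventually.of_forall fun s _ r hr => hd r (hδU hr) s

end lineDerivatives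

section firstVariation

variable {g : (Fin n → ℝ) → ℝ → Matrix (Fin n) (Fin n) ℝ} {T t : ℝ} {x : Fin n → ℝ}
  {u η : ℝ → Fin n → ℝ}

lemma dqf_homogeneous (p : (Fin n → ℝ) × ℝ) (v ξ η : Fin n → ℝ) (c : ℝ) :
    dqf g p (c • v) ξ (c • η) = c ^ 2 * dqf g p v ξ η := by
  simp only [dqf, bl, Matrix.mulVec_smul, smul_dotProduct, dotProduct_smul, smul_eq_mul]
  ring

lemma exists_dqf_bound (hg : SmoothMetricFamily g (Iio T)) (ht : t < T)
    {K K' : Set (Fin n → ℝ)} (hK : IsCompact K) (hK' : IsCompact K') :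
    ∃ C, 0 ≤ C ∧ ∀ y ∈ K, ∀ ξ ∈ K', ∀ v η : Fin n → ℝ, ‖η‖ ≤ 1 →
      |dqf g (y, t) v ξ η| ≤ C * (‖v‖ + 1) ^ 2 := by
  have hc : Continuous fun z : ((Fin n → ℝ) × (Fin n → ℝ)) × ((Fin n → ℝ) × (Fin n → ℝ)) =>
      dqf g (z.1.1, t) z.2.1 z.1.2 z.2.2 :=
    continuous_dqf hg ht (by fun_prop) (by fun_prop) (by fun_prop) (by fun_prop)
  obtain ⟨C, hC⟩ := ((hK.prod hK').prod ((isCompact_closedBall (0 : Fin n → ℝ) 1).prod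
    (isCompact_closedBall (0 : Fin n → ℝ) 1))).exists_bound_of_continuousOn hc.continuousOn
  refine ⟨max C 0, le_max_right _ _, fun y hy ξ hξ v η hη => ?_⟩
  have h0 : 0 < ‖v‖ + 1 := by positivity
  have h1 : dqf g (y, t) v ξ η =
      (‖v‖ + 1) ^ 2 * dqf g (y, t) ((‖v‖ + 1)⁻¹ • v) ξ ((‖v‖ + 1)⁻¹ • η) := by
    rw [← dqf_homogeneous, smul_inv_smul₀ h0.ne', smul_inv_smul₀ h0.ne']
  have h2 := hC ((y, ξ), ((‖v‖ + 1)⁻¹ • v, (‖v‖ + 1)⁻¹ • η)) ⟨⟨hy, hξ⟩, by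
    rw [mem_closedBall_zero_iff, norm_smul, norm_inv, Real.norm_of_nonneg h0.le,
      inv_mul_le_iff₀ h0]; linarith, by
    rw [mem_closedBall_zero_iff, norm_smul, norm_inv, Real.norm_of_nonneg h0.le,
      inv_mul_le_iff₀ h0]; linarith [norm_nonneg v]⟩
  rw [h1, abs_mul, abs_of_nonneg (by positivity), mul_comm]
  exact mul_le_mul_of_nonneg_right (h2.trans (le_max_left _ _)) (by positivity)

lemma pth_add_smul (hu : Integrable u) (hη : Integrable η) (ε s : ℝ) :
    pth x (fun r => u r + ε • η r) s = pth x u s + ε • pth 0 η s := by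
  simp only [pth]
  have h : ∫ r in (0 : ℝ)..s, u r + ε • η r =
      (∫ r in (0 : ℝ)..s, u r) + ∫ r in (0 : ℝ)..s, ε • η r :=
    intervalIntegral.integral_add hu.intervalIntegrable (hη.smul ε).intervalIntegrable
  rw [h, intervalIntegral.integral_smul]
  simp [add_assoc]

lemma Adm.add_smul (hu : Adm u) (hη : Adm η) (ε : ℝ) : Adm fun r => u r + ε • η r :=
  ⟨hu.1.add (hη.1.smul ε), hu.2.add (hη.2.const_smul ε)⟩

lemma hasDerivAt_erg (hg : SmoothMetricFamily g (Iio T)) (ht : t < T) (hu : Adm u) (hη : Adm η)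
    (hη1 : ∀ s, ‖η s‖ ≤ 1) :
    HasDerivAt (fun ε : ℝ => erg g t x fun r => u r + ε • η r)
      (1 / 2 * ∫ s in (0 : ℝ)..1, dqf g (pth x u s, t) (u s) (pth 0 η s) (η s)) 0 := by
  have hγ := continuous_pth (x := x) hu.1
  have hξ := continuous_pth (x := 0) hη.1
  have hK : IsCompact ((fun z : ℝ × ℝ => pth x u z.2 + z.1 • pth 0 η z.2) ''
      (Metric.closedBall 0 1 ×ˢ Icc 0 1)) :=
    ((isCompact_closedBall _ _).prod isCompact_Icc).image (by fun_prop)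
  obtain ⟨C, hC0, hC⟩ := exists_dqf_bound hg ht hK
    ((isCompact_Icc (a := (0 : ℝ)) (b := 1)).image hξ)
  simp only [erg, pth_add_smul hu.1 hη.1]
  refine HasDerivAt.const_mul _ ?_
  have hI : ∀ ε : ℝ, IntervalIntegrable
      (fun s => qf g (pth x u s + ε • pth 0 η s, t) (u s + ε • η s)) volume 0 1 := fun ε =>
    intervalIntegrable_qf hg ht (hγ.add (hξ.const_smul ε)) (hu.add_smul hη ε) 0 1
  have key := (intervalIntegral.hasDerivAt_integral_of_dominated_loc_of_deriv_le
    (F := fun ε s => qf g (pth x u s + ε • pth 0 η s, t) (u s + ε • η s))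
    (F' := fun ε s => dqf g (pth x u s + ε • pth 0 η s, t) (u s + ε • η s) (pth 0 η s) (η s))
    (μ := volume) (a := 0) (b := 1) (x₀ := (0 : ℝ))
    (Metric.closedBall_mem_nhds (0 : ℝ) one_pos)
    (bound := fun s => 2 * C * (‖u s‖ ^ 2 + 4)) ?_ (hI 0) ?_ ?_ ?_ ?_).2
  · simpa using key
  · exact Filter.Eventually.of_forall fun ε => (hI ε).def'.1
  · have hc : Continuous fun z : ((Fin n → ℝ) × (Fin n → ℝ)) × ((Fin n → ℝ) × (Fin n → ℝ)) =>
        dqf g (z.1.1, t) z.2.1 z.1.2 z.2.2 :=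
      continuous_dqf hg ht (by fun_prop) (by fun_prop) (by fun_prop) (by fun_prop)
    have := hc.comp_aestronglyMeasurable (μ := volume.restrict (uIoc (0 : ℝ) 1))
      ((hγ.aestronglyMeasurable.prodMk hξ.aestronglyMeasurable).prodMk
      ((hu.1.1.prodMk hη.1.1).restrict))
    simpa [Function.comp_def] using this
  · refine Filter.Eventually.of_forall fun s hs ε hε => ?_
    rw [uIoc_of_le zero_le_one] at hs
    have hs' := Ioc_subset_Icc_self hs
    refine (hC _ ⟨(ε, s), ⟨hε, hs'⟩, rfl⟩ _ ⟨s, hs', rfl⟩ _ _ (hη1 s)).trans ?_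
    have h1 : ‖u s + ε • η s‖ ≤ ‖u s‖ + 1 := by
      refine (norm_add_le _ _).trans (add_le_add le_rfl ?_)
      rw [norm_smul]
      exact mul_le_one₀ (mem_closedBall_zero_iff.1 hε) (norm_nonneg _) (hη1 s)
    have h2 : (‖u s + ε • η s‖ + 1) ^ 2 ≤ (‖u s‖ + 2) ^ 2 :=
      pow_le_pow_left₀ (by positivity) (by linarith) 2
    nlinarith [sq_nonneg (‖u s‖ - 2)]
  · exact ((hu.sq_integrable.intervalIntegrable).add intervalIntegrable_const).const_mul _
  · exact Filter.Eventually.of_forall fun s _ ε _ => hasDerivAt_qf hg ht _ _ _ _ ε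

lemma integral_mul_integral_indicator {q : ℝ → ℝ} (hq : IntegrableOn q (Ioc 0 1)) {S : Set ℝ}
    (hS : MeasurableSet S) (hS1 : S ⊆ Ioc 0 1) :
    ∫ s in (0 : ℝ)..1, q s * ∫ r in (0 : ℝ)..s, S.indicator 1 r =
      ∫ r in S, ∫ s in r..1, q s := by
  set μ : Measure ℝ := volume.restrict (Ioc (0 : ℝ) 1) with hμ
  obtain ⟨D, hDm, hD⟩ : ∃ D : Set (ℝ × ℝ), MeasurableSet D ∧
      ∀ s r, (s, r) ∈ D ↔ r ≤ s ∧ r ∈ S :=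
    ⟨{z | z.2 ≤ z.1} ∩ Prod.snd ⁻¹' S,
      (measurableSet_le measurable_snd measurable_fst).inter (measurable_snd hS),
      fun _ _ => Iff.rfl⟩
  have hD1 : ∀ s r, r ≤ s → r ∈ S → D.indicator (fun z => q z.1) (s, r) = q s := fun s r h h' =>
    indicator_of_mem ((hD s r).2 ⟨h, h'⟩) _
  have hD2 : ∀ s r, ¬ r ≤ s → D.indicator (fun z => q z.1) (s, r) = 0 := fun s r h =>
    indicator_of_notMem (fun h' => h ((hD s r).1 h').1) _
  have hD3 : ∀ s r, r ∉ S → D.indicator (fun z => q z.1) (s, r) = 0 := fun s r h =>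
    indicator_of_notMem (fun h' => h ((hD s r).1 h').2) _
  have hintg : Integrable (Function.uncurry fun s r => D.indicator (fun z => q z.1) (s, r))
      (μ.prod μ) := by
    have h1 : Integrable (fun z : ℝ × ℝ => q z.1) (μ.prod μ) := Integrable.comp_fst hq _
    exact h1.indicator hDm
  have hL : ∫ s in (0 : ℝ)..1, q s * ∫ r in (0 : ℝ)..s, S.indicator 1 r =
      ∫ s, ∫ r, D.indicator (fun z => q z.1) (s, r) ∂μ ∂μ := by
    rw [intervalIntegral.integral_of_le zero_le_one]
    refine setIntegral_congr_fun measurableSet_Ioc fun s hs => ?_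
    rw [← intervalIntegral.integral_const_mul, intervalIntegral.integral_of_le hs.1.le, hμ,
      ← integral_indicator measurableSet_Ioc, ← integral_indicator measurableSet_Ioc]
    refine integral_congr_ae (Filter.Eventually.of_forall fun r => ?_)
    simp only [indicator_apply, mem_Ioc]
    by_cases h1 : r ∈ S
    · have := hS1 h1
      by_cases h2 : r ≤ s <;> simp [h1, h2, this.1, this.2, hD1, hD2]
    · simp [h1, hD3]
  have hR : ∫ r in S, ∫ s in r..1, q s =
      ∫ r, ∫ s, D.indicator (fun z => q z.1) (s, r) ∂μ ∂μ := by
    rw [hμ, ← integral_indicator hS, ← integral_indicator measurableSet_Ioc]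
    refine integral_congr_ae (Filter.Eventually.of_forall fun r => ?_)
    by_cases h1 : r ∈ S
    · have h2 := hS1 h1
      simp only [indicator_of_mem h1, indicator_of_mem h2]
      rw [intervalIntegral.integral_of_le h2.2, ← integral_Icc_eq_integral_Ioc,
        ← integral_indicator measurableSet_Icc, ← integral_indicator measurableSet_Ioc]
      refine integral_congr_ae (Filter.Eventually.of_forall fun s => ?_)
      simp only [indicator_apply, mem_Ioc, mem_Icc]
      by_cases h3 : r ≤ s
      · simp [h1, h3, h2.1.trans_le h3, hD1]
      · simp [h3, hD2]
    · rw [indicator_of_notMem h1]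
      simp [indicator_apply, hD3 _ _ h1]
  rw [hL, hR]
  exact integral_integral_swap hintg

end firstVariation

section momentum

variable {g : (Fin n → ℝ) → ℝ → Matrix (Fin n) (Fin n) ℝ} {T t a β B : ℝ} {x : Fin n → ℝ}
  {u η : ℝ → Fin n → ℝ}

lemma intervalIntegrable_fun_sum {f : Fin n → ℝ → ℝ} {b b' : ℝ}
    (h : ∀ i, IntervalIntegrable (f i) volume b b') :
    IntervalIntegrable (fun s => ∑ i, f i s) volume b b' := by
  rw [intervalIntegrable_iff]
  exact integrable_finsetSum _ fun i _ => intervalIntegrable_iff.1 (h i)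

lemma dd_smul_left (F : (Fin n → ℝ) × ℝ → ℝ) (p : (Fin n → ℝ) × ℝ) (c : ℝ) (i : Fin n) :
    dd (c • Pi.single i (1 : ℝ), 0) F p = c * dd (ex i) F p := by
  have : ((c • Pi.single i (1 : ℝ), 0) : (Fin n → ℝ) × ℝ) = c • ex i := by simp [ex]
  rw [this, dd, map_smul, smul_eq_mul, dd]

lemma dqf_single (hg : SmoothMetricFamily g (Iio T)) {p : (Fin n → ℝ) × ℝ} (hp : p.2 < T)
    (v : Fin n → ℝ) (c : Fin n) (α α' : ℝ) :
    dqf g p v (α • Pi.single c 1) (α' • Pi.single c 1) =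
      2 * (1 / 2 * bl (dm (ex c) (gm g) p) v v * α) + 2 * (α' * (gm g p *ᵥ v) c) := by
  have h : dm (α • Pi.single c 1, 0) (gm g) p = α • dm (ex c) (gm g) p := by
    ext i j; simp only [dm_apply, dd_smul_left, Matrix.smul_apply, smul_eq_mul]
  rw [dqf, h, bl_comm (gm_transpose hg hp)]
  simp only [bl, Matrix.smul_mulVec, dotProduct_smul, smul_dotProduct, smul_eq_mul,
    single_one_dotProduct]
  ring

lemma hasDerivAt_barrier {e : ℝ → ℝ} {e' s : ℝ} (he : HasDerivAt e e' s) (hB : e s < B) :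
    HasDerivAt (fun s => β / (B - e s) ^ 2) (2 * β / (B - e s) ^ 3 * e') s := by
  have h0 : B - e s ≠ 0 := (sub_pos.2 hB).ne'
  refine ((hasDerivAt_const s β).div ((he.const_sub B).pow 2) (pow_ne_zero 2 h0)).congr_deriv ?_
  simp only [Pi.pow_apply]
  field_simp
  ring

lemma first_variation_eq_zero (hg : SmoothMetricFamily g (Iio T)) (ht : t < T) (hu : Adm u)
    (huB : erg g t x u < B)
    (hmin : ∀ v, Adm v → erg g t x v < B → Fn g a β B x t u ≤ Fn g a β B x t v)
    (hη : Adm η) (hη1 : ∀ s, ‖η s‖ ≤ 1) :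
    dd (pth 0 η 1, 0) (scal g) (pth x u 1, t) + 2 * β / (B - erg g t x u) ^ 3 *
      (1 / 2 * ∫ s in (0 : ℝ)..1, dqf g (pth x u s, t) (u s) (pth 0 η s) (η s)) = 0 := by
  have hE := hasDerivAt_erg (x := x) hg ht hu hη hη1
  have hE0 : (fun r => u r + (0 : ℝ) • η r) = u := by simp
  have h1 : HasDerivAt (fun ε : ℝ => scal g (pth x u 1 + ε • pth 0 η 1, t))
      (dd (pth 0 η 1, 0) (scal g) (pth x u 1, t)) 0 := by
    simpa using hasDerivAt_line (smooth_scal hg) ht (pth x u 1) (pth 0 η 1) 0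
  have h2 := hasDerivAt_barrier (β := β) (B := B) hE (by rw [hE0]; exact huB)
  rw [hE0] at h2
  have h3 := (h1.add_const (n / (t - a))).add h2
  have hloc : IsLocalMin (fun ε : ℝ => Fn g a β B x t fun r => u r + ε • η r) 0 := by
    have hev : ∀ᶠ ε : ℝ in 𝓝 0, erg g t x (fun r => u r + ε • η r) < B :=
      hE.continuousAt.eventually_lt continuousAt_const (by rw [hE0]; exact huB)
    filter_upwards [hev] with ε hε
    rw [hE0]
    exact hmin _ (hu.add_smul hη ε) hε
  refine hloc.hasDerivAt_eq_zero ?_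
  refine h3.congr_of_eventuallyEq (Filter.Eventually.of_forall fun ε => ?_)
  simp only [Fn, pth_add_smul hu.1 hη.1, Pi.add_apply]

lemma integral_indicator_smul {S : Set ℝ} (e : Fin n → ℝ) (s : ℝ) :
    pth 0 (fun r => S.indicator (1 : ℝ → ℝ) r • e) s =
      (∫ r in (0 : ℝ)..s, S.indicator (1 : ℝ → ℝ) r) • e := by
  rw [pth, zero_add, intervalIntegral.integral_smul_const]

lemma adm_indicator {S : Set ℝ} (hS : MeasurableSet S) (hS1 : S ⊆ Ioc 0 1) (e : Fin n → ℝ) :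
    Adm fun r => S.indicator (1 : ℝ → ℝ) r • e := by
  have hfin : volume S ≠ ⊤ := ((measure_mono hS1).trans_lt (by simp)).ne
  have h : (fun r => S.indicator (1 : ℝ → ℝ) r • e) = S.indicator fun _ => e := by
    ext r i
    by_cases hr : r ∈ S <;> simp [hr]
  rw [h]
  exact ⟨(integrable_indicator_iff hS).2 (integrableOn_const hfin), memLp_indicator_const 2 hS e
    (Or.inr hfin)⟩

/-- The Euler-Lagrange equation in integrated form. -/
lemma ae_momentum (hg : SmoothMetricFamily g (Iio T)) (ht : t < T) (hu : Adm u)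
    (huB : erg g t x u < B)
    (hmin : ∀ v, Adm v → erg g t x v < B → Fn g a β B x t u ≤ Fn g a β B x t v) (c : Fin n) :
    ∀ᵐ s ∂(volume.restrict (Ioc (0 : ℝ) 1)), dd (ex c) (scal g) (pth x u 1, t) +
      2 * β / (B - erg g t x u) ^ 3 *
        ((∫ r in s..1, 1 / 2 * bl (dm (ex c) (gm g) (pth x u r, t)) (u r) (u r)) +
          (gm g (pth x u s, t) *ᵥ u s) c) = 0 := by
  have hγ := continuous_pth (x := x) hu.1
  set q : ℝ → ℝ := fun r => 1 / 2 * bl (dm (ex c) (gm g) (pth x u r, t)) (u r) (u r) with hq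
  set ρ : ℝ → ℝ := fun s => (gm g (pth x u s, t) *ᵥ u s) c with hρ
  set k := 2 * β / (B - erg g t x u) ^ 3 with hk
  have hqI : IntervalIntegrable q volume 0 1 := by
    simp only [hq, bl_eq_sum]
    refine IntervalIntegrable.const_mul ?_ _
    refine intervalIntegrable_fun_sum fun i => intervalIntegrable_fun_sum fun j => ?_
    simp only [mul_assoc]
    refine IntervalIntegrable.continuousOn_mul ?_
      ((continuous_slice ((msmooth_gm hg i j).dd (ex c)) ht).comp hγ).continuousOn
    exact ((hu.2.eval i).integrable_mul (hu.2.eval j)).intervalIntegrable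
  have hρI : IntervalIntegrable ρ volume 0 1 := by
    simp only [hρ, Matrix.mulVec, dotProduct]
    refine intervalIntegrable_fun_sum fun j => ?_
    exact IntervalIntegrable.continuousOn_mul (hu.1.eval j).intervalIntegrable
      ((continuous_slice (msmooth_gm hg c j) ht).comp hγ).continuousOn
  have hqI' := (intervalIntegrable_iff_integrableOn_Ioc_of_le zero_le_one).1 hqI
  have hρI' := (intervalIntegrable_iff_integrableOn_Ioc_of_le zero_le_one).1 hρI
  have hQc : ContinuousOn (fun s => ∫ r in s..1, q r) (Icc 0 1) := by
    have h1 := intervalIntegral.continuousOn_primitive_interval_left (μ := volume) (f := q)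
      (a := 0) (b := 1) (by rwa [uIcc_of_le zero_le_one, integrableOn_Icc_iff_integrableOn_Ioc])
    rwa [uIcc_of_le zero_le_one] at h1
  have hQI : IntegrableOn (fun s => ∫ r in s..1, q r) (Ioc 0 1) :=
    (hQc.integrableOn_Icc).mono_set Ioc_subset_Icc_self
  have hcI : IntegrableOn (fun _ : ℝ => dd (ex c) (scal g) (pth x u 1, t)) (Ioc 0 1) :=
    integrableOn_const (by simp)
  refine Integrable.ae_eq_zero_of_forall_setIntegral_eq_zero
    (hcI.add ((hQI.add hρI').const_mul k)) fun S' hS' _ => ?_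
  rw [Measure.restrict_restrict hS']
  set S := S' ∩ Ioc (0 : ℝ) 1 with hSdef
  have hS : MeasurableSet S := hS'.inter measurableSet_Ioc
  have hS1 : S ⊆ Ioc 0 1 := inter_subset_right
  have h := first_variation_eq_zero (η := fun r => S.indicator (1 : ℝ → ℝ) r • Pi.single c 1)
    hg ht hu huB hmin (adm_indicator hS hS1 _) (fun s => by
      by_cases hs : s ∈ S <;> simp [hs, Pi.norm_single])
  simp only [integral_indicator_smul, dd_smul_left,
    fun s : ℝ => dqf_single (g := g) hg (p := (pth x u s, t)) ht] at h
  have hα : IntervalIntegrable (fun s => q s * ∫ r in (0 : ℝ)..s, S.indicator (1 : ℝ → ℝ) r)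
      volume 0 1 := by
    refine hqI.mul_continuousOn (Continuous.continuousOn ?_)
    have : Integrable (S.indicator (1 : ℝ → ℝ)) := by
      rw [integrable_indicator_iff hS]
      exact integrableOn_const ((measure_mono hS1).trans_lt (by simp)).ne
    exact intervalIntegral.continuous_primitive (fun _ _ => this.intervalIntegrable) 0
  have hm : (fun s => S.indicator (1 : ℝ → ℝ) s * ρ s) = S.indicator ρ := by
    ext s; by_cases hs : s ∈ S <;> simp [hs]
  have hρS : IntervalIntegrable (fun s => S.indicator (1 : ℝ → ℝ) s * ρ s) volume 0 1 := by
    rw [hm, intervalIntegrable_iff_integrableOn_Ioc_of_le zero_le_one]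
    exact hρI'.indicator hS
  have h4 : ∀ f : ℝ → ℝ, ∫ s in (0 : ℝ)..1, S.indicator f s = ∫ s in S, f s := by
    intro f
    rw [intervalIntegral.integral_of_le zero_le_one, setIntegral_indicator hS,
      inter_eq_self_of_subset_right hS1]
  have h5 : 1 / 2 * ∫ s in (0 : ℝ)..1,
      (2 * (q s * ∫ r in (0 : ℝ)..s, S.indicator (1 : ℝ → ℝ) r) +
        2 * (S.indicator (1 : ℝ → ℝ) s * ρ s)) =
      (∫ r in S, ∫ s in r..1, q s) + ∫ s in S, ρ s := by
    rw [intervalIntegral.integral_add (hα.const_mul 2) (hρS.const_mul 2),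
      intervalIntegral.integral_const_mul, intervalIntegral.integral_const_mul,
      integral_mul_integral_indicator hqI' hS hS1, hm, h4]
    ring
  rw [h5, h4] at h
  have h6 : ∫ s in S, (dd (ex c) (scal g) (pth x u 1, t) + k * ((∫ r in s..1, q r) + ρ s)) =
      (∫ s in S, dd (ex c) (scal g) (pth x u 1, t)) +
        k * ((∫ r in S, ∫ s in r..1, q s) + ∫ s in S, ρ s) := by
    rw [← integral_add (hQI.mono_set hS1) (hρI'.mono_set hS1), ← integral_const_mul]
    exact integral_add (hcI.mono_set hS1)
      ((((hQI.mono_set hS1).add (hρI'.mono_set hS1))).const_mul k)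
  refine h6.trans (Eq.trans ?_ h)
  simp [hk]

end momentum

section minimalPath

variable {g : (Fin n → ℝ) → ℝ → Matrix (Fin n) (Fin n) ℝ} {T t a β B t₀ : ℝ} {x : Fin n → ℝ}
  {u : ℝ → Fin n → ℝ}

/-- The energy of a path with prescribed velocity field. -/
def Erg (g : (Fin n → ℝ) → ℝ → Matrix (Fin n) (Fin n) ℝ) (t : ℝ) (γ v : ℝ → Fin n → ℝ) : ℝ :=
  1 / 2 * ∫ s in (0 : ℝ)..1, qf g (γ s, t) (v s)

/-- The scalar curvature at the endpoint of a path, with penalties for time and energy. -/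
def Gn (g : (Fin n → ℝ) → ℝ → Matrix (Fin n) (Fin n) ℝ) (a β B t : ℝ)
    (γ v : ℝ → Fin n → ℝ) : ℝ :=
  scal g (γ 1, t) + n / (t - a) + β / (B - Erg g t γ v) ^ 2

/-- A minimising path of `Gn` among paths starting at `x` and times in `(a, t₀]`, with its
Euler-Lagrange equations. -/
structure MinPath (g : (Fin n → ℝ) → ℝ → Matrix (Fin n) (Fin n) ℝ) (a β B t₀ : ℝ)
    (x : Fin n → ℝ) (t : ℝ) (γ v : ℝ → Fin n → ℝ) : Prop where
  time : t ∈ Ioc a t₀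
  contPath : Continuous γ
  contVel : Continuous v
  start : γ 0 = x
  vel : ∀ s, HasDerivAt γ (v s) s
  momentum : ∀ c, ∀ s ∈ Ioo (0 : ℝ) 1, HasDerivAt (fun s => (gm g (γ s, t) *ᵥ v s) c)
    (1 / 2 * bl (dm (ex c) (gm g) (γ s, t)) (v s) (v s)) s
  endpoint : ∀ c, dd (ex c) (scal g) (γ 1, t) +
    2 * β / (B - Erg g t γ v) ^ 3 * (gm g (γ 1, t) *ᵥ v 1) c = 0
  erg_lt : Erg g t γ v < B
  le : ∀ t' ∈ Ioc a t₀, ∀ γ' v' : ℝ → Fin n → ℝ, Continuous γ' → Continuous v' → γ' 0 = x →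
    (∀ s ∈ Ioo (0 : ℝ) 1, HasDerivAt γ' (v' s) s) → Erg g t' γ' v' < B →
      Gn g a β B t γ v ≤ Gn g a β B t' γ' v'

/-- A path with continuous velocity comes from an admissible control. -/
lemma exists_adm {γ v : ℝ → Fin n → ℝ} (hγ : Continuous γ) (hv : Continuous v)
    (hd : ∀ s ∈ Ioo (0 : ℝ) 1, HasDerivAt γ (v s) s) :
    ∃ w, Adm w ∧ (∀ s ∈ Icc (0 : ℝ) 1, pth (γ 0) w s = γ s) ∧
      (∀ s ∈ Ioc (0 : ℝ) 1, w s = v s) ∧ ∀ t, erg g t (γ 0) w = Erg g t γ v := by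
  have hb : ∃ C, ∀ s ∈ Ioc (0 : ℝ) 1, ‖v s‖ ≤ C := by
    obtain ⟨C, hC⟩ := (isCompact_Icc (a := (0 : ℝ)) (b := 1)).exists_bound_of_continuousOn
      hv.continuousOn
    exact ⟨C, fun s hs => hC s (Ioc_subset_Icc_self hs)⟩
  obtain ⟨C, hC⟩ := hb
  have hm : ∀ p, MemLp ((Ioc (0 : ℝ) 1).indicator v) p volume := fun p => by
    rw [memLp_indicator_iff_restrict measurableSet_Ioc]
    refine MemLp.of_bound hv.aestronglyMeasurable C ?_
    exact (ae_restrict_mem measurableSet_Ioc).mono hC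
  have hp : ∀ s ∈ Icc (0 : ℝ) 1, pth (γ 0) ((Ioc (0 : ℝ) 1).indicator v) s = γ s := by
    intro s hs
    have h1 : ∫ r in (0 : ℝ)..s, (Ioc (0 : ℝ) 1).indicator v r = ∫ r in (0 : ℝ)..s, v r := by
      refine intervalIntegral.integral_congr_ae (Filter.Eventually.of_forall fun r hr => ?_)
      rw [uIoc_of_le hs.1] at hr
      exact indicator_of_mem (show r ∈ Ioc (0 : ℝ) 1 from ⟨hr.1, hr.2.trans hs.2⟩) v
    have h2 := intervalIntegral.integral_eq_sub_of_hasDerivAt_of_le hs.1 hγ.continuousOn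
      (fun r hr => hd r ⟨hr.1, hr.2.trans_le hs.2⟩) (hv.intervalIntegrable _ _)
    rw [pth, h1, h2]; abel
  refine ⟨_, ⟨memLp_one_iff_integrable.1 (hm 1), hm 2⟩, hp, fun s hs => indicator_of_mem hs v,
    fun t => ?_⟩
  rw [erg, Erg]
  congr 1
  refine intervalIntegral.integral_congr_ae (Filter.Eventually.of_forall fun r hr => ?_)
  rw [uIoc_of_le zero_le_one] at hr
  rw [hp r (Ioc_subset_Icc_self hr), indicator_of_mem hr]

lemma exists_minPath (hg : SmoothMetricFamily g (Iio T))
    (hc : ∀ t ∈ Iio T, riemComplete (fun x => g x t)) (hn : 0 < n) (ha : a < t₀) (ht₀ : t₀ < T)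
    (hβ : 0 < β) (hB : 0 < B) (x : Fin n → ℝ) :
    ∃ t γ v, MinPath g a β B t₀ x t γ v := by
  obtain ⟨t, ht', u, hu, huB, hmin⟩ := exists_min hg hc hn ha ht₀ hβ hB x
  have ht : t < T := ht'.2.trans_lt ht₀
  set k := 2 * β / (B - erg g t x u) ^ 3 with hk
  have hk0 : 0 < k := div_pos (by linarith) (pow_pos (sub_pos.2 huB) 3)
  set γ := pth x u with hγdef
  have hγ : Continuous γ := continuous_pth hu.1
  set q : Fin n → ℝ → ℝ := fun c r => 1 / 2 * bl (dm (ex c) (gm g) (γ r, t)) (u r) (u r) with hq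
  have hae : ∀ᵐ s ∂(volume.restrict (Ioc (0 : ℝ) 1)), ∀ c, dd (ex c) (scal g) (γ 1, t) +
      k * ((∫ r in s..1, q c r) + (gm g (γ s, t) *ᵥ u s) c) = 0 :=
    ae_all_iff.2 fun c => ae_momentum (a := a) hg ht hu huB (fun v hv hvB => hmin t ht' v hv hvB) c
  have hqI : ∀ c, IntegrableOn (q c) (Ioc 0 1) := by
    intro c
    rw [← intervalIntegrable_iff_integrableOn_Ioc_of_le zero_le_one]
    simp only [hq, bl_eq_sum]
    refine IntervalIntegrable.const_mul ?_ _
    refine intervalIntegrable_fun_sum fun i => intervalIntegrable_fun_sum fun j => ?_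
    simp only [mul_assoc]
    refine IntervalIntegrable.continuousOn_mul ?_
      ((continuous_slice ((msmooth_gm hg i j).dd (ex c)) ht).comp hγ).continuousOn
    exact ((hu.2.eval i).integrable_mul (hu.2.eval j)).intervalIntegrable
  set p : ℝ → Fin n → ℝ := fun s c => -dd (ex c) (scal g) (γ 1, t) / k -
    ∫ r in s..1, (Ioc (0 : ℝ) 1).indicator (q c) r with hp
  have hpc : Continuous p := by
    refine continuous_pi fun c => continuous_const.sub ?_
    have h1 : Integrable ((Ioc (0 : ℝ) 1).indicator (q c)) :=
      (integrable_indicator_iff measurableSet_Ioc).2 (hqI c)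
    simp only [fun s => intervalIntegral.integral_symm (μ := volume)
      (f := (Ioc (0 : ℝ) 1).indicator (q c)) 1 s]
    exact (intervalIntegral.continuous_primitive (fun _ _ => h1.intervalIntegrable) 1).neg
  have hind : ∀ c, ∀ s ∈ Icc (0 : ℝ) 1, ∫ r in s..1, (Ioc (0 : ℝ) 1).indicator (q c) r =
      ∫ r in s..1, q c r := by
    intro c s hs
    refine intervalIntegral.integral_congr_ae (Filter.Eventually.of_forall fun r hr => ?_)
    rw [uIoc_of_le hs.2] at hr
    exact indicator_of_mem (show r ∈ Ioc (0 : ℝ) 1 from ⟨hs.1.trans_lt hr.1, hr.2⟩) _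
  set v : ℝ → Fin n → ℝ := fun s => hm g (γ s, t) *ᵥ p s with hv
  have hvc : Continuous v := by
    refine continuous_pi fun i => ?_
    simp only [hv, Matrix.mulVec, dotProduct]
    exact continuous_finsetSum _ fun j _ =>
      ((continuous_slice (msmooth_hm hg i j) ht).comp hγ).mul ((continuous_apply j).comp hpc)
  have huv : ∀ᵐ s ∂(volume.restrict (Ioc (0 : ℝ) 1)), u s = v s := by
    filter_upwards [hae, ae_restrict_mem measurableSet_Ioc] with s hs hs1
    have h1 : gm g (γ s, t) *ᵥ u s = p s := by
      funext c
      have h2 := hs c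
      simp only [hp]
      rw [hind c s (Ioc_subset_Icc_self hs1)]
      field_simp
      linarith
    simp only [hv]
    rw [← h1, Matrix.mulVec_mulVec, hm_mul_gm hg (by exact ht), Matrix.one_mulVec]
  rw [ae_restrict_iff' measurableSet_Ioc] at huv
  set γ' : ℝ → Fin n → ℝ := fun s => x + ∫ r in (0 : ℝ)..s, v r with hγ'
  have hγγ : ∀ s ∈ Icc (0 : ℝ) 1, γ s = γ' s := by
    intro s hs
    simp only [hγ', hγdef, pth]
    congr 1
    refine intervalIntegral.integral_congr_ae ?_
    filter_upwards [huv] with r hr hr1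
    rw [uIoc_of_le hs.1] at hr1
    exact hr ⟨hr1.1, hr1.2.trans hs.2⟩
  have hder : ∀ s, HasDerivAt γ' (v s) s := fun s =>
    (intervalIntegral.integral_hasDerivAt_right (hvc.intervalIntegrable _ _)
      hvc.stronglyMeasurable.stronglyMeasurableAtFilter hvc.continuousAt).const_add x
  have hγ'c : Continuous γ' := continuous_iff_continuousAt.2 fun s => (hder s).continuousAt
  have hErg : erg g t x u = Erg g t γ' v := by
    rw [erg, Erg]
    congr 1
    refine intervalIntegral.integral_congr_ae ?_
    filter_upwards [huv] with r hr hr1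
    rw [uIoc_of_le zero_le_one] at hr1
    rw [hr hr1, ← hγγ r (Ioc_subset_Icc_self hr1)]
  have hGp : ∀ s, gm g (γ s, t) *ᵥ v s = p s := by
    intro s
    simp only [hv]
    rw [Matrix.mulVec_mulVec, gm_mul_hm hg (by exact ht), Matrix.one_mulVec]
  have h1mem : (1 : ℝ) ∈ Icc (0 : ℝ) 1 := ⟨zero_le_one, le_rfl⟩
  set q' : Fin n → ℝ → ℝ := fun c r => 1 / 2 * bl (dm (ex c) (gm g) (γ' r, t)) (v r) (v r) with hq'
  have hq'c : ∀ c, Continuous (q' c) := fun c => continuous_const.mul (continuous_bl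
    (fun i j => (continuous_slice ((msmooth_gm hg i j).dd (ex c)) ht).comp hγ'c) hvc hvc)
  refine ⟨t, γ', v, ⟨ht', hγ'c, hvc, by simp [hγ'], hder, fun c s hs => ?_, fun c => ?_,
    hErg ▸ huB, fun t' ht' γ₁ v₁ hγ₁ hv₁ hx hd₁ hE₁ => ?_⟩⟩
  · have h1 : ∀ s ∈ Ioo (0 : ℝ) 1, (gm g (γ' s, t) *ᵥ v s) c =
        -dd (ex c) (scal g) (γ 1, t) / k - ∫ r in s..1, q' c r := by
      intro s hs
      have hs' := Ioo_subset_Icc_self hs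
      rw [← hγγ s hs', hGp]
      simp only [hp]
      rw [hind c s hs']
      congr 1
      refine intervalIntegral.integral_congr_ae ?_
      filter_upwards [huv] with r hr hr1
      rw [uIoc_of_le hs'.2] at hr1
      have hr2 : r ∈ Ioc (0 : ℝ) 1 := ⟨hs.1.trans hr1.1, hr1.2⟩
      simp only [hq, hq']
      rw [hr hr2, hγγ r (Ioc_subset_Icc_self hr2)]
    have h2 : HasDerivAt (fun s => -dd (ex c) (scal g) (γ 1, t) / k - ∫ r in s..1, q' c r)
        (q' c s) s := by
      have := (intervalIntegral.integral_hasDerivAt_left ((hq'c c).intervalIntegrable s 1)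
        (hq'c c).stronglyMeasurable.stronglyMeasurableAtFilter
        (hq'c c).continuousAt).const_sub (-dd (ex c) (scal g) (γ 1, t) / k)
      simpa using this
    refine h2.congr_of_eventuallyEq ?_
    filter_upwards [isOpen_Ioo.mem_nhds hs] with r hr using h1 r hr
  · rw [← hErg, ← hγγ 1 h1mem, hGp]
    simp only [hp]
    rw [intervalIntegral.integral_same, ← hk]
    field_simp
    ring
  · subst hx
    obtain ⟨w, hw, hwp, -, hwe⟩ := exists_adm (g := g) hγ₁ hv₁ hd₁
    have h1 := hmin t' ht' w hw (by rw [hwe]; exact hE₁)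
    rw [Fn, Fn, hErg, hwe, hwp 1 h1mem] at h1
    rw [Gn, Gn, ← hγγ 1 h1mem]
    exact h1

end minimalPath

section linearODE

/-- Truncation of a vector to a cube. -/
def clampVec (R : ℝ) (z : Fin n → ℝ) (i : Fin n) : ℝ := max (-R) (min R (z i))

lemma norm_clampVec_sub_le (R : ℝ) (z z' : Fin n → ℝ) :
    ‖clampVec R z - clampVec R z'‖ ≤ ‖z - z'‖ := by
  refine (pi_norm_le_iff_of_nonneg (norm_nonneg _)).2 fun i => ?_
  refine le_trans ?_ (norm_le_pi_norm (z - z') i)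
  simp only [Pi.sub_apply, clampVec, Real.norm_eq_abs]
  have h1 := abs_max_sub_max_le_max (-R) (min R (z i)) (-R) (min R (z' i))
  have h2 := abs_min_sub_min_le_max R (z i) R (z' i)
  simp only [sub_self, abs_zero] at h1 h2
  exact h1.trans (max_le (abs_nonneg _) (h2.trans (max_le (abs_nonneg _) le_rfl)))

lemma norm_clampVec_le {R : ℝ} (hR : 0 ≤ R) (z : Fin n → ℝ) : ‖clampVec R z‖ ≤ R := by
  refine (pi_norm_le_iff_of_nonneg hR).2 fun i => ?_
  rw [Real.norm_eq_abs, abs_le]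
  exact ⟨le_max_left _ _, max_le (by linarith) (min_le_left _ _)⟩

lemma clampVec_eq {R : ℝ} {z : Fin n → ℝ} (hz : ‖z‖ ≤ R) : clampVec R z = z := by
  funext i
  have := abs_le.1 ((norm_le_pi_norm z i).trans hz)
  rw [clampVec, min_eq_right this.2, max_eq_right this.1]

lemma norm_mulVec_le {M : Matrix (Fin n) (Fin n) ℝ} {C : ℝ} (hC : 0 ≤ C)
    (hM : ∀ i j, |M i j| ≤ C) (z : Fin n → ℝ) : ‖M *ᵥ z‖ ≤ n * C * ‖z‖ := by
  refine (pi_norm_le_iff_of_nonneg (by positivity)).2 fun i => ?_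
  simp only [Matrix.mulVec, dotProduct]
  refine (norm_sum_le _ _).trans ((Finset.sum_le_sum fun j _ => ?_ :
    _ ≤ ∑ _j : Fin n, C * ‖z‖).trans_eq (by simp; ring))
  rw [norm_mul]
  exact mul_le_mul (hM i j) (norm_le_pi_norm z j) (norm_nonneg _) hC

lemma exists_linear_ode {M : ℝ → Matrix (Fin n) (Fin n) ℝ}
    (hM : ∀ i j, Continuous fun s => M s i j) (y₀ : Fin n → ℝ) :
    ∃ y : ℝ → Fin n → ℝ, y 0 = y₀ ∧ Continuous y ∧
      ∀ s ∈ Ioo (0 : ℝ) 1, HasDerivAt y (M s *ᵥ y s) s := by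
  have hb : ∃ C, 0 ≤ C ∧ ∀ s ∈ Icc (0 : ℝ) 1, ∀ i j, |M s i j| ≤ C := by
    have h1 : ∀ i j, ∃ C, ∀ s ∈ Icc (0 : ℝ) 1, |M s i j| ≤ C := fun i j =>
      isCompact_Icc.exists_bound_of_continuousOn (hM i j).continuousOn
    choose C hC using h1
    refine ⟨∑ i, ∑ j, |C i j|, by positivity, fun s hs i j => (hC i j s hs).trans ?_⟩
    refine (le_abs_self _).trans ?_
    refine (Finset.single_le_sum (f := fun j => |C i j|) (fun j _ => abs_nonneg _)
      (Finset.mem_univ j)).trans ?_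
    exact Finset.single_le_sum (f := fun i => ∑ j, |C i j|)
      (fun i _ => Finset.sum_nonneg fun j _ => abs_nonneg _) (Finset.mem_univ i)
  obtain ⟨C, hC0, hC⟩ := hb
  set K : ℝ := n * C with hK
  have hK0 : 0 ≤ K := by positivity
  set R : ℝ := ‖y₀‖ * Real.exp K with hR
  have hR0 : 0 ≤ R := by positivity
  have hf : IsPicardLindelof (fun s z => M s *ᵥ clampVec R z) (tmin := 0) (tmax := 1)
      ⟨0, le_rfl, zero_le_one⟩ y₀ (⟨K * R, by positivity⟩ : NNReal) 0 ⟨K * R, by positivity⟩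
      ⟨K, hK0⟩ := by
    refine ⟨fun s hs => ?_, fun z _ => ?_, fun s hs z _ => ?_, ?_⟩
    · refine LipschitzWith.lipschitzOnWith (LipschitzWith.of_dist_le_mul fun z z' => ?_)
      rw [dist_eq_norm, dist_eq_norm, ← Matrix.mulVec_sub]
      exact (norm_mulVec_le hC0 (hC s hs) _).trans
        (mul_le_mul_of_nonneg_left (norm_clampVec_sub_le _ _ _) hK0)
    · refine (continuous_pi fun i => ?_).continuousOn
      simp only [Matrix.mulVec, dotProduct]
      exact continuous_finsetSum _ fun j _ => (hM i j).mul continuous_const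
    · exact (norm_mulVec_le hC0 (hC s hs) _).trans
        (mul_le_mul_of_nonneg_left (norm_clampVec_le hR0 _) hK0)
    · simp
  obtain ⟨α, hα0, hα⟩ := hf.exists_eq_forall_mem_Icc_hasDerivWithinAt₀
  have hαc : ContinuousOn α (Icc 0 1) := fun s hs => (hα s hs).continuousWithinAt
  have hle : ∀ s ∈ Icc (0 : ℝ) 1, ‖α s‖ ≤ R := by
    intro s hs
    have h1 := norm_le_gronwallBound_of_norm_deriv_right_le (f := α) (δ := ‖y₀‖) (K := K) (ε := 0)
      hαc (fun r hr => (hα r (Ico_subset_Icc_self hr)).mono_of_mem_nhdsWithin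
        (Icc_mem_nhdsGE_of_mem hr)) (by simpa using (congrArg norm hα0).le) (fun r hr => by
        have h2 := norm_mulVec_le hC0 (hC r (Ico_subset_Icc_self hr)) (clampVec R (α r))
        have h3 : ‖clampVec R (α r)‖ ≤ ‖α r‖ := by
          have h4 := norm_clampVec_sub_le R (α r) 0
          rwa [clampVec_eq (z := (0 : Fin n → ℝ)) (by simpa using hR0), sub_zero, sub_zero] at h4
        rw [add_zero]
        exact h2.trans (mul_le_mul_of_nonneg_left h3 hK0)) s hs
    rw [gronwallBound_ε0, sub_zero] at h1
    refine h1.trans (mul_le_mul_of_nonneg_left (Real.exp_le_exp.2 ?_) (norm_nonneg _))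
    exact mul_le_of_le_one_right hK0 hs.2
  refine ⟨IccExtend zero_le_one ((Icc (0 : ℝ) 1).domRestrict α), ?_,
    (continuousOn_iff_continuous_domRestrict.1 hαc).Icc_extend', fun s hs => ?_⟩
  · rw [IccExtend_of_mem _ _ ⟨le_rfl, zero_le_one⟩]
    exact hα0
  · have hs' := Ioo_subset_Icc_self hs
    rw [IccExtend_of_mem _ _ hs']
    have h1 := (hα s hs').hasDerivAt (Icc_mem_nhds hs.1 hs.2)
    rw [clampVec_eq (hle s hs')] at h1
    refine h1.congr_of_eventuallyEq ?_
    filter_upwards [Icc_mem_nhds hs.1 hs.2] with r hr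
    exact IccExtend_of_mem _ _ hr

end linearODE

section parallelFrame

variable {g : (Fin n → ℝ) → ℝ → Matrix (Fin n) (Fin n) ℝ} {T t : ℝ}

/-- The connection matrix in the direction `v`. -/
def tc (g : (Fin n → ℝ) → ℝ → Matrix (Fin n) (Fin n) ℝ) (p : (Fin n → ℝ) × ℝ) (v : Fin n → ℝ) :
    Matrix (Fin n) (Fin n) ℝ := ∑ a, v a • conn g a p

lemma dm_vec_gm (hg : SmoothMetricFamily g (Iio T)) {p : (Fin n → ℝ) × ℝ} (hp : p.2 < T)
    (v : Fin n → ℝ) :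
    dm (v, 0) (gm g) p = (tc g p v)ᵀ * gm g p + gm g p * tc g p v := by
  simp only [dm_eq_sum, dm_gm hg hp, tc, Matrix.transpose_sum, Matrix.transpose_smul,
    Finset.sum_mul, Finset.mul_sum, smul_add, Finset.sum_add_distrib, Matrix.smul_mul,
    Matrix.mul_smul]

lemma eq_of_hasDerivAt_zero {f : ℝ → ℝ} (hf : ContinuousOn f (Icc 0 1))
    (hd : ∀ s ∈ Ioo (0 : ℝ) 1, HasDerivAt f 0 s) {s : ℝ} (hs : s ∈ Icc (0 : ℝ) 1) :
    f s = f 0 := by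
  have := intervalIntegral.integral_eq_sub_of_hasDerivAt_of_le (f' := fun _ => (0 : ℝ)) hs.1
    (hf.mono (Icc_subset_Icc_right hs.2)) (fun r hr => hd r ⟨hr.1, hr.2.trans_le hs.2⟩)
    intervalIntegrable_const
  simp at this
  linarith

lemma bl_mulVec_left (M A : Matrix (Fin n) (Fin n) ℝ) (v w : Fin n → ℝ) :
    bl M (A *ᵥ v) w = bl (Aᵀ * M) v w := by
  rw [bl, bl, ← Matrix.mulVec_mulVec, Matrix.dotProduct_mulVec v, Matrix.vecMul_transpose]

lemma bl_mulVec_right (M A : Matrix (Fin n) (Fin n) ℝ) (v w : Fin n → ℝ) :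
    bl M v (A *ᵥ w) = bl (M * A) v w := by
  rw [bl, bl, Matrix.mulVec_mulVec]

lemma bl_add (M M' : Matrix (Fin n) (Fin n) ℝ) (v w : Fin n → ℝ) :
    bl (M + M') v w = bl M v w + bl M' v w := by
  rw [bl, Matrix.add_mulVec, dotProduct_add]; rfl

lemma bl_neg (M : Matrix (Fin n) (Fin n) ℝ) (v w : Fin n → ℝ) : bl (-M) v w = -bl M v w := by
  rw [bl, Matrix.neg_mulVec, dotProduct_neg]; rfl

lemma continuous_conn_along (hg : SmoothMetricFamily g (Iio T)) (ht : t < T)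
    {γ v : ℝ → Fin n → ℝ} (hγ : Continuous γ) (hv : Continuous v) (i j : Fin n) :
    Continuous fun s => tc g (γ s, t) (v s) i j := by
  simp only [tc, Matrix.sum_apply, Matrix.smul_apply, smul_eq_mul]
  exact continuous_finsetSum _ fun a _ => ((continuous_apply a).comp hv).mul
    ((continuous_slice (msmooth_conn hg a i j) ht).comp hγ)

/-- Parallel orthonormal frames along a path. -/
lemma exists_parallel_frame (hg : SmoothMetricFamily g (Iio T)) (ht : t < T)
    {γ v : ℝ → Fin n → ℝ} (hγ : Continuous γ) (hv : Continuous v)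
    (hd : ∀ s, HasDerivAt γ (v s) s) :
    ∃ P : Fin n → ℝ → Fin n → ℝ, (∀ i, Continuous (P i)) ∧
      (∀ i, ∀ s ∈ Ioo (0 : ℝ) 1, HasDerivAt (P i) (-(tc g (γ s, t) (v s) *ᵥ P i s)) s) ∧
      ∀ s ∈ Icc (0 : ℝ) 1, ∀ a b, ∑ i, P i s a * P i s b = hm g (γ s, t) a b := by
  obtain ⟨P₀, -, hP₀⟩ := exists_frame hg (p := (γ 0, t)) (by exact ht)
  have h1 := fun i : Fin n => exists_linear_ode (M := fun s => -tc g (γ s, t) (v s))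
    (fun a b => (continuous_conn_along hg ht hγ hv a b).neg) (fun a => P₀ a i)
  choose P hP0 hPc hPd using h1
  simp only [Matrix.neg_mulVec] at hPd
  refine ⟨P, hPc, hPd, fun s hs => ?_⟩
  have hort : ∀ i j, bl (gm g (γ s, t)) (P i s) (P j s) = (1 : Matrix (Fin n) (Fin n) ℝ) i j := by
    intro i j
    have hcont : Continuous fun s => bl (gm g (γ s, t)) (P i s) (P j s) := continuous_bl
      (fun a b => (continuous_slice (msmooth_gm hg a b) ht).comp hγ) (hPc i) (hPc j)
    have hder : ∀ s ∈ Ioo (0 : ℝ) 1,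
        HasDerivAt (fun s => bl (gm g (γ s, t)) (P i s) (P j s)) 0 s := by
      intro s hs
      refine (hasDerivAt_bl (M := fun s => gm g (γ s, t))
        (fun a b => hasDerivAt_along (msmooth_gm hg a b) ht (hd s))
        (hPd i s hs) (hPd j s hs) (M' := dm (v s, 0) (gm g) (γ s, t))).congr_deriv ?_
      rw [dm_vec_gm hg (by exact ht), ← Matrix.neg_mulVec, ← Matrix.neg_mulVec, bl_mulVec_left,
        bl_mulVec_right, Matrix.transpose_neg, Matrix.neg_mul, Matrix.mul_neg, bl_add, bl_neg,
        bl_neg]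
      ring
    rw [eq_of_hasDerivAt_zero hcont.continuousOn hder hs, ← hP₀]
    simp only [bl_eq_sum, hP0, Matrix.mul_apply, Matrix.transpose_apply, Finset.sum_mul]
    rw [Finset.sum_comm]
    exact Finset.sum_congr rfl fun a _ => Finset.sum_congr rfl fun b _ => by ring
  set Q : Matrix (Fin n) (Fin n) ℝ := Matrix.of fun a i => P i s a with hQ
  have hQG : Qᵀ * gm g (γ s, t) * Q = 1 := by
    ext i j
    rw [← hort i j]
    simp only [bl_eq_sum, Matrix.mul_apply, Matrix.transpose_apply, Finset.sum_mul, hQ,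
      Matrix.of_apply]
    rw [Finset.sum_comm]
    exact Finset.sum_congr rfl fun a _ => Finset.sum_congr rfl fun b _ => by ring
  have h2 : Q * (Qᵀ * gm g (γ s, t)) = 1 := mul_eq_one_comm.1 hQG
  have h3 : Q * Qᵀ = hm g (γ s, t) := by
    have h4 : Q * Qᵀ * gm g (γ s, t) = 1 := by rw [Matrix.mul_assoc]; exact h2
    calc Q * Qᵀ = Q * Qᵀ * (gm g (γ s, t) * hm g (γ s, t)) := by
          rw [gm_mul_hm hg (by exact ht), Matrix.mul_one]
      _ = hm g (γ s, t) := by rw [← Matrix.mul_assoc, h4, Matrix.one_mul]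
  intro a b
  rw [← h3]
  simp [Matrix.mul_apply, hQ]

end parallelFrame

section secondVariationAlgebra

variable {g : (Fin n → ℝ) → ℝ → Matrix (Fin n) (Fin n) ℝ} {T : ℝ} {p : (Fin n → ℝ) × ℝ}

/-- The contraction `H^{ab} (v M_a)_b` of a family of matrices. -/
def cc (H : Matrix (Fin n) (Fin n) ℝ) (M : Fin n → Matrix (Fin n) (Fin n) ℝ) (v : Fin n → ℝ) : ℝ :=
  ∑ a, ∑ b, H a b * (v ᵥ* M a) b

lemma cc_add (H : Matrix (Fin n) (Fin n) ℝ) (M N : Fin n → Matrix (Fin n) (Fin n) ℝ)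
    (v : Fin n → ℝ) : cc H (fun a => M a + N a) v = cc H M v + cc H N v := by
  simp only [cc, Matrix.vecMul_add, Pi.add_apply, mul_add, Finset.sum_add_distrib]

lemma cc_sub (H : Matrix (Fin n) (Fin n) ℝ) (M N : Fin n → Matrix (Fin n) (Fin n) ℝ)
    (v : Fin n → ℝ) : cc H (fun a => M a - N a) v = cc H M v - cc H N v := by
  simp only [cc, Matrix.vecMul_sub, Pi.sub_apply, mul_sub, Finset.sum_sub_distrib]

lemma cc_neg (H : Matrix (Fin n) (Fin n) ℝ) (M : Fin n → Matrix (Fin n) (Fin n) ℝ)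
    (v : Fin n → ℝ) : cc H (fun a => -M a) v = -cc H M v := by
  simp only [cc, Matrix.vecMul_neg, Pi.neg_apply, mul_neg, Finset.sum_neg_distrib]

lemma bl_eq_vecMul (M : Matrix (Fin n) (Fin n) ℝ) (v w : Fin n → ℝ) :
    bl M v w = ∑ b, (v ᵥ* M) b * w b := by
  rw [bl, Matrix.dotProduct_mulVec]; rfl

/-- The trace `H^{ab} Γ_{ab}` of the connection. -/
def zvec (g : (Fin n → ℝ) → ℝ → Matrix (Fin n) (Fin n) ℝ) (p : (Fin n → ℝ) × ℝ) (l : Fin n) : ℝ :=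
  ∑ a, ∑ b, hm g p a b * conn g a p l b

lemma smooth_zvec (hg : SmoothMetricFamily g (Iio T)) (l : Fin n) :
    SmoothOn T fun p => zvec g p l :=
  SmoothOn.sum fun a _ => SmoothOn.sum fun b _ => (msmooth_hm hg a b).mul (msmooth_conn hg a l b)

lemma bl_sum_vec (H G : Matrix (Fin n) (Fin n) ℝ) (M : Fin n → Matrix (Fin n) (Fin n) ℝ)
    (v : Fin n → ℝ) :
    bl G v (fun l => ∑ a, ∑ b, H a b * M a l b) = cc H (fun a => G * M a) v := by
  rw [bl_eq_vecMul, cc]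
  simp only [← Matrix.vecMul_vecMul, Finset.mul_sum]
  rw [Finset.sum_comm]
  refine Finset.sum_congr rfl fun a _ => ?_
  rw [Finset.sum_comm]
  refine Finset.sum_congr rfl fun b _ => ?_
  rw [Matrix.vecMul, dotProduct, Finset.mul_sum]
  exact Finset.sum_congr rfl fun l _ => by ring

/-- The derivative of the connection matrix in direction `v`, with `v` frozen. -/
def dtc (g : (Fin n → ℝ) → ℝ → Matrix (Fin n) (Fin n) ℝ) (p : (Fin n → ℝ) × ℝ) (v : Fin n → ℝ)
    (a : Fin n) : Matrix (Fin n) (Fin n) ℝ := ∑ c, v c • dm (ex a) (conn g c) p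

lemma tc_apply (v : Fin n → ℝ) (i j : Fin n) : tc g p v i j = ∑ c, v c * conn g c p i j := by
  simp only [tc, Matrix.sum_apply, Matrix.smul_apply, smul_eq_mul]

lemma conn_mulVec (hg : SmoothMetricFamily g (Iio T)) (hp : p.2 < T) (v : Fin n → ℝ) (a k : Fin n) :
    (conn g a p *ᵥ v) k = tc g p v k a := by
  simp only [tc_apply, Matrix.mulVec, dotProduct]
  exact Finset.sum_congr rfl fun c _ => by rw [conn_symm hg hp]; ring

lemma dm_conn_mulVec (hg : SmoothMetricFamily g (Iio T)) (hp : p.2 < T) (v : Fin n → ℝ)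
    (a b k : Fin n) : (dm (ex a) (conn g b) p *ᵥ v) k = dtc g p v a k b := by
  simp only [dtc, Matrix.mulVec, dotProduct, Matrix.sum_apply, Matrix.smul_apply, smul_eq_mul]
  refine Finset.sum_congr rfl fun c _ => ?_
  rw [mul_comm]; congr 1
  exact dd_congr _ hp fun q hq => conn_symm hg (mem_dom.1 hq) _ _ _

lemma bl_mul_conn (hg : SmoothMetricFamily g (Iio T)) (hp : p.2 < T)
    (M : Matrix (Fin n) (Fin n) ℝ) (v w : Fin n → ℝ) (b : Fin n) :
    bl (M * conn g b p) w v = (w ᵥ* (M * tc g p v)) b := by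
  rw [← bl_mulVec_right, bl_eq_vecMul, ← Matrix.vecMul_vecMul]
  simp only [conn_mulVec hg hp]
  rfl

lemma bl_mul_dm_conn (hg : SmoothMetricFamily g (Iio T)) (hp : p.2 < T)
    (M : Matrix (Fin n) (Fin n) ℝ) (v w : Fin n → ℝ) (a b : Fin n) :
    bl (M * dm (ex a) (conn g b) p) w v = (w ᵥ* (M * dtc g p v a)) b := by
  rw [← bl_mulVec_right, bl_eq_vecMul, ← Matrix.vecMul_vecMul]
  simp only [dm_conn_mulVec hg hp]
  rfl

lemma bl_transpose (M : Matrix (Fin n) (Fin n) ℝ) (v w : Fin n → ℝ) : bl Mᵀ v w = bl M w v := by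
  rw [bl, Matrix.dotProduct_mulVec, Matrix.vecMul_transpose, bl, dotProduct_comm]

lemma bl_dm_gm (hg : SmoothMetricFamily g (Iio T)) (hp : p.2 < T) (v : Fin n → ℝ) (b : Fin n) :
    bl (dm (ex b) (gm g) p) v v = 2 * (v ᵥ* (gm g p * tc g p v)) b := by
  have h : (conn g b p)ᵀ * gm g p = (gm g p * conn g b p)ᵀ := by
    rw [Matrix.transpose_mul, gm_transpose hg hp]
  rw [dm_gm hg hp, h, bl_add, bl_transpose, bl_mul_conn hg hp]; ring

lemma bl_dm_dm_gm (hg : SmoothMetricFamily g (Iio T)) (hp : p.2 < T) (v : Fin n → ℝ)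
    (a b : Fin n) : bl (dm (ex a) (dm (ex b) (gm g)) p) v v =
      2 * ((v ᵥ* (dm (ex a) (gm g) p * tc g p v)) b + (v ᵥ* (gm g p * dtc g p v a)) b) := by
  have hA := msmooth_conn hg b
  have hG := msmooth_gm hg
  have h1 : dm (ex a) (dm (ex b) (gm g)) p =
      dm (ex a) (fun q => (gm g q * conn g b q)ᵀ + gm g q * conn g b q) p := by
    refine dm_congr _ hp fun q hq => ?_
    rw [dm_gm hg (mem_dom.1 hq), Matrix.transpose_mul, gm_transpose hg (mem_dom.1 hq)]
  rw [h1, dm_add _ hp (hG.mul hA).transpose (hG.mul hA), dm_transpose, dm_mul _ hp hG hA, bl_add,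
    bl_transpose, bl_add, bl_mul_conn hg hp, bl_mul_dm_conn hg hp]
  ring

lemma cc_transpose_mul (hg : SmoothMetricFamily g (Iio T)) (hp : p.2 < T)
    (M : Matrix (Fin n) (Fin n) ℝ) (v : Fin n → ℝ) (H : Matrix (Fin n) (Fin n) ℝ) :
    cc H (fun a => (conn g a p)ᵀ * M) v = ∑ a, ∑ b, H a b * ((tc g p v)ᵀ * M) a b := by
  refine Finset.sum_congr rfl fun a _ => Finset.sum_congr rfl fun b _ => ?_
  rw [← Matrix.vecMul_vecMul, Matrix.vecMul_transpose, Matrix.mul_apply, Matrix.vecMul, dotProduct]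
  simp only [conn_mulVec hg hp, Matrix.transpose_apply]

lemma sum_zvec_bl (hg : SmoothMetricFamily g (Iio T)) (hp : p.2 < T) (v : Fin n → ℝ) :
    1 / 2 * ∑ l, zvec g p l * bl (dm (ex l) (gm g) p) v v =
      cc (hm g p) (fun a => gm g p * (tc g p v * conn g a p)) v := by
  have h := bl_sum_vec (hm g p) (gm g p * tc g p v) (fun a => conn g a p) v
  simp only [Matrix.mul_assoc] at h
  rw [← h, bl_eq_vecMul, Finset.mul_sum]
  refine Finset.sum_congr rfl fun l _ => ?_
  rw [bl_dm_gm hg hp, zvec]; ring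

lemma dm_vec_hm (hg : SmoothMetricFamily g (Iio T)) (hp : p.2 < T) (v : Fin n → ℝ) :
    dm (v, 0) (hm g) p = -(hm g p * (tc g p v)ᵀ) - tc g p v * hm g p := by
  simp only [dm_eq_sum, dm_hm hg hp, tc, Matrix.transpose_sum, Matrix.transpose_smul,
    Finset.sum_mul, Finset.mul_sum, smul_sub, smul_neg, Finset.sum_sub_distrib,
    Finset.sum_neg_distrib, Matrix.smul_mul, Matrix.mul_smul]

lemma bl_dd_zvec (hg : SmoothMetricFamily g (Iio T)) (hp : p.2 < T) (v : Fin n → ℝ) :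
    bl (gm g p) v (fun l => dd (v, 0) (fun q => zvec g q l) p) =
      cc (hm g p) (fun a => gm g p * dm (v, 0) (conn g a) p) v
      - 2 * cc (hm g p) (fun a => gm g p * (conn g a p * tc g p v)) v := by
  have h1 : (fun l => dd (v, 0) (fun q => zvec g q l) p) = fun l =>
      (∑ a, ∑ b, dm (v, 0) (hm g) p a b * conn g a p l b) +
        ∑ a, ∑ b, hm g p a b * dm (v, 0) (conn g a) p l b := by
    funext l
    have hs : ∀ a b, SmoothOn T fun q => hm g q a b * conn g a q l b := fun a b =>
      (msmooth_hm hg a b).mul (msmooth_conn hg a l b)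
    simp only [zvec]
    rw [dd_sum _ hp fun a _ => SmoothOn.sum fun b _ => hs a b, ← Finset.sum_add_distrib]
    refine Finset.sum_congr rfl fun a _ => ?_
    rw [dd_sum _ hp fun b _ => hs a b, ← Finset.sum_add_distrib]
    exact Finset.sum_congr rfl fun b _ => dd_mul _ hp (msmooth_hm hg a b) (msmooth_conn hg a l b)
  have h2 : ∀ l, ∑ a, ∑ b, dm (v, 0) (hm g) p a b * conn g a p l b =
      -2 * ∑ a, ∑ b, hm g p a b * (conn g a p * tc g p v) l b := by
    intro l
    have e1 : ∑ a, ∑ b, (hm g p * (tc g p v)ᵀ) a b * conn g a p l b =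
        ∑ a, ∑ b, hm g p a b * (conn g a p * tc g p v) l b := by
      refine Finset.sum_congr rfl fun a _ => ?_
      simp only [Matrix.mul_apply, Matrix.transpose_apply, Finset.sum_mul, Finset.mul_sum]
      rw [Finset.sum_comm]
      exact Finset.sum_congr rfl fun b _ => Finset.sum_congr rfl fun c _ => by ring
    have e2 : ∑ a, ∑ b, (tc g p v * hm g p) a b * conn g a p l b =
        ∑ a, ∑ b, hm g p a b * (conn g a p * tc g p v) l b := by
      rw [← e1, Finset.sum_comm]
      refine Finset.sum_congr rfl fun a _ => Finset.sum_congr rfl fun b _ => ?_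
      rw [conn_symm hg hp]
      congr 1
      simp only [Matrix.mul_apply, Matrix.transpose_apply]
      exact Finset.sum_congr rfl fun c _ => by rw [hm_symm hg hp]; ring
    rw [dm_vec_hm hg hp]
    simp only [Matrix.sub_apply, Matrix.neg_apply, sub_mul, neg_mul, Finset.sum_sub_distrib,
      Finset.sum_neg_distrib, e1, e2]
    ring
  have h3 : (fun l => dd (v, 0) (fun q => zvec g q l) p) =
      (-2 : ℝ) • (fun l => ∑ a, ∑ b, hm g p a b * (conn g a p * tc g p v) l b) +
        fun l => ∑ a, ∑ b, hm g p a b * dm (v, 0) (conn g a) p l b := by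
    rw [h1]; funext l; rw [h2]; rfl
  rw [h3, bl, Matrix.mulVec_add, Matrix.mulVec_smul, dotProduct_add, dotProduct_smul]
  change _ • bl _ _ _ + bl _ _ _ = _
  rw [bl_sum_vec, bl_sum_vec, smul_eq_mul]
  ring

lemma cc_curv (hg : SmoothMetricFamily g (Iio T)) (hp : p.2 < T) (v : Fin n → ℝ) :
    cc (hm g p) (fun a => gm g p * ∑ c, v c • curv g a c p) v = -bl (ric g p) v v := by
  have h1 : ∀ a, gm g p * ∑ c, v c • curv g a c p = -((∑ c, v c • curv g a c p)ᵀ * gm g p) := by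
    intro a
    simp only [Finset.mul_sum, Matrix.transpose_sum, Finset.sum_mul, Matrix.transpose_smul,
      Matrix.smul_mul, Matrix.mul_smul, ← Finset.sum_neg_distrib, ← smul_neg]
    refine Finset.sum_congr rfl fun c _ => ?_
    rw [eq_neg_of_add_eq_zero_right (curv_skew hg hp a c)]
  simp only [h1]
  rw [cc_neg]
  congr 1
  have h2 : ∀ a, ∑ b, hm g p a b * (v ᵥ* ((∑ c, v c • curv g a c p)ᵀ * gm g p)) b =
      ((∑ c, v c • curv g a c p) *ᵥ v) a := by
    intro a
    rw [← Matrix.vecMul_vecMul, Matrix.vecMul_transpose]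
    have : gm g p * hm g p = 1 := gm_mul_hm hg hp
    calc _ = ((((∑ c, v c • curv g a c p) *ᵥ v) ᵥ* gm g p) ᵥ* hm g p) a := by
            conv_rhs => rw [Matrix.vecMul, dotProduct]
            exact Finset.sum_congr rfl fun b _ => by rw [hm_symm hg hp, mul_comm]
      _ = _ := by rw [Matrix.vecMul_vecMul, this, Matrix.vecMul_one]
  rw [cc, Finset.sum_congr rfl fun a _ => h2 a, bl_eq_sum]
  simp only [ric_apply hg hp, Matrix.mulVec, dotProduct, Matrix.sum_apply, Matrix.smul_apply,
    smul_eq_mul, Finset.sum_mul]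
  rw [Finset.sum_comm, Finset.sum_comm (s := Finset.univ) (t := Finset.univ)
    (f := fun i j => ∑ a, curv g a i p a j * v i * v j)]
  refine Finset.sum_congr rfl fun k _ => ?_
  rw [Finset.sum_comm]
  exact Finset.sum_congr rfl fun c _ => Finset.sum_congr rfl fun a _ => by ring

/-- The curvature identity behind the second variation formula. -/
lemma second_variation_identity (hg : SmoothMetricFamily g (Iio T)) (hp : p.2 < T)
    (v : Fin n → ℝ) :
    1 / 2 * ∑ a, ∑ b, hm g p a b * bl (dm (ex a) (dm (ex b) (gm g)) p) v v
      - 2 * cc (hm g p) (fun a => dm (ex a) (gm g) p * tc g p v) v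
      + ∑ a, ∑ b, hm g p a b * ((tc g p v)ᵀ * (gm g p * tc g p v)) a b
    = -bl (ric g p) v v + 1 / 2 * ∑ l, zvec g p l * bl (dm (ex l) (gm g) p) v v
      + bl (gm g p) v (fun l => dd (v, 0) (fun q => zvec g q l) p) := by
  have h1 : 1 / 2 * ∑ a, ∑ b, hm g p a b * bl (dm (ex a) (dm (ex b) (gm g)) p) v v =
      cc (hm g p) (fun a => dm (ex a) (gm g) p * tc g p v) v +
        cc (hm g p) (fun a => gm g p * dtc g p v a) v := by
    rw [cc, cc, ← Finset.sum_add_distrib, Finset.mul_sum]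
    refine Finset.sum_congr rfl fun a _ => ?_
    rw [← Finset.sum_add_distrib, Finset.mul_sum]
    exact Finset.sum_congr rfl fun b _ => by rw [bl_dm_dm_gm hg hp]; ring
  have h2 : cc (hm g p) (fun a => dm (ex a) (gm g) p * tc g p v) v =
      cc (hm g p) (fun a => (conn g a p)ᵀ * (gm g p * tc g p v)) v +
        cc (hm g p) (fun a => gm g p * (conn g a p * tc g p v)) v := by
    rw [← cc_add]
    simp only [dm_gm hg hp, Matrix.add_mul, Matrix.mul_assoc]
  have h3 := cc_curv hg hp v
  have h4 : ∀ a, gm g p * ∑ c, v c • curv g a c p = gm g p * dtc g p v a -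
      gm g p * dm (v, 0) (conn g a) p + gm g p * (conn g a p * tc g p v) -
      gm g p * (tc g p v * conn g a p) := by
    intro a
    rw [← Matrix.mul_sub, ← Matrix.mul_add, ← Matrix.mul_sub]
    congr 1
    simp only [dm_eq_sum, dtc, tc, curv, smul_sub, smul_add, Finset.sum_sub_distrib,
      Finset.sum_add_distrib, Finset.mul_sum, Finset.sum_mul, Matrix.smul_mul, Matrix.mul_smul]
  simp only [h4] at h3
  rw [cc_sub, cc_add, cc_sub] at h3
  rw [sum_zvec_bl hg hp, bl_dd_zvec hg hp, h1, ← cc_transpose_mul hg hp, h2]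
  linarith

end secondVariationAlgebra

section frameSums

variable {g : (Fin n → ℝ) → ℝ → Matrix (Fin n) (Fin n) ℝ} {T : ℝ} {p : (Fin n → ℝ) × ℝ}

lemma sum_frame {H : Matrix (Fin n) (Fin n) ℝ} {P : Fin n → Fin n → ℝ}
    (hP : ∀ a b, ∑ i, P i a * P i b = H a b) (K : Fin n → Fin n → ℝ) :
    ∑ i, ∑ a, ∑ b, P i a * P i b * K a b = ∑ a, ∑ b, H a b * K a b := by
  rw [Finset.sum_comm]
  refine Finset.sum_congr rfl fun a _ => ?_
  rw [Finset.sum_comm]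
  refine Finset.sum_congr rfl fun b _ => ?_
  rw [← hP, Finset.sum_mul]

lemma bl_smul_left (M : Matrix (Fin n) (Fin n) ℝ) (c : ℝ) (v w : Fin n → ℝ) :
    bl M (c • v) w = c * bl M v w := by rw [bl, smul_dotProduct, smul_eq_mul]; rfl

lemma bl_smul_right (M : Matrix (Fin n) (Fin n) ℝ) (c : ℝ) (v w : Fin n → ℝ) :
    bl M v (c • w) = c * bl M v w := by
  rw [bl, Matrix.mulVec_smul, dotProduct_smul, smul_eq_mul]; rfl

lemma bl_sub_left (M : Matrix (Fin n) (Fin n) ℝ) (u v w : Fin n → ℝ) :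
    bl M (u - v) w = bl M u w - bl M v w := by rw [bl, sub_dotProduct]; rfl

lemma bl_sub_right (M : Matrix (Fin n) (Fin n) ℝ) (u v w : Fin n → ℝ) :
    bl M u (v - w) = bl M u v - bl M u w := by
  rw [bl, Matrix.mulVec_sub, dotProduct_sub]; rfl

lemma sum_bl_frame {H : Matrix (Fin n) (Fin n) ℝ} {P : Fin n → Fin n → ℝ}
    (hP : ∀ a b, ∑ i, P i a * P i b = H a b) (M : Matrix (Fin n) (Fin n) ℝ) :
    ∑ i, bl M (P i) (P i) = ∑ a, ∑ b, H a b * M a b := by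
  refine Eq.trans ?_ (sum_frame hP fun a b => M a b)
  simp only [bl_eq_sum]
  exact Finset.sum_congr rfl fun i _ => Finset.sum_congr rfl fun a _ =>
    Finset.sum_congr rfl fun b _ => by ring

lemma sum_bl_dm_frame {H : Matrix (Fin n) (Fin n) ℝ} {P : Fin n → Fin n → ℝ}
    (hP : ∀ a b, ∑ i, P i a * P i b = H a b) (F : (Fin n → ℝ) × ℝ → Matrix (Fin n) (Fin n) ℝ)
    (A : Matrix (Fin n) (Fin n) ℝ) (v : Fin n → ℝ) :
    ∑ i, bl (dm (P i, 0) F p * A) v (P i) = cc H (fun a => dm (ex a) F p * A) v := by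
  rw [cc, ← sum_frame hP]
  refine Finset.sum_congr rfl fun i _ => ?_
  simp only [dm_eq_sum, Finset.sum_mul, Matrix.smul_mul]
  rw [bl_sum_left]
  refine Finset.sum_congr rfl fun a _ => ?_
  rw [bl_eq_vecMul, Finset.mul_sum]
  exact Finset.sum_congr rfl fun b _ => by ring

lemma sum_bl_dm_dm_frame (hg : SmoothMetricFamily g (Iio T)) (hp : p.2 < T)
    {H : Matrix (Fin n) (Fin n) ℝ} {P : Fin n → Fin n → ℝ}
    (hP : ∀ a b, ∑ i, P i a * P i b = H a b) (v : Fin n → ℝ) :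
    ∑ i, bl (dm (P i, 0) (dm (P i, 0) (gm g)) p) v v =
      ∑ a, ∑ b, H a b * bl (dm (ex a) (dm (ex b) (gm g)) p) v v := by
  rw [← sum_frame hP]
  refine Finset.sum_congr rfl fun i _ => ?_
  have h : dm (P i, 0) (dm (P i, 0) (gm g)) p =
      ∑ a, P i a • ∑ b, P i b • dm (ex a) (dm (ex b) (gm g)) p := by
    ext j k
    simp only [Matrix.sum_apply, Matrix.smul_apply, smul_eq_mul, Finset.mul_sum]
    refine (dd_dd_eq_sum (msmooth_gm hg j k) (P i) hp).trans ?_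
    exact Finset.sum_congr rfl fun a _ => Finset.sum_congr rfl fun b _ => mul_assoc _ _ _
  rw [h, bl_sum_left]
  refine Finset.sum_congr rfl fun a _ => ?_
  rw [bl_sum_left, Finset.mul_sum]
  exact Finset.sum_congr rfl fun b _ => by ring

lemma dm_smul_dir (F : (Fin n → ℝ) × ℝ → Matrix (Fin n) (Fin n) ℝ) (c : ℝ) (ξ : Fin n → ℝ) :
    dm (c • ξ, 0) F p = c • dm (ξ, 0) F p := by
  simp only [dm_eq_sum, Finset.smul_sum, smul_smul, Pi.smul_apply, smul_eq_mul]

lemma dm_dm_smul_dir (hg : SmoothMetricFamily g (Iio T)) (hp : p.2 < T) (c : ℝ) (ξ : Fin n → ℝ) :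
    dm (c • ξ, 0) (dm (c • ξ, 0) (gm g)) p = c ^ 2 • dm (ξ, 0) (dm (ξ, 0) (gm g)) p := by
  ext j k
  refine (dd_dd_eq_sum (msmooth_gm hg j k) (c • ξ) hp).trans ?_
  rw [Matrix.smul_apply, smul_eq_mul]
  refine Eq.trans ?_ (congrArg (c ^ 2 * ·) (dd_dd_eq_sum (msmooth_gm hg j k) ξ hp).symm)
  simp only [Finset.mul_sum, Pi.smul_apply, smul_eq_mul]
  exact Finset.sum_congr rfl fun a _ => Finset.sum_congr rfl fun b _ => by ring

lemma bl_smul_matrix (M : Matrix (Fin n) (Fin n) ℝ) (c : ℝ) (v w : Fin n → ℝ) :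
    bl (c • M) v w = c * bl M v w := by
  rw [bl, Matrix.smul_mulVec, dotProduct_smul, smul_eq_mul]; rfl

/-- The traced second variation density of a frame `P` scaled by `f`. -/
lemma sum_ddqf (hg : SmoothMetricFamily g (Iio T)) (hp : p.2 < T) (v : Fin n → ℝ)
    {P : Fin n → Fin n → ℝ} (hP : ∀ a b, ∑ i, P i a * P i b = hm g p a b) (f f' : ℝ) :
    ∑ i, ddqf g p v (f • P i) (f' • P i - f • (tc g p v *ᵥ P i)) =
      2 * (n * f' ^ 2 - f ^ 2 * bl (ric g p) v v + 2 * f * f' * bl (gm g p) v (zvec g p)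
        + f ^ 2 * (1 / 2 * ∑ l, zvec g p l * bl (dm (ex l) (gm g) p) v v
          + bl (gm g p) v (fun l => dd (v, 0) (fun q => zvec g q l) p))) := by
  have key := second_variation_identity hg hp v
  have e1 := sum_bl_dm_dm_frame hg hp hP v
  have e2 := sum_bl_dm_frame (p := p) hP (gm g) (tc g p v) v
  have e3 := sum_bl_frame hP ((tc g p v)ᵀ * (gm g p * tc g p v))
  have e4 := sum_bl_frame hP (gm g p)
  have e4' : ∑ a, ∑ b, hm g p a b * gm g p a b = n := by
    have h := congrArg Matrix.trace (hm_mul_gm hg hp)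
    rw [Matrix.trace_one, Fintype.card_fin] at h
    rw [← h, Matrix.trace]
    refine Finset.sum_congr rfl fun a _ => ?_
    rw [Matrix.diag_apply, Matrix.mul_apply]
    exact Finset.sum_congr rfl fun b _ => by rw [gm_symm hg hp]
  have e5 := sum_bl_frame hP (gm g p * tc g p v)
  have e6 := sum_bl_dm_frame (p := p) hP (gm g) 1 v
  simp only [Matrix.mul_one] at e6
  have e7 : cc (hm g p) (fun a => dm (ex a) (gm g) p) v =
      (∑ a, ∑ b, hm g p a b * (gm g p * tc g p v) a b) + bl (gm g p) v (zvec g p) := by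
    simp only [dm_gm hg hp]
    rw [cc_add, ← bl_sum_vec, cc_transpose_mul hg hp]
    congr 1
    have h : (tc g p v)ᵀ * gm g p = (gm g p * tc g p v)ᵀ := by
      rw [Matrix.transpose_mul, gm_transpose hg hp]
    rw [h, Finset.sum_comm]
    exact Finset.sum_congr rfl fun a _ => Finset.sum_congr rfl fun b _ => by
      rw [hm_symm hg hp, Matrix.transpose_apply]
  have hterm : ∀ i, ddqf g p v (f • P i) (f' • P i - f • (tc g p v *ᵥ P i)) =
      f ^ 2 * bl (dm (P i, 0) (dm (P i, 0) (gm g)) p) v v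
      + 4 * f * f' * bl (dm (P i, 0) (gm g) p) v (P i)
      - 4 * f ^ 2 * bl (dm (P i, 0) (gm g) p * tc g p v) v (P i)
      + 2 * f' ^ 2 * bl (gm g p) (P i) (P i)
      - 4 * f * f' * bl (gm g p * tc g p v) (P i) (P i)
      + 2 * f ^ 2 * bl ((tc g p v)ᵀ * (gm g p * tc g p v)) (P i) (P i) := by
    intro i
    rw [ddqf, dm_dm_smul_dir hg hp, dm_smul_dir, bl_smul_matrix, bl_smul_matrix, bl_sub_left,
      bl_sub_right, bl_sub_right, bl_sub_right]
    simp only [bl_smul_left, bl_smul_right]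
    rw [bl_comm (gm_transpose hg hp) (tc g p v *ᵥ P i) (P i), bl_mulVec_left, bl_mulVec_right,
      bl_mulVec_right, bl_mulVec_right, Matrix.mul_assoc]
    ring
  simp only [hterm, Finset.sum_add_distrib, Finset.sum_sub_distrib, ← Finset.mul_sum]
  rw [e1, e2, e3, e4, e4', e5, e6, e7]
  linear_combination 2 * f ^ 2 * key

end frameSums

section secondVariation

variable {g : (Fin n → ℝ) → ℝ → Matrix (Fin n) (Fin n) ℝ} {T t a β B t₀ : ℝ} {x : Fin n → ℝ}
  {γ v : ℝ → Fin n → ℝ}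

/-- The second derivative test at a local minimum. -/
lemma IsLocalMin.second_deriv_nonneg {φ φ' : ℝ → ℝ} {c : ℝ} (hmin : IsLocalMin φ 0)
    (hφ : ∀ᶠ ε in 𝓝 0, HasDerivAt φ (φ' ε) ε) (hφ' : HasDerivAt φ' c 0) : 0 ≤ c := by
  by_contra! hc
  have hd : deriv φ =ᶠ[𝓝 0] φ' := hφ.mono fun ε h => h.deriv
  have h2 : deriv (deriv φ) 0 = c := by rw [hd.deriv_eq, hφ'.deriv]
  have h1 : deriv φ 0 = 0 := hmin.deriv_eq_zero
  have hmax : IsLocalMin (fun ε => -φ ε) 0 := by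
    have e1 : deriv (fun ε => -φ ε) = fun ε => -deriv φ ε := by funext ε; exact deriv.fun_neg
    refine isLocalMin_of_deriv_deriv_pos ?_ ?_ hφ.self_of_nhds.continuousAt.neg
    · rw [e1, deriv.fun_neg, h2]; linarith
    · rw [e1]; simp [h1]
  have hconst : φ =ᶠ[𝓝 0] fun _ => φ 0 := by
    filter_upwards [hmin, hmax] with ε h h'
    linarith
  have h3 : deriv φ =ᶠ[𝓝 0] fun _ => 0 := by
    have := hconst.deriv
    simpa using this
  rw [h3.deriv_eq, deriv_const] at h2
  exact hc.ne h2.symm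

lemma hasDerivAt_Erg (hg : SmoothMetricFamily g (Iio T)) (ht : t < T) (hγ : Continuous γ)
    (hv : Continuous v) {ξ η : ℝ → Fin n → ℝ} (hξ : Continuous ξ) (hη : Continuous η) (ε : ℝ) :
    HasDerivAt (fun ε : ℝ => Erg g t (fun s => γ s + ε • ξ s) (fun s => v s + ε • η s))
      (1 / 2 * ∫ s in (0 : ℝ)..1, dqf g (γ s + ε • ξ s, t) (v s + ε • η s) (ξ s) (η s)) ε := by
  refine (hasDerivAt_integral_of_continuousOn isOpen_univ (mem_univ ε)
    (φ := fun ε s => qf g (γ s + ε • ξ s, t) (v s + ε • η s))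
    (φ' := fun ε s => dqf g (γ s + ε • ξ s, t) (v s + ε • η s) (ξ s) (η s))
    (fun r _ => (continuous_qf hg ht).comp (f := fun s => (γ s + r • ξ s, v s + r • η s))
      (by fun_prop)) ?_ (fun r _ s => hasDerivAt_qf hg ht _ _ _ _ _)).const_mul _
  exact (continuous_dqf hg ht (by fun_prop) (by fun_prop) (by fun_prop)
    (by fun_prop)).continuousOn

lemma hasDerivAt_dErg (hg : SmoothMetricFamily g (Iio T)) (ht : t < T) (hγ : Continuous γ)
    (hv : Continuous v) {ξ η : ℝ → Fin n → ℝ} (hξ : Continuous ξ) (hη : Continuous η) (ε : ℝ) :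
    HasDerivAt (fun ε : ℝ => 1 / 2 *
        ∫ s in (0 : ℝ)..1, dqf g (γ s + ε • ξ s, t) (v s + ε • η s) (ξ s) (η s))
      (1 / 2 * ∫ s in (0 : ℝ)..1, ddqf g (γ s + ε • ξ s, t) (v s + ε • η s) (ξ s) (η s)) ε := by
  refine (hasDerivAt_integral_of_continuousOn isOpen_univ (mem_univ ε)
    (φ := fun ε s => dqf g (γ s + ε • ξ s, t) (v s + ε • η s) (ξ s) (η s))
    (φ' := fun ε s => ddqf g (γ s + ε • ξ s, t) (v s + ε • η s) (ξ s) (η s))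
    (fun r _ => continuous_dqf hg ht (by fun_prop) (by fun_prop) hξ hη) ?_
    (fun r _ s => hasDerivAt_dqf hg ht _ _ _ _ _)).const_mul _
  exact (continuous_ddqf hg ht (by fun_prop) (by fun_prop) (by fun_prop)
    (by fun_prop)).continuousOn

/-- The second variation of `Gn` at a minimising path is nonnegative. -/
lemma MinPath.second_variation (hg : SmoothMetricFamily g (Iio T)) (ht : t < T)
    (h : MinPath g a β B t₀ x t γ v) {ξ η : ℝ → Fin n → ℝ} (hξ : Continuous ξ)
    (hη : Continuous η) (hξ0 : ξ 0 = 0) (hd : ∀ s ∈ Ioo (0 : ℝ) 1, HasDerivAt ξ (η s) s) :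
    0 ≤ dd (ξ 1, 0) (dd (ξ 1, 0) (scal g)) (γ 1, t)
      + 2 * β / (B - Erg g t γ v) ^ 3 *
        (1 / 2 * ∫ s in (0 : ℝ)..1, ddqf g (γ s, t) (v s) (ξ s) (η s))
      + 6 * β / (B - Erg g t γ v) ^ 4 *
        (1 / 2 * ∫ s in (0 : ℝ)..1, dqf g (γ s, t) (v s) (ξ s) (η s)) ^ 2 := by
  set e : ℝ → ℝ := fun ε => Erg g t (fun s => γ s + ε • ξ s) (fun s => v s + ε • η s) with he
  set e' : ℝ → ℝ := fun ε => 1 / 2 *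
    ∫ s in (0 : ℝ)..1, dqf g (γ s + ε • ξ s, t) (v s + ε • η s) (ξ s) (η s) with he'
  have hde : ∀ ε, HasDerivAt e (e' ε) ε := hasDerivAt_Erg hg ht h.contPath h.contVel hξ hη
  have hde' := hasDerivAt_dErg hg ht h.contPath h.contVel hξ hη 0
  have he0 : e 0 = Erg g t γ v := by simp [he]
  have he'0 : e' 0 = 1 / 2 * ∫ s in (0 : ℝ)..1, dqf g (γ s, t) (v s) (ξ s) (η s) := by simp [he']
  have hev : ∀ᶠ ε in 𝓝 (0 : ℝ), e ε < B :=
    (hde 0).continuousAt.eventually_lt continuousAt_const (by rw [he0]; exact h.erg_lt)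
  have hB : e 0 < B := hev.self_of_nhds
  have hR := smooth_scal hg
  set φ : ℝ → ℝ := fun ε => scal g (γ 1 + ε • ξ 1, t) + n / (t - a) + β / (B - e ε) ^ 2 with hφ
  have hmin : IsLocalMin φ 0 := by
    filter_upwards [hev] with ε hε
    have h1 := h.le t h.time (fun s => γ s + ε • ξ s) (fun s => v s + ε • η s)
      (h.contPath.add (hξ.const_smul ε)) (h.contVel.add (hη.const_smul ε))
      (by simp [hξ0, h.start]) (fun s hs => (h.vel s).add ((hd s hs).const_smul ε)) hε
    simpa [hφ, Gn, he] using h1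
  have hφ1 : ∀ᶠ ε in 𝓝 (0 : ℝ), HasDerivAt φ (dd (ξ 1, 0) (scal g) (γ 1 + ε • ξ 1, t) +
      2 * β / (B - e ε) ^ 3 * e' ε) ε := by
    filter_upwards [hev] with ε hε
    exact ((hasDerivAt_line hR ht _ _ _).add_const _).add (hasDerivAt_barrier (hde ε) hε)
  have h3 : HasDerivAt (fun ε => 2 * β / (B - e ε) ^ 3) (6 * β / (B - e 0) ^ 4 * e' 0) 0 := by
    have hne : B - e 0 ≠ 0 := by linarith
    refine ((((hde 0).const_sub B).fun_pow 3).fun_inv (pow_ne_zero 3 hne) |>.const_mul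
      (2 * β)).congr_deriv ?_ |>.congr_of_eventuallyEq ?_
    · field_simp
      push_cast
      ring
    · exact Filter.Eventually.of_forall fun ε => div_eq_mul_inv _ _
  have hφ2 : HasDerivAt (fun ε => dd (ξ 1, 0) (scal g) (γ 1 + ε • ξ 1, t) +
      2 * β / (B - e ε) ^ 3 * e' ε) (dd (ξ 1, 0) (dd (ξ 1, 0) (scal g)) (γ 1 + (0 : ℝ) • ξ 1, t) +
      (6 * β / (B - e 0) ^ 4 * e' 0 * e' 0 + 2 * β / (B - e 0) ^ 3 * (1 / 2 *
        ∫ s in (0 : ℝ)..1, ddqf g (γ s + (0 : ℝ) • ξ s, t) (v s + (0 : ℝ) • η s) (ξ s) (η s)))) 0 :=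
    (hasDerivAt_line (hR.dd (ξ 1, 0)) ht _ _ _).add (h3.mul hde')
  have h4 := hmin.second_deriv_nonneg hφ1 hφ2
  simp only [zero_smul, add_zero] at h4
  rw [he'0, he0] at h4
  linarith

/-- The first variation of the energy at a minimising path. -/
lemma MinPath.first_variation (hg : SmoothMetricFamily g (Iio T)) (ht : t < T)
    (h : MinPath g a β B t₀ x t γ v) {ξ η : ℝ → Fin n → ℝ} (hξ : Continuous ξ)
    (hη : Continuous η) (hξ0 : ξ 0 = 0) (hd : ∀ s ∈ Ioo (0 : ℝ) 1, HasDerivAt ξ (η s) s) :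
    1 / 2 * ∫ s in (0 : ℝ)..1, dqf g (γ s, t) (v s) (ξ s) (η s) =
      bl (gm g (γ 1, t)) (v 1) (ξ 1) := by
  have hf : Continuous fun s => bl (gm g (γ s, t)) (v s) (ξ s) := continuous_bl
    (fun i j => (continuous_slice (msmooth_gm hg i j) ht).comp h.contPath) h.contVel hξ
  have hbl : ∀ s, ∀ w, bl (gm g (γ s, t)) (v s) w = ∑ c, (gm g (γ s, t) *ᵥ v s) c * w c := by
    intro s w
    rw [bl_comm (gm_transpose hg (by exact ht)), bl, dotProduct_comm]; rfl
  have hder : ∀ s ∈ Ioo (0 : ℝ) 1, HasDerivAt (fun s => bl (gm g (γ s, t)) (v s) (ξ s))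
      (1 / 2 * dqf g (γ s, t) (v s) (ξ s) (η s)) s := by
    intro s hs
    simp only [hbl]
    refine (HasDerivAt.fun_sum fun c _ => (h.momentum c s hs).mul
      ((hasDerivAt_pi.1 (hd s hs)) c)).congr_deriv ?_
    rw [dqf, dm_eq_sum, bl_sum_left, hbl, Finset.mul_sum, ← Finset.sum_add_distrib,
      Finset.mul_sum]
    exact Finset.sum_congr rfl fun c _ => by ring
  have hintg := (continuous_dqf hg ht h.contPath h.contVel hξ hη).intervalIntegrable
    (μ := volume) 0 1
  have := intervalIntegral.integral_eq_sub_of_hasDerivAt_of_le zero_le_one hf.continuousOn hder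
    (hintg.const_mul _)
  rw [intervalIntegral.integral_const_mul] at this
  rw [this, hξ0]
  simp [bl]

/-- A minimising path has constant speed. -/
lemma MinPath.speed (hg : SmoothMetricFamily g (Iio T)) (ht : t < T)
    (h : MinPath g a β B t₀ x t γ v) {s : ℝ} (hs : s ∈ Icc (0 : ℝ) 1) :
    qf g (γ s, t) (v s) = 2 * Erg g t γ v := by
  have hc : Continuous fun s => qf g (γ s, t) (v s) :=
    (continuous_qf hg ht).comp (h.contPath.prodMk h.contVel)
  have hq : ∀ s, qf g (γ s, t) (v s) =
      bl (hm g (γ s, t)) (gm g (γ s, t) *ᵥ v s) (gm g (γ s, t) *ᵥ v s) := by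
    intro s
    rw [qf_eq_bl, bl_mulVec_right, hm_mul_gm hg (by exact ht),
      bl_comm (gm_transpose hg (by exact ht)),
      bl, bl, Matrix.one_mulVec, dotProduct_comm]
  have hder : ∀ s ∈ Ioo (0 : ℝ) 1, HasDerivAt (fun s => qf g (γ s, t) (v s)) 0 s := by
    intro s hs
    have hp : ((γ s, t) : (Fin n → ℝ) × ℝ).2 < T := ht
    simp only [hq]
    have hmom : HasDerivAt (fun s => gm g (γ s, t) *ᵥ v s)
        (fun c => 1 / 2 * bl (dm (ex c) (gm g) (γ s, t)) (v s) (v s)) s :=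
      hasDerivAt_pi.2 fun c => h.momentum c s hs
    refine (hasDerivAt_bl (M := fun s => hm g (γ s, t))
      (fun i j => hasDerivAt_along (msmooth_hm hg i j) ht (h.vel s)) hmom hmom
      (M' := dm (v s, 0) (hm g) (γ s, t))).congr_deriv ?_
    have e1 : dm (v s, 0) (hm g) (γ s, t) = -(hm g (γ s, t) * dm (v s, 0) (gm g) (γ s, t) *
        hm g (γ s, t)) := dm_inv _ hp (msmooth_gm hg) (gm_det hg)
    have e2 : bl (dm (v s, 0) (hm g) (γ s, t)) (gm g (γ s, t) *ᵥ v s) (gm g (γ s, t) *ᵥ v s) =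
        -bl (dm (v s, 0) (gm g) (γ s, t)) (v s) (v s) := by
      rw [e1, bl_mulVec_right, bl_mulVec_left, gm_transpose hg hp, Matrix.neg_mul, Matrix.mul_neg,
        bl_neg, Matrix.mul_assoc, hm_mul_gm hg hp, Matrix.mul_one, ← Matrix.mul_assoc,
        gm_mul_hm hg hp, Matrix.one_mul]
    have e3 : ∀ w, bl (hm g (γ s, t)) w (gm g (γ s, t) *ᵥ v s) = ∑ c, w c * v s c := by
      intro w
      rw [bl_mulVec_right, hm_mul_gm hg hp, bl, Matrix.one_mulVec]; rfl
    rw [bl_comm (hm_transpose hg hp) (gm g (γ s, t) *ᵥ v s), e2, e3, dm_eq_sum, bl_sum_left,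
      add_assoc, ← two_mul, Finset.mul_sum, ← Finset.sum_neg_distrib, ← Finset.sum_add_distrib]
    exact Finset.sum_eq_zero fun c _ => by ring
  have hconst : ∀ r ∈ Icc (0 : ℝ) 1, qf g (γ r, t) (v r) = qf g (γ 0, t) (v 0) := fun r hr =>
    eq_of_hasDerivAt_zero hc.continuousOn hder hr
  have hE : Erg g t γ v = 1 / 2 * qf g (γ 0, t) (v 0) := by
    rw [Erg, intervalIntegral.integral_congr (g := fun _ => qf g (γ 0, t) (v 0))
      (fun r hr => hconst r (by rwa [uIcc_of_le zero_le_one] at hr))]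
    simp
  rw [hconst s hs, hE]; ring

end secondVariation

section tracedSecondVariation

variable {g : (Fin n → ℝ) → ℝ → Matrix (Fin n) (Fin n) ℝ} {T t a β B t₀ : ℝ} {x : Fin n → ℝ}
  {γ v : ℝ → Fin n → ℝ}

lemma continuous_bl_ric (hg : SmoothMetricFamily g (Iio T)) (ht : t < T) (hγ : Continuous γ)
    (hv : Continuous v) : Continuous fun s => bl (ric g (γ s, t)) (v s) (v s) :=
  continuous_bl (fun i j => (continuous_slice (msmooth_ric hg i j) ht).comp hγ) hv hv

lemma MinPath.integral_sum_ddqf (hg : SmoothMetricFamily g (Iio T)) (ht : t < T)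
    (h : MinPath g a β B t₀ x t γ v) {P : Fin n → ℝ → Fin n → ℝ} (hPc : ∀ i, Continuous (P i))
    (hP : ∀ s ∈ Icc (0 : ℝ) 1, ∀ a b, ∑ i, P i s a * P i s b = hm g (γ s, t) a b)
    {f f' : ℝ → ℝ} (hf : ∀ s, HasDerivAt f (f' s) s) (hf' : Continuous f') (hf0 : f 0 = 0)
    (hf1 : f 1 = 1) :
    ∑ i, (1 / 2 * ∫ s in (0 : ℝ)..1, ddqf g (γ s, t) (v s) (f s • P i s)
      (f' s • P i s - f s • (tc g (γ s, t) (v s) *ᵥ P i s))) =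
      (∫ s in (0 : ℝ)..1, (n * f' s ^ 2 - f s ^ 2 * bl (ric g (γ s, t)) (v s) (v s))) +
        ∑ c, (gm g (γ 1, t) *ᵥ v 1) c * zvec g (γ 1, t) c := by
  have hfc : Continuous f := continuous_iff_continuousAt.2 fun s => (hf s).continuousAt
  have hγ := h.contPath
  have hv := h.contVel
  have hη : ∀ i, Continuous fun s => f' s • P i s - f s • (tc g (γ s, t) (v s) *ᵥ P i s) := by
    intro i
    refine (hf'.smul (hPc i)).sub (hfc.smul (continuous_pi fun j => ?_))
    simp only [Matrix.mulVec, dotProduct]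
    exact continuous_finsetSum _ fun k _ => (continuous_conn_along hg ht hγ hv j k).mul
      ((continuous_apply k).comp (hPc i))
  set D : ℝ → ℝ := fun s => ∑ i, ddqf g (γ s, t) (v s) (f s • P i s)
      (f' s • P i s - f s • (tc g (γ s, t) (v s) *ᵥ P i s)) with hD
  have hdc : ∀ i, Continuous fun s => ddqf g (γ s, t) (v s) (f s • P i s)
      (f' s • P i s - f s • (tc g (γ s, t) (v s) *ᵥ P i s)) := fun i =>
    continuous_ddqf hg ht hγ hv (hfc.smul (hPc i)) (hη i)
  have hDc : Continuous D := continuous_finsetSum _ fun i _ => hdc i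
  set N : ℝ → ℝ := fun s => n * f' s ^ 2 - f s ^ 2 * bl (ric g (γ s, t)) (v s) (v s) with hN
  have hNc : Continuous N := (continuous_const.mul (hf'.pow 2)).sub
    ((hfc.pow 2).mul (continuous_bl_ric hg ht hγ hv))
  set Q : ℝ → ℝ := fun s => ∑ c, (gm g (γ s, t) *ᵥ v s) c * zvec g (γ s, t) c with hQ
  have hbl : ∀ s, ∀ w, bl (gm g (γ s, t)) (v s) w = ∑ c, (gm g (γ s, t) *ᵥ v s) c * w c := by
    intro s w
    rw [bl_comm (gm_transpose hg (by exact ht)), bl, dotProduct_comm]; rfl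
  have hQc : Continuous Q := by
    refine continuous_finsetSum _ fun c _ => Continuous.mul ?_
      ((continuous_slice (smooth_zvec hg c) ht).comp hγ)
    simp only [Matrix.mulVec, dotProduct]
    exact continuous_finsetSum _ fun k _ =>
      ((continuous_slice (msmooth_gm hg c k) ht).comp hγ).mul ((continuous_apply k).comp hv)
  have hQd : ∀ s ∈ Ioo (0 : ℝ) 1, HasDerivAt (fun s => f s ^ 2 * Q s) (1 / 2 * D s - N s) s := by
    intro s hs
    have hp : ((γ s, t) : (Fin n → ℝ) × ℝ).2 < T := ht
    have h1 : HasDerivAt Q (1 / 2 * ∑ l, zvec g (γ s, t) l * bl (dm (ex l) (gm g) (γ s, t))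
          (v s) (v s)
          + bl (gm g (γ s, t)) (v s) (fun l => dd (v s, 0) (fun q => zvec g q l) (γ s, t))) s := by
      refine (HasDerivAt.fun_sum fun c _ => (h.momentum c s hs).mul
        (hasDerivAt_along (smooth_zvec hg c) ht (h.vel s))).congr_deriv ?_
      rw [hbl, Finset.mul_sum, ← Finset.sum_add_distrib]
      exact Finset.sum_congr rfl fun c _ => by ring
    refine (((hf s).fun_pow 2).mul h1).congr_deriv ?_
    simp only [hD, hN, hQ]
    rw [sum_ddqf hg hp (v s) (hP s (Ioo_subset_Icc_self hs)), ← hbl]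
    push_cast
    ring
  have hI := intervalIntegral.integral_eq_sub_of_hasDerivAt_of_le zero_le_one
    ((hfc.pow 2).mul hQc).continuousOn hQd
    (((continuous_const.mul hDc).sub hNc).intervalIntegrable _ _)
  have hD2 : Continuous fun s => 1 / 2 * D s := continuous_const.mul hDc
  rw [intervalIntegral.integral_sub (hD2.intervalIntegrable _ _)
    (hNc.intervalIntegrable _ _), intervalIntegral.integral_const_mul] at hI
  simp only [Pi.mul_apply, Pi.pow_apply, hf0, hf1] at hI
  rw [← Finset.mul_sum, ← intervalIntegral.integral_finsetSum
    fun i _ => (hdc i).intervalIntegrable _ _]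
  linarith

lemma sum_sq_frame (hg : SmoothMetricFamily g (Iio T)) {p : (Fin n → ℝ) × ℝ} (hp : p.2 < T)
    {P : Fin n → Fin n → ℝ} (hP : ∀ a b, ∑ i, P i a * P i b = hm g p a b) (v : Fin n → ℝ) :
    ∑ i, bl (gm g p) v (P i) ^ 2 = qf g p v := by
  have h1 : qf g p v = bl (hm g p) (gm g p *ᵥ v) (gm g p *ᵥ v) := by
    rw [qf_eq_bl, bl_mulVec_right, hm_mul_gm hg hp, bl_comm (gm_transpose hg hp), bl, bl,
      Matrix.one_mulVec, dotProduct_comm]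
  rw [h1, bl_eq_sum]
  have h2 := sum_frame hP fun a b => (gm g p *ᵥ v) a * (gm g p *ᵥ v) b
  simp only [mul_assoc]
  rw [← h2]
  refine Finset.sum_congr rfl fun i _ => ?_
  rw [bl_comm (gm_transpose hg hp), bl, dotProduct, sq, Finset.sum_mul_sum]
  exact Finset.sum_congr rfl fun a _ => Finset.sum_congr rfl fun b _ => by ring

/-- The traced second variation inequality at a minimising path. -/
lemma MinPath.traced_second_variation (hg : SmoothMetricFamily g (Iio T)) (ht : t < T)
    (h : MinPath g a β B t₀ x t γ v) {f f' : ℝ → ℝ} (hf : ∀ s, HasDerivAt f (f' s) s)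
    (hf' : Continuous f') (hf0 : f 0 = 0) (hf1 : f 1 = 1) :
    0 ≤ lapScal g (γ 1, t) + 2 * β / (B - Erg g t γ v) ^ 3 *
        (∫ s in (0 : ℝ)..1, (n * f' s ^ 2 - f s ^ 2 * bl (ric g (γ s, t)) (v s) (v s)))
      + 6 * β / (B - Erg g t γ v) ^ 4 * (2 * Erg g t γ v) := by
  have hp1 : ((γ 1, t) : (Fin n → ℝ) × ℝ).2 < T := ht
  have hfc : Continuous f := continuous_iff_continuousAt.2 fun s => (hf s).continuousAt
  obtain ⟨P, hPc, hPd, hP⟩ := exists_parallel_frame hg ht h.contPath h.contVel h.vel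
  have hη : ∀ i, Continuous fun s => f' s • P i s - f s • (tc g (γ s, t) (v s) *ᵥ P i s) := by
    intro i
    refine (hf'.smul (hPc i)).sub (hfc.smul (continuous_pi fun j => ?_))
    simp only [Matrix.mulVec, dotProduct]
    exact continuous_finsetSum _ fun k _ =>
      (continuous_conn_along hg ht h.contPath h.contVel j k).mul
      ((continuous_apply k).comp (hPc i))
  have hξ : ∀ i, Continuous fun s => f s • P i s := fun i => hfc.smul (hPc i)
  have hξd : ∀ i, ∀ s ∈ Ioo (0 : ℝ) 1, HasDerivAt (fun s => f s • P i s)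
      (f' s • P i s - f s • (tc g (γ s, t) (v s) *ᵥ P i s)) s := by
    intro i s hs
    refine ((hf s).fun_smul (hPd i s hs)).congr_deriv ?_
    rw [smul_neg]; abel
  have hξ0 : ∀ i, f 0 • P i 0 = 0 := fun i => by rw [hf0, zero_smul]
  have hsum := Finset.sum_nonneg fun i (_ : i ∈ Finset.univ) =>
    h.second_variation hg ht (hξ i) (hη i) (hξ0 i) (hξd i)
  have h1 : ∀ i, _ := fun i => h.first_variation hg ht (hξ i) (hη i) (hξ0 i) (hξd i)
  simp only [h1] at hsum
  simp only [Finset.sum_add_distrib, ← Finset.mul_sum] at hsum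
  rw [Finset.mul_sum, h.integral_sum_ddqf hg ht hPc hP hf hf' hf0 hf1] at hsum
  simp only [hf1, one_smul] at hsum
  rw [sum_sq_frame hg hp1 (hP 1 (by simp)), h.speed hg ht (by simp)] at hsum
  have h2 : ∑ i, dd (P i 1, 0) (dd (P i 1, 0) (scal g)) (γ 1, t) =
      ∑ a, ∑ b, hm g (γ 1, t) a b * dd (ex a) (dd (ex b) (scal g)) (γ 1, t) := by
    rw [← sum_frame (hP 1 (by simp))]
    exact Finset.sum_congr rfl fun i _ => dd_dd_eq_sum (smooth_scal hg) _ hp1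
  have h3 : ∑ a, ∑ b, hm g (γ 1, t) a b * dd (ex a) (dd (ex b) (scal g)) (γ 1, t) =
      lapScal g (γ 1, t) + ∑ c, zvec g (γ 1, t) c * dd (ex c) (scal g) (γ 1, t) := by
    have h4 : ∑ c, zvec g (γ 1, t) c * dd (ex c) (scal g) (γ 1, t) = ∑ a, ∑ b,
        hm g (γ 1, t) a b * ∑ c, conn g a (γ 1, t) c b * dd (ex c) (scal g) (γ 1, t) := by
      simp only [zvec, Finset.sum_mul, Finset.mul_sum]
      rw [Finset.sum_comm]
      refine Finset.sum_congr rfl fun a _ => ?_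
      rw [Finset.sum_comm]
      exact Finset.sum_congr rfl fun b _ => Finset.sum_congr rfl fun c _ => by ring
    rw [h4, lapScal, ← Finset.sum_add_distrib]
    refine Finset.sum_congr rfl fun a _ => ?_
    rw [← Finset.sum_add_distrib]
    refine Finset.sum_congr rfl fun b _ => ?_
    rw [show dd (ex b) (scal g) = fun q => dd (ex b) (scal g) q from rfl]
    ring
  have h5 : 2 * β / (B - Erg g t γ v) ^ 3 *
      ∑ c, (gm g (γ 1, t) *ᵥ v 1) c * zvec g (γ 1, t) c =
      -∑ c, zvec g (γ 1, t) c * dd (ex c) (scal g) (γ 1, t) := by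
    rw [Finset.mul_sum, ← Finset.sum_neg_distrib]
    refine Finset.sum_congr rfl fun c _ => ?_
    linear_combination zvec g (γ 1, t) c * h.endpoint c
  rw [h2, h3, mul_add, h5] at hsum
  linarith

end tracedSecondVariation

section timeDerivative

variable {g : (Fin n → ℝ) → ℝ → Matrix (Fin n) (Fin n) ℝ} {T t a β B t₀ : ℝ} {x : Fin n → ℝ}
  {γ v : ℝ → Fin n → ℝ}

lemma hasDerivAt_Erg_time (hg : SmoothMetricFamily g (Iio T)) (hflow : IsRicciFlow g (Iio T))
    (ht : t < T) (hγ : Continuous γ) (hv : Continuous v) :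
    HasDerivAt (fun r => Erg g r γ v)
      (-∫ s in (0 : ℝ)..1, bl (ric g (γ s, t)) (v s) (v s)) t := by
  have h := hasDerivAt_integral_of_continuousOn (U := Iio T) (ε := t)
    (φ := fun r s => qf g (γ s, r) (v s))
    (φ' := fun r s => -2 * bl (ric g (γ s, r)) (v s) (v s)) isOpen_Iio ht ?_ ?_ ?_
  · refine (h.const_mul (1 / 2)).congr_deriv ?_
    rw [intervalIntegral.integral_const_mul]; ring
  · intro r hr
    exact (continuous_qf hg hr).comp (hγ.prodMk hv)
  · refine continuousOn_const.mul ?_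
    simp only [bl_eq_sum]
    refine continuousOn_finsetSum _ fun i _ => continuousOn_finsetSum _ fun j _ => ?_
    refine (ContinuousOn.mul ?_ ?_).mul ?_
    · exact (msmooth_ric hg i j).continuousOn.comp
        (f := fun z : ℝ × ℝ => ((γ z.2, z.1) : (Fin n → ℝ) × ℝ)) (by fun_prop)
        fun z hz => mem_dom.2 hz.1
    · exact (by fun_prop : Continuous fun z : ℝ × ℝ => v z.2 i).continuousOn
    · exact (by fun_prop : Continuous fun z : ℝ × ℝ => v z.2 j).continuousOn
  · intro r hr s
    have hp : ((γ s, r) : (Fin n → ℝ) × ℝ).2 < T := hr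
    simp only [qf_eq_bl]
    refine (hasDerivAt_bl (M := fun r => gm g (γ s, r)) (M' := dm et (gm g) (γ s, r)) (fun i j =>
      hasDerivAt_dd_time ((msmooth_gm hg i j).differentiableAt hp))
      (hasDerivAt_const r (v s)) (hasDerivAt_const r (v s))).congr_deriv ?_
    rw [dm_time_gm hg hflow hp, bl_smul_matrix]
    simp [bl]

lemma MinPath.time_derivative (hg : SmoothMetricFamily g (Iio T))
    (hflow : IsRicciFlow g (Iio T)) (ht₀ : t₀ < T) (h : MinPath g a β B t₀ x t γ v) :
    dd et (scal g) (γ 1, t) ≤ n / (t - a) ^ 2 + 2 * β / (B - Erg g t γ v) ^ 3 *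
      ∫ s in (0 : ℝ)..1, bl (ric g (γ s, t)) (v s) (v s) := by
  have ht : t < T := h.time.2.trans_lt ht₀
  have hta : t - a ≠ 0 := (sub_pos.2 h.time.1).ne'
  have hp : ((γ 1, t) : (Fin n → ℝ) × ℝ).2 < T := ht
  have hE := hasDerivAt_Erg_time hg hflow ht h.contPath h.contVel
  have hd : HasDerivAt (fun r => Gn g a β B r γ v)
      (dd et (scal g) (γ 1, t) + -(n / (t - a) ^ 2) + 2 * β / (B - Erg g t γ v) ^ 3 *
        -∫ s in (0 : ℝ)..1, bl (ric g (γ s, t)) (v s) (v s)) t := by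
    refine ((hasDerivAt_dd_time ((smooth_scal hg).differentiableAt hp)).add ?_).add
      (hasDerivAt_barrier (β := β) hE h.erg_lt)
    refine ((hasDerivAt_const t (n : ℝ)).div ((hasDerivAt_id t).sub_const a) hta).congr_deriv ?_
    simp [neg_div]
  have hle : dd et (scal g) (γ 1, t) + -(n / (t - a) ^ 2) + 2 * β / (B - Erg g t γ v) ^ 3 *
        -∫ s in (0 : ℝ)..1, bl (ric g (γ s, t)) (v s) (v s) ≤ 0 := by
    have h1 := (hasDerivAt_iff_tendsto_slope.1 hd).mono_left
      (nhdsWithin_mono t (fun r (hr : r < t) => (hr.ne : r ≠ t)) : 𝓝[<] t ≤ 𝓝[≠] t)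
    refine le_of_tendsto h1 ?_
    have h2 : ∀ᶠ r in 𝓝[<] t, Erg g r γ v < B :=
      (hE.continuousAt.eventually_lt continuousAt_const h.erg_lt).filter_mono nhdsWithin_le_nhds
    filter_upwards [h2, Ioo_mem_nhdsLT h.time.1] with r hr1 hr2
    have h3 := h.le r ⟨hr2.1, hr2.2.le.trans h.time.2⟩ γ v h.contPath h.contVel h.start
      (fun s _ => h.vel s) hr1
    rw [slope_def_field]
    exact div_nonpos_of_nonneg_of_nonpos (sub_nonneg.2 h3) (sub_nonpos.2 hr2.2.le)
  linarith

/-- The differential inequality at the endpoint of a minimising path. -/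
lemma MinPath.scal_sq_le (hg : SmoothMetricFamily g (Iio T)) (hn : 0 < n)
    (hflow : IsRicciFlow g (Iio T)) (ht₀ : t₀ < T) (h : MinPath g a β B t₀ x t γ v)
    {f f' : ℝ → ℝ} (hf : ∀ s, HasDerivAt f (f' s) s) (hf' : Continuous f') (hf0 : f 0 = 0)
    (hf1 : f 1 = 1) :
    2 / n * scal g (γ 1, t) ^ 2 ≤ n / (t - a) ^ 2 + 2 * β / (B - Erg g t γ v) ^ 3 *
      (∫ s in (0 : ℝ)..1, (n * f' s ^ 2 + (1 - f s ^ 2) * bl (ric g (γ s, t)) (v s) (v s))) +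
      12 * β * Erg g t γ v / (B - Erg g t γ v) ^ 4 := by
  have ht : t < T := h.time.2.trans_lt ht₀
  have hp : ((γ 1, t) : (Fin n → ℝ) × ℝ).2 < T := ht
  have hfc : Continuous f := continuous_iff_continuousAt.2 fun s => (hf s).continuousAt
  have hr := continuous_bl_ric hg ht h.contPath h.contVel
  have h1 := h.time_derivative hg hflow ht₀
  have h2 := h.traced_second_variation hg ht hf hf' hf0 hf1
  have h3 := dd_time_scal hg hflow hp
  have h4 := _root_.scal_sq_le hg hflow hp
  have h5 : ∫ s in (0 : ℝ)..1, (n * f' s ^ 2 + (1 - f s ^ 2) * bl (ric g (γ s, t)) (v s) (v s)) =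
      (∫ s in (0 : ℝ)..1, (n * f' s ^ 2 - f s ^ 2 * bl (ric g (γ s, t)) (v s) (v s))) +
      ∫ s in (0 : ℝ)..1, bl (ric g (γ s, t)) (v s) (v s) := by
    rw [← intervalIntegral.integral_add _ (hr.intervalIntegrable _ _)]
    · exact intervalIntegral.integral_congr fun s _ => by ring
    · exact ((continuous_const.mul (hf'.pow 2)).sub
        ((hfc.pow 2).mul hr)).intervalIntegrable _ _
  have hn' : (0 : ℝ) < n := Nat.cast_pos.2 hn
  have h6 : 2 / n * scal g (γ 1, t) ^ 2 ≤
      2 * (ric g (γ 1, t) * hm g (γ 1, t) * ric g (γ 1, t) * hm g (γ 1, t)).trace := by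
    rw [div_mul_eq_mul_div, div_le_iff₀ hn']; linarith
  have h7 : 12 * β * Erg g t γ v / (B - Erg g t γ v) ^ 4 =
      6 * β / (B - Erg g t γ v) ^ 4 * (2 * Erg g t γ v) := by ring
  rw [h5, h7, mul_add]
  linarith

end timeDerivative

section cutoff

lemma hasDerivAt_max_zero_sq (x : ℝ) :
    HasDerivAt (fun y : ℝ => max 0 y ^ 2) (2 * max 0 x) x := by
  refine hasDerivAt_of_hasDerivAt_of_ne' (g := fun y : ℝ => 2 * max 0 y) (x := 0)
    (fun y hy => ?_) (by fun_prop) (by fun_prop) x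
  rcases hy.lt_or_gt with hy | hy
  · rw [max_eq_left hy.le, mul_zero]
    refine (hasDerivAt_const y (0 : ℝ)).congr_of_eventuallyEq ?_
    filter_upwards [gt_mem_nhds hy] with z hz
    rw [max_eq_left (le_of_lt hz)]; norm_num
  · rw [max_eq_right hy.le]
    refine ((hasDerivAt_pow 2 y).congr_deriv (by simp)).congr_of_eventuallyEq ?_
    filter_upwards [lt_mem_nhds hy] with z hz
    rw [max_eq_right (le_of_lt hz)]

lemma hasDerivAt_cutoff (σ s : ℝ) : HasDerivAt (fun s : ℝ => 1 - max 0 (1 - s / σ) ^ 2)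
    (2 / σ * max 0 (1 - s / σ)) s := by
  have h1 : HasDerivAt (fun s : ℝ => 1 - s / σ) (-(1 / σ)) s :=
    ((hasDerivAt_id s).div_const σ).const_sub 1
  refine (((hasDerivAt_max_zero_sq (1 - s / σ)).comp s h1).const_sub 1).congr_deriv ?_
  ring

end cutoff

section lowerBound

variable {g : (Fin n → ℝ) → ℝ → Matrix (Fin n) (Fin n) ℝ} {T t a β B t₀ : ℝ} {x : Fin n → ℝ}
  {γ v : ℝ → Fin n → ℝ}

lemma Erg_nonneg (hg : SmoothMetricFamily g (Iio T)) (ht : t < T) : 0 ≤ Erg g t γ v :=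
  mul_nonneg (by norm_num) (intervalIntegral.integral_nonneg zero_le_one fun _ _ =>
    qf_nonneg hg (by exact ht) _)

/-- The Ricci curvature is bounded along the initial part of minimising paths. -/
lemma exists_ric_bound (hg : SmoothMetricFamily g (Iio T)) (ht₀ : t₀ < T) (a : ℝ)
    (x : Fin n → ℝ) :
    ∃ r > 0, ∃ K, 0 ≤ K ∧ ∀ {β B t : ℝ} {γ v : ℝ → Fin n → ℝ}, MinPath g a β B t₀ x t γ v →
      ∀ s ∈ Icc (0 : ℝ) 1, s * √(2 * B) < r →
        bl (ric g (γ s, t)) (v s) (v s) ≤ K * (2 * B) := by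
  obtain ⟨r, hr, hstay⟩ := exists_short_paths_stay (a := a) hg ht₀ x zero_lt_one
  have hK : IsCompact (Metric.closedBall x 1 ×ˢ Icc a t₀) :=
    (isCompact_closedBall _ _).prod isCompact_Icc
  have hKT : Metric.closedBall x 1 ×ˢ Icc a t₀ ⊆ dom n T :=
    fun p hp => mem_dom.2 (hp.2.2.trans_lt ht₀)
  obtain ⟨m, hm0, hm⟩ := exists_le_qf hg hK hKT
  obtain ⟨C, hC0, hC⟩ := (msmooth_ric hg).exists_bound hK hKT
  refine ⟨r, hr, n ^ 2 * C / m, by positivity, fun {β B t γ v} h s hs hsr => ?_⟩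
  have htT : t < T := h.time.2.trans_lt ht₀
  have htI : t ∈ Icc a t₀ := Ioc_subset_Icc_self h.time
  have hsE : s * √(2 * Erg g t γ v) < r :=
    (mul_le_mul_of_nonneg_left (Real.sqrt_le_sqrt (by linarith [h.erg_lt])) hs.1).trans_lt hsr
  obtain ⟨w, hw, hwp, hwv, -⟩ := exists_adm (g := g) h.contPath h.contVel fun s _ => h.vel s
  rw [h.start] at hwp
  have hlen : len g t x w 0 s = s * √(2 * Erg g t γ v) := by
    rw [len]
    have h1 : ∫ q in (0 : ℝ)..s, nm g (pth x w q, t) (w q) =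
        ∫ q in (0 : ℝ)..s, √(2 * Erg g t γ v) := by
      refine intervalIntegral.integral_congr_ae (Filter.Eventually.of_forall fun q hq => ?_)
      rw [uIoc_of_le hs.1] at hq
      have hq1 : q ∈ Ioc (0 : ℝ) 1 := ⟨hq.1, hq.2.trans hs.2⟩
      rw [hwv q hq1, hwp q (Ioc_subset_Icc_self hq1), nm,
        h.speed hg htT (Ioc_subset_Icc_self hq1)]
    rw [h1, intervalIntegral.integral_const, sub_zero, smul_eq_mul]
  have hball := hstay t htI w hw.1 s hs.1 (hlen ▸ hsE)
  rw [hwp s hs] at hball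
  have hmem : ((γ s, t) : (Fin n → ℝ) × ℝ) ∈ Metric.closedBall x 1 ×ˢ Icc a t₀ :=
    ⟨by simpa [dist_eq_norm] using hball.le, htI⟩
  have h1 := le_of_abs_le (abs_sum_le_norm_sq (hC _ hmem) (v s))
  rw [← bl_eq_sum] at h1
  have h2 : ‖v s‖ ^ 2 ≤ 2 * B / m := by
    rw [le_div_iff₀ hm0, mul_comm]
    have h3 := hm _ hmem (v s)
    rw [h.speed hg htT hs] at h3
    linarith [h.erg_lt]
  calc bl (ric g (γ s, t)) (v s) (v s) ≤ n ^ 2 * C * ‖v s‖ ^ 2 := h1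
    _ ≤ n ^ 2 * C * (2 * B / m) := by gcongr
    _ = n ^ 2 * C / m * (2 * B) := by ring

lemma MinPath.scal_sq_le_of_bound (hg : SmoothMetricFamily g (Iio T)) (hn : 0 < n)
    (hflow : IsRicciFlow g (Iio T)) (ht₀ : t₀ < T) (h : MinPath g a β B t₀ x t γ v) {σ L : ℝ}
    (hσ : σ ∈ Ioc (0 : ℝ) 1) (hβ : 0 < β) (hL : 0 ≤ L)
    (hb : ∀ s ∈ Icc 0 σ, bl (ric g (γ s, t)) (v s) (v s) ≤ L) :
    2 / n * scal g (γ 1, t) ^ 2 ≤ n / (t - a) ^ 2 + 2 * β / (B - Erg g t γ v) ^ 3 *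
      (4 * n / σ + L * σ) + 12 * β * Erg g t γ v / (B - Erg g t γ v) ^ 4 := by
  have ht : t < T := h.time.2.trans_lt ht₀
  have hD : 0 < B - Erg g t γ v := sub_pos.2 h.erg_lt
  set f : ℝ → ℝ := fun s => 1 - max 0 (1 - s / σ) ^ 2 with hf
  set f' : ℝ → ℝ := fun s => 2 / σ * max 0 (1 - s / σ) with hf'
  have hf'c : Continuous f' := by fun_prop
  have hfc : Continuous f := by fun_prop
  have h1 : 1 - 1 / σ ≤ 0 := by
    rw [sub_nonpos, one_le_div hσ.1]; exact hσ.2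
  refine (h.scal_sq_le hg hn hflow ht₀ (hasDerivAt_cutoff σ) hf'c (by simp)
    (by simp only [max_eq_left h1]; norm_num)).trans ?_
  set D : ℝ → ℝ := fun s => n * f' s ^ 2 + (1 - f s ^ 2) * bl (ric g (γ s, t)) (v s) (v s) with hDd
  have hDc : Continuous D := (continuous_const.mul (hf'c.pow 2)).add
    ((continuous_const.sub (hfc.pow 2)).mul (continuous_bl_ric hg ht h.contPath h.contVel))
  have h2 : ∫ s in (0 : ℝ)..1, D s ≤ 4 * n / σ + L * σ := by
    rw [← intervalIntegral.integral_add_adjacent_intervals (hDc.intervalIntegrable 0 σ)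
      (hDc.intervalIntegrable σ 1)]
    have h3 : ∫ s in σ..1, D s = 0 := by
      rw [intervalIntegral.integral_congr (g := fun _ => (0 : ℝ))]
      · simp
      · intro s hs
        rw [uIcc_of_le hσ.2] at hs
        have : 1 - s / σ ≤ 0 := by rw [sub_nonpos, one_le_div hσ.1]; exact hs.1
        simp [hDd, hf, hf', max_eq_left this]
    have h4 : ∫ s in (0 : ℝ)..σ, D s ≤ ∫ s in (0 : ℝ)..σ, (4 * n / σ ^ 2 + L) := by
      refine intervalIntegral.integral_mono_on hσ.1.le (hDc.intervalIntegrable _ _)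
        intervalIntegrable_const fun s hs => ?_
      have h5 : 0 ≤ 1 - s / σ := by rw [sub_nonneg, div_le_one hσ.1]; exact hs.2
      have h6 : 1 - s / σ ≤ 1 := sub_le_self _ (div_nonneg hs.1 hσ.1.le)
      have h7 : f' s ^ 2 ≤ 4 / σ ^ 2 := by
        have : f' s ^ 2 = 4 / σ ^ 2 * (1 - s / σ) ^ 2 := by
          simp only [hf', max_eq_right h5]; ring
        rw [this]
        exact mul_le_of_le_one_right (by positivity) (pow_le_one₀ h5 h6)
      have h8 : f s = 1 - (1 - s / σ) ^ 2 := by simp only [hf, max_eq_right h5]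
      have h9 : (1 - s / σ) ^ 2 ≤ 1 := pow_le_one₀ h5 h6
      have h10 : 0 ≤ f s ∧ f s ≤ 1 := by rw [h8]; constructor <;> nlinarith [sq_nonneg (1 - s / σ)]
      have h11 : 0 ≤ 1 - f s ^ 2 ∧ 1 - f s ^ 2 ≤ 1 :=
        ⟨sub_nonneg.2 (pow_le_one₀ h10.1 h10.2), by nlinarith⟩
      have h12 : (1 - f s ^ 2) * bl (ric g (γ s, t)) (v s) (v s) ≤ L :=
        (mul_le_mul_of_nonneg_left (hb s hs) h11.1).trans (mul_le_of_le_one_left hL h11.2)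
      have h13 : (n : ℝ) * f' s ^ 2 ≤ 4 * n / σ ^ 2 := by
        rw [mul_comm (4 : ℝ), mul_div_assoc]; gcongr
      exact add_le_add h13 h12
    rw [h3, add_zero]
    refine h4.trans (le_of_eq ?_)
    rw [intervalIntegral.integral_const, smul_eq_mul]
    have := hσ.1.ne'
    field_simp
    ring
  gcongr

lemma barrier_contradiction {N τ D E B S J C β : ℝ} (hN : 0 < N) (hτ : 0 < τ) (hD : 0 < D)
    (hE : 0 ≤ E) (hB : D = B - E) (hC : 0 ≤ C) (hJ : J ≤ C) (hβ : β = N * B * (C + 6))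
    (hS : S < -(N / τ + β / D ^ 2))
    (h : 2 / N * S ^ 2 ≤ N / τ ^ 2 + 2 * β / D ^ 3 * J + 12 * β * E / D ^ 4) : False := by
  have hB0 : 0 < B := by linarith
  have hβ0 : 0 < β := by rw [hβ]; positivity
  have h1 : N ^ 2 / τ ^ 2 + β ^ 2 / D ^ 4 ≤ S ^ 2 := by
    have h2 : (N / τ + β / D ^ 2) ^ 2 ≤ S ^ 2 := by
      rw [← neg_sq S]
      exact pow_le_pow_left₀ (by positivity) (by linarith) 2
    refine le_trans ?_ h2
    have h3 : 0 ≤ N / τ * (β / D ^ 2) := by positivity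
    have h4 : (N / τ + β / D ^ 2) ^ 2 =
        N ^ 2 / τ ^ 2 + β ^ 2 / D ^ 4 + 2 * (N / τ * (β / D ^ 2)) := by ring
    linarith
  have h2 : 2 / N * (N ^ 2 / τ ^ 2 + β ^ 2 / D ^ 4) =
      2 * (N / τ ^ 2) + 2 * β / D ^ 4 * (B * (C + 6)) := by
    have : β ^ 2 = β * (N * B * (C + 6)) := by rw [← hβ]; ring
    rw [this]; field_simp
  have h3 : 2 / N * (N ^ 2 / τ ^ 2 + β ^ 2 / D ^ 4) ≤ 2 / N * S ^ 2 := by gcongr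
  have h4 : 2 * β / D ^ 3 * J ≤ 2 * β / D ^ 4 * (B * C) := by
    calc 2 * β / D ^ 3 * J ≤ 2 * β / D ^ 3 * C := by gcongr
      _ = 2 * β / D ^ 4 * (D * C) := by field_simp
      _ ≤ 2 * β / D ^ 4 * (B * C) := by gcongr; linarith
  have h5 : 12 * β * E / D ^ 4 ≤ 2 * β / D ^ 4 * (B * 6) := by
    rw [show 12 * β * E / D ^ 4 = 2 * β / D ^ 4 * (E * 6) by ring]
    gcongr; linarith
  have h6 : 2 * β / D ^ 4 * (B * (C + 6)) =
      2 * β / D ^ 4 * (B * C) + 2 * β / D ^ 4 * (B * 6) := by ring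
  have h7 : 0 < N / τ ^ 2 := by positivity
  linarith

lemma scal_ge_of_energy (hg : SmoothMetricFamily g (Iio T)) (hflow : IsRicciFlow g (Iio T))
    (hc : ∀ t ∈ Iio T, riemComplete (fun x => g x t)) (hn : 0 < n) (ha : a < t₀) (ht₀ : t₀ < T)
    (x : Fin n → ℝ) :
    ∃ c : ℝ, ∀ b > 0, -(n / (t₀ - a)) - c * (1 / b ^ 2 + 1 / b) ≤ scal g (x, t₀) := by
  obtain ⟨r, hr, K, hK, hric⟩ := exists_ric_bound hg ht₀ a x
  have hn' : (0 : ℝ) < n := Nat.cast_pos.2 hn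
  refine ⟨2 * n * (4 * n + 6) + 2 * n * (4 * n / r + K * r), fun b hb => ?_⟩
  set B := b ^ 2 / 2 with hB
  have hB0 : 0 < B := by positivity
  have hsq : √(2 * B) = b := by
    rw [hB, mul_div_cancel₀ _ (two_ne_zero), Real.sqrt_sq hb.le]
  set C := 4 * n + b * (4 * n / r + K * r) with hC
  have hC0 : 0 ≤ C := by positivity
  set β := n * B * (C + 6) with hβ
  have hβ0 : 0 < β := by positivity
  obtain ⟨t, γ, v, h⟩ := exists_minPath hg hc hn ha ht₀ hβ0 hB0 x
  have ht : t < T := h.time.2.trans_lt ht₀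
  set σ := r / (r + b) with hσ
  have hσm : σ ∈ Ioc (0 : ℝ) 1 :=
    ⟨by positivity, by rw [hσ, div_le_one (by positivity)]; linarith⟩
  have hσb : σ * b < r := by
    rw [hσ, div_mul_eq_mul_div, div_lt_iff₀ (by positivity)]; nlinarith
  have hJ : 4 * n / σ + K * (2 * B) * σ ≤ C := by
    have h1 : 4 * n / σ = 4 * n + b * (4 * n / r) := by
      rw [hσ]; field_simp
    have h2 : K * (2 * B) * σ ≤ b * (K * r) := by
      rw [show K * (2 * B) * σ = K * b * (σ * b) by rw [hB]; ring]
      calc K * b * (σ * b) ≤ K * b * r := by gcongr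
        _ = b * (K * r) := by ring
    rw [h1, hC]; linarith
  have hmain := h.scal_sq_le_of_bound hg hn hflow ht₀ hσm hβ0
    (by positivity : 0 ≤ K * (2 * B)) fun s hs => by
      refine hric h s ⟨hs.1, hs.2.trans hσm.2⟩ ?_
      rw [hsq]
      exact (mul_le_mul_of_nonneg_right hs.2 hb.le).trans_lt hσb
  have hlow : 0 ≤ scal g (γ 1, t) + n / (t - a) + β / (B - Erg g t γ v) ^ 2 := by
    by_contra! hneg
    exact barrier_contradiction hn' (sub_pos.2 h.time.1) (sub_pos.2 h.erg_lt)
      (Erg_nonneg hg ht) rfl hC0 hJ hβ (by linarith) hmain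
  have hE0 : Erg g t₀ (fun _ => x) (fun _ => 0) = 0 := by simp [Erg, qf]
  have hle := h.le t₀ ⟨ha, le_rfl⟩ (fun _ => x) (fun _ => 0) continuous_const continuous_const rfl
    (fun s _ => hasDerivAt_const s x) (by rw [hE0]; exact hB0)
  rw [Gn, Gn, hE0, sub_zero] at hle
  have hβB : β / B ^ 2 =
      2 * n * (4 * n + 6) * (1 / b ^ 2) + 2 * n * (4 * n / r + K * r) * (1 / b) := by
    rw [hβ, hC, hB]; field_simp; ring
  have h1 : 0 ≤ 2 * n * (4 * n + 6) * (1 / b) := by positivity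
  have h2 : 0 ≤ 2 * n * (4 * n / r + K * r) * (1 / b ^ 2) := by positivity
  rw [hβB] at hle
  linarith

lemma scal_ge (hg : SmoothMetricFamily g (Iio T)) (hflow : IsRicciFlow g (Iio T))
    (hc : ∀ t ∈ Iio T, riemComplete (fun x => g x t)) (hn : 0 < n) (ha : a < t₀) (ht₀ : t₀ < T)
    (x : Fin n → ℝ) : -(n / (t₀ - a)) ≤ scal g (x, t₀) := by
  obtain ⟨c, h⟩ := scal_ge_of_energy hg hflow hc hn ha ht₀ x
  have h1 : Filter.Tendsto (fun b : ℝ => -(n / (t₀ - a)) - c * (1 / b ^ 2 + 1 / b)) Filter.atTop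
      (𝓝 (-(n / (t₀ - a)) - c * (0 + 0))) := by
    refine tendsto_const_nhds.sub (Filter.Tendsto.const_mul c (Filter.Tendsto.add ?_ ?_))
    · exact tendsto_const_nhds.div_atTop (Filter.tendsto_pow_atTop two_ne_zero)
    · exact tendsto_const_nhds.div_atTop Filter.tendsto_id
  simp only [add_zero, mul_zero, sub_zero] at h1
  exact le_of_tendsto h1 ((Filter.eventually_gt_atTop 0).mono h)

lemma scal_nonneg (hg : SmoothMetricFamily g (Iio T)) (hflow : IsRicciFlow g (Iio T))
    (hc : ∀ t ∈ Iio T, riemComplete (fun x => g x t)) (hn : 0 < n) (ht₀ : t₀ < T)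
    (x : Fin n → ℝ) : 0 ≤ scal g (x, t₀) := by
  have h1 : Filter.Tendsto (fun d : ℝ => -(n / d)) Filter.atTop (𝓝 (-0)) :=
    (tendsto_const_nhds.div_atTop Filter.tendsto_id).neg
  rw [neg_zero] at h1
  refine le_of_tendsto h1 ((Filter.eventually_gt_atTop 0).mono fun d hd => ?_)
  simpa using scal_ge (a := t₀ - d) hg hflow hc hn (by linarith) ht₀ x

end lowerBound

/-- Any complete ancient solution to the Ricci flow has nonnegative scalar
curvature (Corollary 2.5). -/
theorem stmt_7 (n : ℕ) (hn : 2 ≤ n) (T : ℝ)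
    (g : (Fin n → ℝ) → ℝ → Matrix (Fin n) (Fin n) ℝ)
    (hg : SmoothMetricFamily g (Iio T)) (hflow : IsRicciFlow g (Iio T))
    (hcomplete : ∀ t ∈ Iio T, riemComplete (fun x => g x t)) :
    ∀ x : Fin n → ℝ, ∀ t ∈ Iio T, 0 ≤ scalarCurv (fun y => g y t) x :=
  fun x _ ht => scal_nonneg hg hflow hcomplete (by omega) ht x

end
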